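/- arXiv:1204.5755 — 2 statements merged into one kernel-verified Lean document; each statement's English description precedes it below -/
import Mathlib

section
/- If every factor of a recurrent infinite binary word w has at most three abelian returns and at least two semi-abelian returns, then one of the two letters is isolated in w, i.e., either 00 or 11 is not a factor of w. -/
/-- The factor of length `n` of the infinite word `w` starting at position `i`. -/
def wordAt {α : Type*} (w : ℕ → α) (i n : ℕ) : List α :=
  (List.range n).map (fun k => w (i + k))

/-- `u` is a factor of the infinite word `w`. -/
def IsFactorW {α : Type*} (w : ℕ → α) (u : List α) : Prop :=
  ∃ i, u = wordAt w i u.length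

/-- `w` is recurrent: every factor occurs infinitely often. -/
def RecurrentW {α : Type*} (w : ℕ → α) : Prop :=
  ∀ u, IsFactorW w u → ∀ N, ∃ i, N ≤ i ∧ u = wordAt w i u.length

/-- `w` is (purely) periodic. -/
def PeriodicW {α : Type*} (w : ℕ → α) : Prop :=
  ∃ T, 0 < T ∧ ∀ n, w (n + T) = w n

/-- `w` is ultimately periodic. -/
def UltPeriodicW {α : Type*} (w : ℕ → α) : Prop :=
  ∃ T, 0 < T ∧ ∃ n₀, ∀ n, n₀ ≤ n → w (n + T) = w n

/-- Two finite words are abelian equivalent: same number of occurrences of each letter. -/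
def AbEquiv {α : Type*} [DecidableEq α] (u v : List α) : Prop :=
  ∀ a : α, u.count a = v.count a

/-- Positions of occurrences of words abelian equivalent to `u` in `w`. -/
def abOcc {α : Type*} [DecidableEq α] (w : ℕ → α) (u : List α) : Set ℕ :=
  {i | AbEquiv (wordAt w i u.length) u}

/-- The semi-abelian returns to (the abelian class of) `u` in `w`: words extending from one
occurrence of the abelian class of `u` to the next one. -/
def semiAbReturns {α : Type*} [DecidableEq α] (w : ℕ → α) (u : List α) : Set (List α) :=
  {r | ∃ i j, i ∈ abOcc w u ∧ j ∈ abOcc w u ∧ i < j ∧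
      (∀ k, i < k → k < j → k ∉ abOcc w u) ∧ r = wordAt w i (j - i)}

/-- Positions of (exact) occurrences of `u` in `w`. -/
def occW {α : Type*} [DecidableEq α] (w : ℕ → α) (u : List α) : Set ℕ :=
  {i | u = wordAt w i u.length}

/-- The ordinary return words of `u` in `w`. -/
def returnWords {α : Type*} [DecidableEq α] (w : ℕ → α) (u : List α) : Set (List α) :=
  {r | ∃ i j, i ∈ occW w u ∧ j ∈ occW w u ∧ i < j ∧
      (∀ k, i < k → k < j → k ∉ occW w u) ∧ r = wordAt w i (j - i)}

/-- `u` has exactly `k` semi-abelian returns in `w`. -/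
def ExactlyKSemiAbReturns {α : Type*} [DecidableEq α] (w : ℕ → α) (u : List α) (k : ℕ) : Prop :=
  ∃ f : Fin k → List α, Function.Injective f ∧ semiAbReturns w u = Set.range f

/-- `u` has exactly `k` abelian returns in `w`: there are `k` pairwise non-abelian-equivalent
representatives so that every semi-abelian return is abelian equivalent to exactly one of them,
and each representative is realized. -/
def ExactlyKAbReturns {α : Type*} [DecidableEq α] (w : ℕ → α) (u : List α) (k : ℕ) : Prop :=
  ∃ f : Fin k → List α,
    (∀ i j, AbEquiv (f i) (f j) → i = j) ∧
    (∀ r ∈ semiAbReturns w u, ∃ i, AbEquiv r (f i)) ∧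
    (∀ i, ∃ r ∈ semiAbReturns w u, AbEquiv r (f i))

/-- `u` has at most `k` abelian returns in `w`. -/
def AtMostKAbReturns {α : Type*} [DecidableEq α] (w : ℕ → α) (u : List α) (k : ℕ) : Prop :=
  ∃ f : Fin k → List α, ∀ r ∈ semiAbReturns w u, ∃ i, AbEquiv r (f i)

/-- `u` has at least `k` abelian returns in `w`. -/
def AtLeastKAbReturns {α : Type*} [DecidableEq α] (w : ℕ → α) (u : List α) (k : ℕ) : Prop :=
  ∃ f : Fin k → List α,
    (∀ i j, AbEquiv (f i) (f j) → i = j) ∧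
    (∀ i, ∃ r ∈ semiAbReturns w u, AbEquiv r (f i))

/-- `u` has at least two semi-abelian returns in `w`. -/
def AtLeastTwoSemiAbReturns {α : Type*} [DecidableEq α] (w : ℕ → α) (u : List α) : Prop :=
  ∃ r₁ r₂, r₁ ∈ semiAbReturns w u ∧ r₂ ∈ semiAbReturns w u ∧ r₁ ≠ r₂

/-- The factor complexity of `w`. -/
noncomputable def complexityW {α : Type*} (w : ℕ → α) (n : ℕ) : ℕ :=
  {u : List α | u.length = n ∧ IsFactorW w u}.ncard

/-- A Sturmian word: aperiodic binary word with factor complexity `n + 1`. -/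
def SturmianW (w : ℕ → Bool) : Prop :=
  ¬ UltPeriodicW w ∧ ∀ n, complexityW w n = n + 1

/-- Right special factor of a binary word. -/
def RightSpecial (w : ℕ → Bool) (B : List Bool) : Prop :=
  IsFactorW w (B ++ [false]) ∧ IsFactorW w (B ++ [true])

/-- Left special factor of a binary word. -/
def LeftSpecial (w : ℕ → Bool) (B : List Bool) : Prop :=
  IsFactorW w (false :: B) ∧ IsFactorW w (true :: B)

/-- Bispecial factor of a binary word. -/
def Bispecial (w : ℕ → Bool) (B : List Bool) : Prop :=
  RightSpecial w B ∧ LeftSpecial w B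

/-- `w` is `c`-balanced. -/
def CBalanced {α : Type*} [DecidableEq α] (w : ℕ → α) (c : ℕ) : Prop :=
  ∀ u v : List α, IsFactorW w u → IsFactorW w v → u.length = v.length →
    ∀ a : α, |((u.count a : ℤ) - (v.count a : ℤ))| ≤ (c : ℤ)

namespace AbelianReturns

/-- The number of letters `true` of `w` before position `n`. -/
def ones (w : ℕ → Bool) : ℕ → ℕ
  | 0 => 0
  | n + 1 => ones w n + (w n).toNat

/-- The window of length `n` at position `i` contains exactly `v` letters `true`. -/
def Occ (w : ℕ → Bool) (n v i : ℕ) : Prop := ones w (i + n) = ones w i + v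

/-- `i < j` are consecutive positions of windows of length `n` with `v` letters `true`. -/
def Consec (w : ℕ → Bool) (n v i j : ℕ) : Prop :=
  i < j ∧ Occ w n v i ∧ Occ w n v j ∧ ∀ k, i < k → k < j → ¬ Occ w n v k

/-- The class of windows of length `n` with `v` letters `true` has a return with `z` letters
`false` and `o` letters `true`. -/
def Ret (w : ℕ → Bool) (n v z o : ℕ) : Prop :=
  ∃ i, Consec w n v i (i + z + o) ∧ ones w (i + z + o) = ones w i + o

/-- Recurrent words all of whose factors have at most three abelian returns and at least two
semi-abelian returns, in terms of window counts. -/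
structure Admissible (w : ℕ → Bool) : Prop where
  recur : ∀ i n N, ∃ j, N ≤ j ∧ ∀ k < n, w (j + k) = w (i + k)
  three : ∀ n v z₁ o₁ z₂ o₂ z₃ o₃ z₄ o₄, 0 < n → Ret w n v z₁ o₁ → Ret w n v z₂ o₂ →
    Ret w n v z₃ o₃ → Ret w n v z₄ o₄ → (z₁ = z₂ ∧ o₁ = o₂) ∨ (z₁ = z₃ ∧ o₁ = o₃) ∨
      (z₁ = z₄ ∧ o₁ = o₄) ∨ (z₂ = z₃ ∧ o₂ = o₃) ∨ (z₂ = z₄ ∧ o₂ = o₄) ∨ (z₃ = z₄ ∧ o₃ = o₄)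
  two : ∀ n v p, 0 < n → Occ w n v p → ∃ i j i' j', Consec w n v i j ∧ Consec w n v i' j' ∧
    ¬ (j + i' = j' + i ∧ ∀ k, i + k < j → w (i + k) = w (i' + k))

section Counting

variable {w : ℕ → Bool}

theorem ones_succ_of_true {i : ℕ} (h : w i = true) : ones w (i + 1) = ones w i + 1 := by
  simp [ones, h]

theorem ones_succ_of_false {i : ℕ} (h : w i = false) : ones w (i + 1) = ones w i := by
  simp [ones, h]

theorem ones_add_le (i n : ℕ) : ones w i ≤ ones w (i + n) ∧ ones w (i + n) ≤ ones w i + n := by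
  induction n with
  | zero => simp
  | succ n ih =>
    have : (w (i + n)).toNat ≤ 1 := Bool.toNat_le _
    rw [← add_assoc, ones]
    omega

theorem ones_bounds {i j : ℕ} (h : i ≤ j) : ones w i ≤ ones w j ∧ ones w j + i ≤ ones w i + j := by
  obtain ⟨n, rfl⟩ := Nat.exists_eq_add_of_le h
  have := ones_add_le (w := w) i n
  omega

theorem ones_add_of_true {i n : ℕ} (h : ∀ k < n, w (i + k) = true) :
    ones w (i + n) = ones w i + n := by
  induction n with
  | zero => rfl
  | succ n ih =>
    rw [← add_assoc, ones_succ_of_true (h n (by omega)), ih fun k hk => h k (by omega)]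
    omega

theorem ones_add_of_false {i n : ℕ} (h : ∀ k < n, w (i + k) = false) :
    ones w (i + n) = ones w i := by
  induction n with
  | zero => rfl
  | succ n ih =>
    rw [← add_assoc, ones_succ_of_false (h n (by omega)), ih fun k hk => h k (by omega)]

theorem ones_congr {w' : ℕ → Bool} {i j n : ℕ} (h : ∀ k < n, w (i + k) = w' (j + k)) :
    ones w (i + n) + ones w' j = ones w i + ones w' (j + n) := by
  induction n with
  | zero => simp
  | succ n ih =>
    have h1 := ih fun k hk => h k (by omega)
    have h2 := h n (by omega)
    rw [← add_assoc, ← add_assoc, ones, ones, h2]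
    omega

theorem ones_not (i : ℕ) : ones (fun k => !w k) i + ones w i = i := by
  induction i with
  | zero => rfl
  | succ n ih =>
    rw [ones, ones]
    cases h : w n <;> (simp; omega)

theorem occ_congr {i j n v m : ℕ} (h : ∀ k < m, w (i + k) = w (j + k)) (l : ℕ) (hl : l + n ≤ m) :
    Occ w n v (i + l) ↔ Occ w n v (j + l) := by
  have := ones_congr (w := w) (w' := w) (i := i + l) (j := j + l) (n := n)
    fun k hk => by simpa [add_assoc] using h (l + k) (by omega)
  unfold Occ
  omega

theorem consec_congr {i i' j n v N : ℕ} (hc : Consec w n v i j)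
    (h : ∀ k < N, w (i' + k) = w (i + k)) (hN : j - i + n ≤ N) :
    Consec w n v i' (i' + (j - i)) := by
  obtain ⟨h1, h2, h3, h4⟩ := hc
  refine ⟨by omega, ?_, ?_, ?_⟩
  · simpa using (occ_congr (n := n) (v := v) h 0 (by omega)).2 (by simpa using h2)
  · rw [occ_congr h (j - i) hN]
    rwa [Nat.add_sub_cancel' h1.le]
  · intro k hk1 hk2 hk
    obtain ⟨l, rfl⟩ := Nat.exists_eq_add_of_lt hk1
    have := (occ_congr (n := n) (v := v) h (l + 1) (by omega)).1 hk
    exact h4 _ (by omega) (by omega) this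

theorem occ_not {n v i : ℕ} (hv : v ≤ n) : Occ (fun k => !w k) n v i ↔ Occ w n (n - v) i := by
  have h1 := ones_not (w := w) i
  have h2 := ones_not (w := w) (i + n)
  unfold Occ
  omega

theorem consec_not {n v i j : ℕ} (hv : v ≤ n) :
    Consec (fun k => !w k) n v i j ↔ Consec w n (n - v) i j := by
  simp only [Consec, occ_not hv]

theorem Occ.le {n v i : ℕ} (h : Occ w n v i) : v ≤ n := by
  have := ones_add_le (w := w) i n
  unfold Occ at h
  omega

theorem Ret.le {n v z o : ℕ} (h : Ret w n v z o) : v ≤ n := by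
  obtain ⟨i, hi, -⟩ := h
  exact hi.2.1.le

theorem Ret.of_not {n v z o : ℕ} (h : Ret (fun k => !w k) n v z o) : Ret w n (n - v) o z := by
  obtain ⟨i, hi, h'⟩ := id h
  rw [consec_not h.le] at hi
  refine ⟨i, by rwa [add_right_comm] at hi, ?_⟩
  have h1 := ones_not (w := w) i
  have h2 := ones_not (w := w) (i + z + o)
  rw [add_right_comm]
  omega

theorem Admissible.not (hw : Admissible w) : Admissible fun k => !w k where
  recur i n N := by
    obtain ⟨j, hj, h⟩ := hw.recur i n N
    exact ⟨j, hj, fun k hk => by rw [h k hk]⟩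
  three n v z₁ o₁ z₂ o₂ z₃ o₃ z₄ o₄ hn h₁ h₂ h₃ h₄ := by
    have := hw.three _ _ _ _ _ _ _ _ _ _ hn h₁.of_not h₂.of_not h₃.of_not h₄.of_not
    tauto
  two n v p hn h := by
    obtain ⟨i, j, i', j', h1, h2, h3⟩ := hw.two n (n - v) p hn ((occ_not h.le).1 h)
    exact ⟨i, j, i', j', (consec_not h.le).2 h1, (consec_not h.le).2 h2, by simpa using h3⟩

theorem Admissible.next (hw : Admissible w) {n v i : ℕ} (h : Occ w n v i) :
    ∃ j, Consec w n v i j := by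
  classical
  have hex : ∃ j, i < j ∧ Occ w n v j := by
    obtain ⟨j, hj, hj'⟩ := hw.recur i n (i + 1)
    exact ⟨j, hj, (occ_congr (l := 0) hj' (by omega)).2 h⟩
  refine ⟨Nat.find hex, (Nat.find_spec hex).1, h, (Nat.find_spec hex).2, fun k hk hk' hk'' => ?_⟩
  exact Nat.find_min hex hk' ⟨hk, hk''⟩

theorem Consec.ret {n v i j : ℕ} (h : Consec w n v i j) :
    Ret w n v (j - i - (ones w j - ones w i)) (ones w j - ones w i) := by
  have h1 := ones_bounds (w := w) h.1.le
  have h2 := h.1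
  have : i + (j - i - (ones w j - ones w i)) + (ones w j - ones w i) = j := by omega
  exact ⟨i, by rwa [this], by rw [this]; omega⟩

theorem ret_of {n v i j z o : ℕ} (h1 : Occ w n v i) (h2 : Occ w n v j) (hij : i < j)
    (h3 : ∀ k, i < k → k < j → ¬ Occ w n v k) (hj : j = i + z + o)
    (ho : ones w j = ones w i + o) : Ret w n v z o := by
  subst hj
  exact ⟨i, ⟨hij, h1, h2, h3⟩, ho⟩

theorem Admissible.ret_of_open (hw : Admissible w) {n v i q : ℕ} (h : Occ w n v i) (hq : i < q)
    (h' : ∀ k, i < k → k < q → ¬ Occ w n v k) :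
    ∃ z o, Ret w n v z o ∧ ones w q ≤ ones w i + o ∧ q + ones w i ≤ i + z + ones w q := by
  obtain ⟨j, hj⟩ := hw.next h
  have hqj : q ≤ j := by
    by_contra hlt
    exact h' j hj.1 (by omega) hj.2.2.1
  have h1 := ones_bounds (w := w) hqj
  have h2 := ones_bounds (w := w) hq.le
  exact ⟨_, _, hj.ret, by omega, by omega⟩

/-- If from some position on all returns of a class are equal, the class has one semi-abelian
return. -/
theorem Admissible.false_of_single (hw : Admissible w) {n v p : ℕ} (hn : 0 < n)
    (hp : Occ w n v p) (N d : ℕ) (r : ℕ → Bool)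
    (h : ∀ i j, N ≤ i → Consec w n v i j → j = i + d ∧ ∀ k < d, w (i + k) = r k) : False := by
  obtain ⟨i, j, i', j', h1, h2, h3⟩ := hw.two n v p hn hp
  have key : ∀ i j, Consec w n v i j → j = i + d ∧ ∀ k < d, w (i + k) = r k := by
    intro i j hc
    obtain ⟨l, hl, hl'⟩ := hw.recur i (j - i + n) N
    have := h _ _ hl (consec_congr hc hl' le_rfl)
    have hij := hc.1
    refine ⟨by omega, fun k hk => ?_⟩
    rw [← hl' k (by omega), this.2 k hk]
  have e1 := key _ _ h1
  have e2 := key _ _ h2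
  refine h3 ⟨by omega, fun k hk => ?_⟩
  rw [e1.2 k (by omega), e2.2 k (by omega)]

end Counting

section Translation

variable {w : ℕ → Bool}

theorem length_wordAt (i n : ℕ) : (wordAt w i n).length = n := by
  simp [wordAt]

theorem wordAt_succ (i n : ℕ) : wordAt w i (n + 1) = wordAt w i n ++ [w (i + n)] := by
  simp [wordAt, List.range_succ]

theorem wordAt_eq_iff {i j n : ℕ} :
    wordAt w i n = wordAt w j n ↔ ∀ k < n, w (i + k) = w (j + k) := by
  simp [wordAt]

theorem isFactorW_wordAt (i n : ℕ) : IsFactorW w (wordAt w i n) :=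
  ⟨i, by rw [length_wordAt]⟩

theorem count_true_wordAt (i n : ℕ) : (wordAt w i n).count true + ones w i = ones w (i + n) := by
  induction n with
  | zero => simp [wordAt]
  | succ n ih =>
    rw [wordAt_succ, ← add_assoc, ones, ← ih, List.count_append]
    cases h : w (i + n)
    · simp
    · simp
      omega

theorem count_false_wordAt (i n : ℕ) :
    (wordAt w i n).count false + (wordAt w i n).count true = n := by
  induction n with
  | zero => simp [wordAt]
  | succ n ih =>
    rw [wordAt_succ, List.count_append, List.count_append]
    cases h : w (i + n) <;> (simp; omega)

theorem mem_abOcc_iff {i p n v : ℕ} (h : Occ w n v p) :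
    i ∈ abOcc w (wordAt w p n) ↔ Occ w n v i := by
  have h1 := count_true_wordAt (w := w) i n
  have h2 := count_true_wordAt (w := w) p n
  have h3 := count_false_wordAt (w := w) i n
  have h4 := count_false_wordAt (w := w) p n
  simp only [abOcc, AbEquiv, length_wordAt, Set.mem_ofPred_eq, Bool.forall_bool]
  unfold Occ at h ⊢
  omega

theorem Consec.mem_semiAbReturns {i j p n v : ℕ} (h : Occ w n v p) (hc : Consec w n v i j) :
    wordAt w i (j - i) ∈ semiAbReturns w (wordAt w p n) :=
  ⟨i, j, (mem_abOcc_iff h).2 hc.2.1, (mem_abOcc_iff h).2 hc.2.2.1, hc.1,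
    fun k hk hk' => (mem_abOcc_iff h).not.2 (hc.2.2.2 k hk hk'), rfl⟩

theorem Ret.exists_mem {n v z o p : ℕ} (hp : Occ w n v p) (h : Ret w n v z o) :
    ∃ r ∈ semiAbReturns w (wordAt w p n), r.count false = z ∧ r.count true = o := by
  obtain ⟨i, hc, ho⟩ := h
  refine ⟨_, hc.mem_semiAbReturns hp, ?_⟩
  have h1 := count_true_wordAt (w := w) i (i + z + o - i)
  have h3 := count_false_wordAt (w := w) i (i + z + o - i)
  have : i + (i + z + o - i) = i + z + o := by omega
  rw [this] at h1
  omega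

theorem admissible_of_returns (hrec : RecurrentW w)
    (h : ∀ u, IsFactorW w u → u ≠ [] → AtMostKAbReturns w u 3 ∧ AtLeastTwoSemiAbReturns w u) :
    Admissible w where
  recur i n N := by
    obtain ⟨j, hj, h'⟩ := hrec _ (isFactorW_wordAt i n) N
    rw [length_wordAt] at h'
    exact ⟨j, hj, fun k hk => (wordAt_eq_iff.1 h' k hk).symm⟩
  three n v z₁ o₁ z₂ o₂ z₃ o₃ z₄ o₄ hn h₁ h₂ h₃ h₄ := by
    obtain ⟨p, hp⟩ := id h₁
    have hp := hp.1.2.1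
    have hne : wordAt w p n ≠ [] := fun h0 => by
      have := length_wordAt (w := w) p n
      rw [h0, List.length_nil] at this
      omega
    obtain ⟨f, hf⟩ := (h _ (isFactorW_wordAt p n) hne).1
    obtain ⟨r₁, m₁, c₁, d₁⟩ := h₁.exists_mem hp
    obtain ⟨r₂, m₂, c₂, d₂⟩ := h₂.exists_mem hp
    obtain ⟨r₃, m₃, c₃, d₃⟩ := h₃.exists_mem hp
    obtain ⟨r₄, m₄, c₄, d₄⟩ := h₄.exists_mem hp
    obtain ⟨a₁, e₁⟩ := hf _ m₁
    obtain ⟨a₂, e₂⟩ := hf _ m₂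
    obtain ⟨a₃, e₃⟩ := hf _ m₃
    obtain ⟨a₄, e₄⟩ := hf _ m₄
    have key : a₁ = a₂ ∨ a₁ = a₃ ∨ a₁ = a₄ ∨ a₂ = a₃ ∨ a₂ = a₄ ∨ a₃ = a₄ := by omega
    have f₁ := e₁ false; have t₁ := e₁ true
    have f₂ := e₂ false; have t₂ := e₂ true
    have f₃ := e₃ false; have t₃ := e₃ true
    have f₄ := e₄ false; have t₄ := e₄ true
    rw [c₁] at f₁; rw [d₁] at t₁; rw [c₂] at f₂; rw [d₂] at t₂
    rw [c₃] at f₃; rw [d₃] at t₃; rw [c₄] at f₄; rw [d₄] at t₄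
    rw [f₁, f₂, f₃, f₄, t₁, t₂, t₃, t₄]
    rcases key with rfl | rfl | rfl | rfl | rfl | rfl <;> simp
  two n v p hn hp := by
    have hne : wordAt w p n ≠ [] := fun h0 => by
      have := length_wordAt (w := w) p n
      rw [h0, List.length_nil] at this
      omega
    obtain ⟨r, r', ⟨i, j, hi, hj, hij, hk, rfl⟩, ⟨i', j', hi', hj', hij', hk', rfl⟩, hr⟩ :=
      (h _ (isFactorW_wordAt p n) hne).2
    simp only [mem_abOcc_iff hp] at *
    refine ⟨i, j, i', j', ⟨hij, hi, hj, hk⟩, ⟨hij', hi', hj', hk'⟩, fun ⟨h1, h2⟩ => hr ?_⟩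
    rw [show j' - i' = j - i by omega, wordAt_eq_iff]
    exact fun k hk => h2 k (by omega)

end Translation

section Search

/-- The finite word `u` occurs in `w` at position `i`. -/
def At (w : ℕ → Bool) : ℕ → List Bool → Prop
  | _, [] => True
  | i, c :: u => w i = c ∧ At w (i + 1) u

/-- The binary word with the decimal digits of `n` after the leading one. -/
def word : ℕ → ℕ → List Bool
  | 0, _ => []
  | fuel + 1, n => if n ≤ 1 then [] else word fuel (n / 10) ++ [n % 10 == 1]

/-- `b` is a factor of `u`. -/
def isInfix (b : List Bool) : List Bool → Bool
  | [] => b.isEmpty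
  | c :: u => b.isPrefixOf (c :: u) || isInfix b u

/-- Some word of `B` is a factor of `u`. -/
def isForbidden (B : List (List Bool)) (u : List Bool) : Bool :=
  B.any fun b => isInfix b u

/-- `evalThen u f` is `f u`, arranged so that the word `u` is evaluated first. -/
def evalThen {α : Type} : List Bool → (List Bool → α) → α
  | [], f => f []
  | true :: u, f => evalThen u fun u' => f (true :: u')
  | false :: u, f => evalThen u fun u' => f (false :: u')

/-- The left extension of `u` by a letter, if it is forced by the forbidden words `B`. -/
def extendLeft (B : List (List Bool)) (u : List Bool) : List Bool :=
  bif B.any fun b => b.isPrefixOf (false :: u) then true :: u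
  else bif B.any fun b => b.isPrefixOf (true :: u) then false :: u
  else u

/-- The right extension of `u` by a letter, if it is forced by the forbidden words `B`. -/
def extendRight (B : List (List Bool)) (u : List Bool) : List Bool :=
  evalThen u.reverse fun v =>
    bif B.any fun b => b.reverse.isPrefixOf (false :: v) then u ++ [true]
    else bif B.any fun b => b.reverse.isPrefixOf (true :: v) then u ++ [false]
    else u

/-- Repeated forced extension of a word, up to length about 24. -/
def extend (B : List (List Bool)) : ℕ → List Bool → List Bool
  | 0, u => u
  | fuel + 1, u => bif Nat.ble 24 u.length then u
    else evalThen (extendRight B u) fun u' => evalThen (extendLeft B u') fun u'' =>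
      extend B fuel u''

/-- `extendAllThen B K f` applies `f` to the list of extensions of the words in `K`. -/
def extendAllThen (B : List (List Bool)) {α : Type} :
    List (List Bool) → (List (List Bool) → α) → α
  | [], f => f []
  | u :: K, f => evalThen (extend B 12 u) fun u' => extendAllThen B K fun K' => f (u' :: K')

/-- Read a word from left to right and collect the returns of the class of windows of length `n`
with `v` letters `true`. The state is the list of returns found so far and the content of the part
of `w` between the last occurrence of the class and the current position. -/
def scan (n v : ℕ) : List Bool → List (ℕ × ℕ) → Option (ℕ × ℕ) → List (ℕ × ℕ) × Option (ℕ × ℕ)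
  | [], R, acc => (R, acc)
  | c :: u, R, acc =>
    bif Nat.ble n (u.length + 1) then
      bif Nat.beq (((c :: u).take n).count true) v then
        scan n v u (acc.toList ++ R) (some (if c then (0, 1) else (1, 0)))
      else match acc with
        | none => scan n v u R none
        | some (z, o) => scan n v u R (some (if c then (z, o + 1) else (z + 1, o)))
    else (R, acc)

/-- The words `K` force four different returns for the class of windows of length `n` with `v`
letters `true`. -/
def hasFourReturns (n v : ℕ) (K : List (List Bool)) : Bool :=
  match (K.flatMap fun u => (scan n v u [] none).1).dedup with
  | _ :: _ :: _ :: _ :: _ => true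
  | [a, b, c] => K.any fun u => (scan n v u [] none).2.toList.any fun t =>
      [a, b, c].all fun r => r.1 < t.1 || r.2 < t.2
  | _ => false

/-- `u` matches the periodic word with period `s`, starting from residue `r`. -/
def cycleMatch (s u : List Bool) (r : ℕ) : Bool :=
  (List.range u.length).all fun q => u.getD q false == s.getD ((r + q) % s.length) false

/-- If all sufficiently late letters follow the period `s`, then either some word of `K` is not a
factor, or the word `0 ^ m` has only one return. -/
def cycleBad (m : ℕ) (K : List (List Bool)) (s : List Bool) : Bool :=
  (K.any fun u => (List.range s.length).all fun r => !cycleMatch s u r) ||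
    ((List.range s.length).filter (cycleMatch s (List.replicate m false))).length == 1

/-- Case trees refuting the existence of a word with given factors and forbidden factors. -/
inductive Tree
  | dead
  | kill (n v : ℕ)
  | cycle (y p : ℕ)
  | split (x : ℕ) (present absent : Tree)

/-- Check that a case tree shows that no admissible word has all factors in `K` and no factor in
`B`. -/
def Tree.check (m : ℕ) : Tree → List (List Bool) → List (List Bool) → Bool
  | .dead, K, B => K.any (isForbidden B)
  | .kill n v, K, _ => Nat.ble 1 n && hasFourReturns n v K
  | .cycle y p, K, B => evalThen (word 30 y) fun y => evalThen ((extendRight B)^[p] y) fun z =>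
    Nat.ble 1 p && Nat.beq z.length (y.length + p) && z.drop p == y && K.any (isInfix y) &&
      cycleBad m K (z.take p)
  | .split x t t', K, B => evalThen (word 30 x) fun x =>
    extendAllThen B (x :: K) (fun K' => t.check m K' B) &&
      extendAllThen (x :: B) K (fun K' => t'.check m K' (x :: B))

end Search

section Soundness

variable {w : ℕ → Bool}

theorem at_iff {u : List Bool} {i : ℕ} :
    At w i u ↔ ∀ k < u.length, w (i + k) = u.getD k false := by
  induction u generalizing i with
  | nil => simp [At]
  | cons c u ih =>
    rw [At, ih]
    constructor
    · rintro ⟨h1, h2⟩ (_ | k) hk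
      · simpa using h1
      · simpa [add_assoc, add_comm 1] using h2 k (by simpa using hk)
    · intro h
      refine ⟨by simpa using h 0 (by simp), fun k hk => ?_⟩
      simpa [add_assoc, add_comm 1] using h (k + 1) (by simpa using hk)

theorem at_append {u v : List Bool} {i : ℕ} :
    At w i (u ++ v) ↔ At w i u ∧ At w (i + u.length) v := by
  induction u generalizing i with
  | nil => simp [At]
  | cons c u ih => simp [At, ih, and_assoc, add_assoc, add_comm 1]

theorem At.prefix {b u : List Bool} {i : ℕ} (hu : At w i u) (h : b.isPrefixOf u = true) :
    At w i b := by
  obtain ⟨v, rfl⟩ := List.isPrefixOf_iff_prefix.1 h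
  exact (at_append.1 hu).1

theorem At.infix {b u : List Bool} {i : ℕ} (hu : At w i u) (h : isInfix b u = true) :
    ∃ j, At w j b := by
  induction u generalizing i with
  | nil =>
    rw [isInfix, List.isEmpty_iff] at h
    exact ⟨0, h ▸ trivial⟩
  | cons c u ih =>
    rw [isInfix, Bool.or_eq_true] at h
    rcases h with h | h
    · exact ⟨i, hu.prefix h⟩
    · exact ih hu.2 h

theorem Admissible.at_recur (hw : Admissible w) {u : List Bool} {i : ℕ} (h : At w i u) (N : ℕ) :
    ∃ j, N ≤ j ∧ At w j u := by
  obtain ⟨j, hj, h'⟩ := hw.recur i u.length N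
  exact ⟨j, hj, at_iff.2 fun k hk => (h' k hk).trans (at_iff.1 h k hk)⟩

theorem not_isForbidden {B : List (List Bool)} (hB : ∀ b ∈ B, ∀ i, ¬ At w i b) {u : List Bool}
    {i : ℕ} (hu : At w i u) : isForbidden B u = false := by
  rw [isForbidden, List.any_eq_false]
  intro b hb h
  obtain ⟨j, hj⟩ := hu.infix h
  exact hB b hb j hj

theorem evalThen_eq {α : Type} (u : List Bool) (f : List Bool → α) : evalThen u f = f u := by
  induction u generalizing f with
  | nil => rfl
  | cons c u ih => cases c <;> simp [evalThen, ih]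

theorem at_extendLeft {B : List (List Bool)} (hB : ∀ b ∈ B, ∀ i, ¬ At w i b) {u : List Bool}
    {i : ℕ} (hu : At w (i + 1) u) : ∃ j, At w j (extendLeft B u) := by
  have key : ∀ c, w i = c → (B.any fun b => b.isPrefixOf (c :: u)) = false := by
    intro c hc
    rw [List.any_eq_false]
    intro b hb h
    exact hB b hb i (At.prefix (u := c :: u) ⟨hc, hu⟩ h)
  rw [extendLeft]
  cases h0 : w i
  · rw [key _ h0, cond_false]
    cases B.any fun b => b.isPrefixOf (true :: u)
    · exact ⟨_, hu⟩
    · exact ⟨i, h0, hu⟩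
  · rw [key _ h0, cond_false]
    cases B.any fun b => b.isPrefixOf (false :: u)
    · exact ⟨_, hu⟩
    · exact ⟨i, h0, hu⟩

theorem at_extendRight {B : List (List Bool)} (hB : ∀ b ∈ B, ∀ i, ¬ At w i b) {u : List Bool}
    {i : ℕ} (hu : At w i u) : At w i (extendRight B u) := by
  have key : ∀ c, w (i + u.length) = c →
      (B.any fun b => b.reverse.isPrefixOf (c :: u.reverse)) = false := by
    intro c hc
    rw [List.any_eq_false]
    intro b hb h
    have h' := List.isPrefixOf_iff_prefix.1 h
    rw [← List.reverse_concat, List.reverse_prefix] at h'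
    obtain ⟨v, hv⟩ := h'
    have : At w i (u ++ [c]) := at_append.2 ⟨hu, hc, trivial⟩
    rw [← hv] at this
    exact hB b hb _ (at_append.1 this).2
  rw [extendRight, evalThen_eq]
  cases h0 : w (i + u.length)
  · rw [key _ h0, cond_false]
    cases B.any fun b => b.reverse.isPrefixOf (true :: u.reverse)
    · exact hu
    · exact at_append.2 ⟨hu, h0, trivial⟩
  · rw [key _ h0, cond_false]
    cases B.any fun b => b.reverse.isPrefixOf (false :: u.reverse)
    · exact hu
    · exact at_append.2 ⟨hu, h0, trivial⟩

theorem Admissible.at_extend (hw : Admissible w) {B : List (List Bool)}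
    (hB : ∀ b ∈ B, ∀ i, ¬ At w i b) (fuel : ℕ) {u : List Bool} (hu : ∃ i, At w i u) :
    ∃ i, At w i (extend B fuel u) := by
  induction fuel generalizing u with
  | zero => exact hu
  | succ n ih =>
    rw [extend, evalThen_eq, evalThen_eq]
    cases Nat.ble 24 u.length
    · obtain ⟨i, hi⟩ := hu
      obtain ⟨j, hj, hj'⟩ := hw.at_recur (at_extendRight hB hi) 1
      obtain ⟨j, rfl⟩ := Nat.exists_eq_add_of_le' hj
      exact ih (at_extendLeft hB hj')
    · exact hu

theorem Admissible.extendAllThen (hw : Admissible w) {B : List (List Bool)}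
    (hB : ∀ b ∈ B, ∀ i, ¬ At w i b) {α : Type} {K : List (List Bool)}
    (hK : ∀ u ∈ K, ∃ i, At w i u) (f : List (List Bool) → α) :
    ∃ K' : List (List Bool), (∀ u ∈ K', ∃ i, At w i u) ∧ extendAllThen B K f = f K' := by
  induction K generalizing f with
  | nil => exact ⟨[], hK, rfl⟩
  | cons u K ih =>
    rw [AbelianReturns.extendAllThen, evalThen_eq]
    obtain ⟨K', h, h'⟩ := ih (fun u hu => hK u (List.mem_cons_of_mem _ hu))
      fun K' => f (extend B 12 u :: K')
    refine ⟨extend B 12 u :: K', ?_, h'⟩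
    rintro v (_ | ⟨_, hv⟩)
    · exact hw.at_extend hB 12 (hK u List.mem_cons_self)
    · exact h v hv

/-- The last occurrence before `i` of a class of windows is followed by `z` letters `false` and `o`
letters `true` up to position `i`. -/
def Open (w : ℕ → Bool) (n v i z o : ℕ) : Prop :=
  ∃ p < i, p + z + o = i ∧ Occ w n v p ∧ ones w i = ones w p + o ∧
    ∀ k, p < k → k < i → ¬ Occ w n v k

theorem At.count_take {n i : ℕ} {u : List Bool} (hu : At w i u) (hn : n ≤ u.length) :
    ones w (i + n) = ones w i + (u.take n).count true := by
  induction n generalizing i u with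
  | zero => simp
  | succ n ih =>
    obtain _ | ⟨c, u⟩ := u
    · simp at hn
    · have h1 := ih hu.2 (by simpa using hn)
      rw [List.take_succ_cons, List.count_cons, add_comm n 1, ← add_assoc, h1, ones, hu.1]
      cases c
      · simp
      · simp
        omega

theorem scan_spec {n v i : ℕ} {u : List Bool} {R : List (ℕ × ℕ)} {acc : Option (ℕ × ℕ)}
    (hu : At w i u) (hR : ∀ r ∈ R, Ret w n v r.1 r.2)
    (hacc : ∀ a ∈ acc, Open w n v i a.1 a.2) :
    (∀ r ∈ (scan n v u R acc).1, Ret w n v r.1 r.2) ∧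
      ∀ a ∈ (scan n v u R acc).2, ∃ j, Open w n v j a.1 a.2 := by
  induction u generalizing i R acc with
  | nil => exact ⟨hR, fun a ha => ⟨i, hacc a ha⟩⟩
  | cons c u ih =>
    rw [scan.eq_def]
    dsimp only
    cases hle : Nat.ble n (u.length + 1)
    · exact ⟨hR, fun a ha => ⟨i, hacc a ha⟩⟩
    · have hct := hu.count_take (n := n) (by simpa using Nat.le_of_ble_eq_true hle)
      have hstep : ones w (i + 1) = ones w i + c.toNat := by rw [ones, hu.1]
      cases hocc : Nat.beq (((c :: u).take n).count true) v
      · have hno : ¬ Occ w n v i := fun h => by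
          refine Nat.ne_of_beq_eq_false hocc ?_
          unfold Occ at h
          omega
        obtain _ | ⟨z, o⟩ := acc
        · exact ih hu.2 hR (by simp)
        · refine ih hu.2 hR ?_
          obtain ⟨p, hp, hpi, hp', hpo, hpk⟩ := hacc (z, o) rfl
          have hk : ∀ k, p < k → k < i + 1 → ¬ Occ w n v k := fun k hk hk' => by
            rcases eq_or_ne k i with rfl | hne
            · exact hno
            · exact hpk k hk (by omega)
          rintro a ha
          simp only [Option.mem_def, Option.some.injEq] at ha
          subst ha
          refine ⟨p, by omega, ?_, hp', ?_, hk⟩ <;> cases c <;> simp at hstep ⊢ <;> omega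
      · have hyes : Occ w n v i := by
          have := Nat.eq_of_beq_eq_true hocc
          unfold Occ
          omega
        refine ih hu.2 ?_ ?_
        · intro r hr
          rcases List.mem_append.1 hr with hr | hr
          · obtain ⟨p, hp, hpi, hp', hpo, hpk⟩ := hacc r (by simpa using hr)
            exact ret_of hp' hyes hp hpk hpi.symm hpo
          · exact hR r hr
        · intro a ha
          simp only [Option.mem_def, Option.some.injEq] at ha
          subst ha
          refine ⟨i, by omega, ?_, hyes, ?_, fun k hk hk' => by omega⟩ <;> cases c <;>
            simp at hstep ⊢ <;> omega

theorem Admissible.hasFourReturns_eq_false (hw : Admissible w) {n v : ℕ} (hn : 0 < n)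
    {K : List (List Bool)} (hK : ∀ u ∈ K, ∃ i, At w i u) : hasFourReturns n v K = false := by
  have hspec : ∀ u ∈ K, (∀ r ∈ (scan n v u [] none).1, Ret w n v r.1 r.2) ∧
      ∀ a ∈ (scan n v u [] none).2, ∃ j, Open w n v j a.1 a.2 := fun u hu => by
    obtain ⟨i, hi⟩ := hK u hu
    exact scan_spec hi (by simp) (by simp)
  have hret : ∀ r ∈ (K.flatMap fun u => (scan n v u [] none).1).dedup, Ret w n v r.1 r.2 := by
    intro r hr
    obtain ⟨u, hu, hr⟩ := List.mem_flatMap.1 (List.mem_dedup.1 hr)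
    exact (hspec u hu).1 r hr
  have hnd := List.nodup_dedup (K.flatMap fun u => (scan n v u [] none).1)
  rw [hasFourReturns]
  split
  · rename_i a b c d l heq
    rw [heq] at hret hnd
    simp only [List.mem_cons, forall_eq_or_imp] at hret
    have := hw.three n v _ _ _ _ _ _ _ _ hn hret.1 hret.2.1 hret.2.2.1 hret.2.2.2.1
    simp only [List.nodup_cons, List.mem_cons, not_or, Prod.ext_iff] at hnd
    tauto
  · rename_i a b c heq
    rw [heq] at hret hnd
    simp only [List.mem_cons, forall_eq_or_imp] at hret
    by_contra hne
    rw [Bool.not_eq_false, List.any_eq_true] at hne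
    obtain ⟨u, hu, hne⟩ := hne
    rw [List.any_eq_true] at hne
    obtain ⟨t, ht, hall⟩ := hne
    obtain ⟨j, p, hp, hpi, hp', hpo, hpk⟩ := (hspec u hu).2 t (by simpa using ht)
    obtain ⟨z, o, hzo, h1, h2⟩ := hw.ret_of_open hp' hp hpk
    have := hw.three n v _ _ _ _ _ _ _ _ hn hret.1 hret.2.1 hret.2.2.1 hzo
    simp only [List.nodup_cons, List.mem_cons, not_or, Prod.ext_iff] at hnd
    simp only [List.all_cons, List.all_nil, Bool.and_true, Bool.and_eq_true, Bool.or_eq_true,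
      decide_eq_true_eq] at hall
    omega
  · rfl

theorem Admissible.cycleBad_eq_false (hw : Admissible w) {m i : ℕ} (hm : 0 < m)
    {K : List (List Bool)} (hK : ∀ u ∈ K, ∃ i, At w i u) {s : List Bool} (hs : 0 < s.length)
    (h : ∀ n, w (i + n) = s.getD (n % s.length) false) : cycleBad m K s = false := by
  have hmatch : ∀ n u, cycleMatch s u (n % s.length) = true ↔ At w (i + n) u := fun n u => by
    rw [cycleMatch, at_iff]
    simp only [List.all_eq_true, List.mem_range, beq_iff_eq, add_assoc, h, Nat.mod_add_mod]
    exact forall₂_congr fun k hk => eq_comm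
  rw [cycleBad, Bool.or_eq_false_iff]
  constructor
  · rw [List.any_eq_false]
    intro u hu hall
    obtain ⟨j, hj⟩ := hK u hu
    obtain ⟨l, hl, hl'⟩ := hw.at_recur hj i
    obtain ⟨n, rfl⟩ := Nat.exists_eq_add_of_le hl
    have := List.all_eq_true.1 hall (n % s.length) (by simpa using Nat.mod_lt _ hs)
    rw [(hmatch n u).2 hl'] at this
    simp at this
  · by_contra hne
    rw [Bool.not_eq_false, beq_iff_eq, List.length_eq_one_iff] at hne
    obtain ⟨r, hr⟩ := hne
    have hmem : ∀ q, q = r ↔ q < s.length ∧ cycleMatch s (List.replicate m false) q = true := by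
      intro q
      rw [← List.mem_singleton, ← hr, List.mem_filter, List.mem_range]
    have hocc : ∀ n, Occ w m 0 (i + n) ↔ n % s.length = r := by
      intro n
      rw [hmem, hmatch, and_iff_right (Nat.mod_lt _ hs), at_iff]
      simp only [List.length_replicate]
      constructor
      · intro h' k hk
        have e1 := ones_bounds (w := w) (i := i + n) (j := i + n + k) (by omega)
        have e2 := ones_bounds (w := w) (i := i + n + k + 1) (j := i + n + m) (by omega)
        have e3 : ones w (i + n + k + 1) = ones w (i + n + k) + (w (i + n + k)).toNat := rfl
        unfold Occ at h'
        cases hc : w (i + n + k)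
        · simp [hk]
        · rw [hc, Bool.toNat_true] at e3
          omega
      · intro h'
        exact ones_add_of_false fun k hk => by simpa [hk] using h' k hk
    have hrs := ((hmem r).1 rfl).1
    refine hw.false_of_single (p := i + r) hm ((hocc r).2 (Nat.mod_eq_of_lt hrs)) i s.length
      (fun k => s.getD ((r + k) % s.length) false) ?_
    rintro p q hp ⟨h1, h2, h3, h4⟩
    obtain ⟨n, rfl⟩ := Nat.exists_eq_add_of_le hp
    obtain ⟨l, rfl⟩ := Nat.exists_eq_add_of_lt h1
    rw [hocc] at h2
    rw [add_assoc, add_assoc, hocc] at h3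
    have hnext : Occ w m 0 (i + (n + s.length)) := by
      rw [hocc, Nat.add_mod_right, h2]
    constructor
    · have hdvd : s.length ∣ l + 1 := by
        have : n % s.length = (n + (l + 1)) % s.length := h2.trans h3.symm
        have := (Nat.modEq_iff_dvd' (by omega)).1 this
        simpa using this
      have hle := Nat.le_of_dvd (by omega) hdvd
      by_contra hne
      exact h4 (i + n + s.length) (by omega) (by omega) (by rwa [add_assoc])
    · intro k hk
      rw [add_assoc, h, Nat.add_mod, h2]
      conv_rhs => rw [Nat.add_mod, Nat.mod_eq_of_lt hrs]

theorem Tree.check_sound (hw : Admissible w) {m : ℕ} (hm : 0 < m) {t : Tree}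
    {K B : List (List Bool)} (hK : ∀ u ∈ K, ∃ i, At w i u) (hB : ∀ b ∈ B, ∀ i, ¬ At w i b) :
    t.check m K B = false := by
  induction t generalizing K B with
  | dead =>
    rw [check, List.any_eq_false]
    intro u hu
    obtain ⟨i, hi⟩ := hK u hu
    simp [not_isForbidden hB hi]
  | kill n v =>
    rw [check, Bool.and_eq_false_iff, or_iff_not_imp_left]
    intro hn
    exact hw.hasFourReturns_eq_false (Nat.le_of_ble_eq_true (by simpa using hn)) hK
  | cycle y p =>
    rw [check, evalThen_eq, evalThen_eq]
    by_contra hne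
    generalize word 30 y = y at hne
    set z := (extendRight B)^[p] y with hz
    simp only [Bool.not_eq_false, Bool.and_eq_true, beq_iff_eq] at hne
    obtain ⟨⟨⟨⟨hp, hlen⟩, hdrop⟩, hy⟩, hbad⟩ := hne
    replace hp := Nat.le_of_ble_eq_true hp
    replace hlen := Nat.eq_of_beq_eq_true hlen
    obtain ⟨u, hu, huy⟩ := List.any_eq_true.1 hy
    obtain ⟨i, hi⟩ := hK u hu
    obtain ⟨j, hj⟩ := hi.infix huy
    have hyz : ∀ j, At w j y → At w j z := by
      intro j hj
      rw [hz]
      clear_value z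
      clear hz hlen hdrop hbad hp
      induction p with
      | zero => exact hj
      | succ p ih =>
        rw [Function.iterate_succ_apply']
        exact at_extendRight hB ih
    have hper : ∀ l, At w (j + p * l) z := by
      intro l
      induction l with
      | zero => exact hyz _ hj
      | succ l ih =>
        rw [← List.take_append_drop p z, at_append, hdrop] at ih
        have := hyz _ ih.2
        rwa [List.length_take, min_eq_left (by omega), add_assoc] at this
    have hlt : (z.take p).length = p := by rw [List.length_take]; omega
    have := hw.cycleBad_eq_false (m := m) (i := j) hm hK (s := z.take p) (by omega) fun n => by
      have h1 := hper (n / p)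
      rw [← List.take_append_drop p z, at_append] at h1
      have h2 := at_iff.1 h1.1 (n % p) (by rw [hlt]; exact Nat.mod_lt _ (by omega))
      rw [add_assoc, Nat.div_add_mod] at h2
      rwa [hlt]
    rw [this] at hbad
    exact Bool.false_ne_true hbad
  | split x t t' ih ih' =>
    rw [check, evalThen_eq, Bool.and_eq_false_iff]
    generalize word 30 x = x
    by_cases hx : ∃ i, At w i x
    · left
      obtain ⟨K', hK', h⟩ := hw.extendAllThen hB (K := x :: K)
        (by rintro u (_ | ⟨_, hu⟩); exacts [hx, hK u hu]) fun K' => t.check m K' B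
      rw [h]
      exact ih hK' hB
    · right
      have hB' : ∀ b ∈ x :: B, ∀ i, ¬ At w i b := by
        rintro b (_ | ⟨_, hb⟩)
        exacts [not_exists.1 hx, hB b hb]
      obtain ⟨K', hK', h⟩ := hw.extendAllThen hB' hK fun K' => t'.check m K' (x :: B)
      rw [h]
      exact ih' hK' hB'

end Soundness

def treeOneOne : Tree :=
  (.split 10101
   (.split 11100
    (.split 10010
     (.split 11011
      (.split 100101
       (.split 101011
        (.split 101010
         (.kill 3 1)
         (.split 110101
          (.kill 3 2)
          (.split 100100
           (.kill 4 2)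
           (.split 111011
            (.kill 4 2)
            (.split 1101100
             (.split 1110010
              (.split 1001100
               (.kill 3 1)
               (.split 1010010
                (.kill 3 2)
                (.split 10011
                 (.cycle 10011 6)
                 (.split 11101
                  .dead
                  (.cycle 1110 6)))))
              (.kill 3 2))
             (.kill 3 1))))))
        (.kill 4 2))
       (.kill 3 2))
      (.kill 3 1))
     (.split 11101
      (.kill 3 2)
      (.cycle 1110 4)))
    (.split 11010
     (.split 10010
      (.split 11011
       (.split 111010
        (.split 11011010
         (.split 100101
          (.split 10011
           (.kill 5 2)
           (.split 100100
            (.split 101011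
             (.split 101010
              (.kill 3 1)
              (.kill 5 2))
             (.kill 4 2))
            (.split 110101
             (.kill 3 2)
             (.split 101011
              (.split 101010
               (.kill 3 1)
               (.split 111011
                (.kill 5 3)
                (.cycle 10101 8)))
              (.kill 5 3)))))
          (.split 10011
           (.kill 4 2)
           (.cycle 1001 3)))
         (.kill 4 2))
        (.cycle 11101 3))
       (.kill 3 1))
      (.kill 3 2))
     (.kill 5 2)))
   (.split 10011
    (.split 11010
     (.split 10010
      (.kill 4 2)
      (.split 11011
       (.kill 4 2)
       (.split 11100
        (.kill 3 1)
        (.cycle 1110 6))))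
     (.kill 4 2))
    (.cycle 1001 3)))

theorem treeOneOne_check : treeOneOne.check 2
    [[false, false], [true, true], [true, false, true], [false, true, false]]
    [[false, false, false], [true, true, true]] = true := by
  decide +kernel

def treeOneFour : Tree :=
  (.split 101101
   (.split 111100
    (.split 100110
     (.split 110111
      (.split 1001101
       (.split 1001100
        (.kill 6 4)
        (.split 1101101
         (.kill 5 4)
         (.split 10110111
          (.split 10110110
           (.kill 4 2)
           (.split 11110111
            (.kill 6 4)
            (.split 111100110
             (.split 110111100
              (.split 100111100
               (.kill 4 2)
               (.split 101100110
                (.kill 4 3)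
                (.split 100111
                 (.cycle 111101 9)
                 (.split 111101
                  .dead
                  (.cycle 10011 9)))))
              (.kill 4 2))
             (.kill 4 3))))
          (.kill 6 4))))
       (.kill 5 4))
      (.kill 4 2))
     (.split 111101
      (.kill 5 4)
      (.cycle 11110 6)))
    (.split 110110
     (.split 100110
      (.split 110111
       (.split 11110110
        (.split 11011110110
         (.split 1001100
          (.split 100111
           (.kill 6 4)
           (.split 1001101
            (.split 10110111
             (.kill 5 3)
             (.kill 6 4))
            (.cycle 100110 4)))
          (.split 100111
           (.kill 4 3)
           (.split 1101101
            (.kill 5 4)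
            (.split 11110111
             (.kill 7 5)
             (.split 10110110
              (.kill 4 2)
              (.cycle 1011011 12))))))
         (.kill 6 4))
        (.cycle 11111 5))
       (.kill 4 2))
      (.kill 5 4))
     (.kill 5 3)))
   (.split 100111
    (.split 110110
     (.split 100110
      (.kill 6 4)
      (.split 110111
       (.kill 6 4)
       (.split 111100
        (.kill 4 2)
        (.cycle 10110 9))))
     (.kill 6 4))
    (.cycle 10011 4)))

theorem treeOneFour_check : treeOneFour.check 2
    [[true, false, false, true], [true, false, true], [false, true, true, false],
      [false, true, true, true, true, false]]
    [[false, false, false], [false, true, false], [false, true, true, true, false],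
      [true, true, true, true, true]] = true := by
  decide +kernel

def treeFourFour : Tree :=
  (.split 1011001
   (.split 1111000
    (.split 1000110
     (.split 1100111
      (.split 100011001
       (.split 100011000
        (.kill 8 4)
        (.split 101100111
         (.split 111100111
          (.kill 8 4)
          (.split 101100110
           (.kill 6 2)
           (.split 110011001
            (.kill 6 4)
            (.split 11001111000
             (.split 11110000110
              (.split 10001111000
               (.kill 5 2)
               (.split 11001111001
                (.kill 5 2)
                (.split 11110000111
                 (.kill 5 3)
                 (.cycle 1100111100 12))))
              (.kill 5 3))
             (.kill 5 2)))))
         (.kill 8 4)))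
       (.kill 6 4))
      (.kill 6 2))
     (.split 1111001
      (.kill 6 4)
      (.cycle 111100 8)))
    (.split 1100110
     (.split 1000110
      (.split 1100111
       (.split 111100110
        (.split 1100111100110
         (.split 111100111
          (.split 110011000
           (.kill 7 4)
           (.kill 8 4))
          (.split 1000111
           (.kill 5 2)
           (.split 100011001
            (.split 100011000
             (.kill 7 3)
             (.split 101100110
              (.kill 6 2)
              (.split 110011001
               (.kill 6 4)
               (.cycle 111100 16))))
            (.cycle 10001100 6))))
         (.kill 8 4))
        (.cycle 11110011 6))
       (.kill 6 2))
      (.kill 6 4))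
     (.kill 7 3)))
   (.split 1000111
    (.split 1100110
     (.split 1000110
      (.kill 8 4)
      (.split 1100111
       (.kill 7 4)
       (.split 1111000
        (.kill 5 2)
        (.cycle 111100 12))))
     (.kill 8 4))
    (.cycle 100011 6)))

theorem treeFourFour_check : treeFourFour.check 4
    [[true, false, false, true], [true, false, false, false, false, true], [false, true, true, false],
      [false, true, true, true, true, false]]
    [[true, false, true], [false, true, false], [true, false, false, false, true],
      [false, false, false, false, false], [false, true, true, true, false],
      [true, true, true, true, true]] = true := by
  decide +kernel

section Runs

variable {w : ℕ → Bool}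

/-- A maximal run of `b` letters `c` follows position `i`. -/
structure Run (w : ℕ → Bool) (c : Bool) (i b : ℕ) : Prop where
  pos : 0 < b
  left : w i = !c
  mid : ∀ k < b, w (i + 1 + k) = c
  right : w (i + 1 + b) = !c

theorem Run.of_not {c : Bool} {i b : ℕ} (h : Run (fun k => !w k) c i b) : Run w (!c) i b where
  pos := h.pos
  left := by simpa using h.left
  mid k hk := by simpa using congrArg Bool.not (h.mid k hk)
  right := by simpa using h.right

theorem Run.not {c : Bool} {i b : ℕ} (h : Run w c i b) : Run (fun k => !w k) (!c) i b where
  pos := h.pos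
  left := by simpa using h.left
  mid k hk := by simpa using h.mid k hk
  right := by simpa using h.right

theorem Run.congr {c : Bool} {i j b : ℕ} (h : Run w c i b)
    (hij : ∀ k < b + 2, w (j + k) = w (i + k)) : Run w c j b where
  pos := h.pos
  left := (hij 0 (by omega)).trans h.left
  mid k hk := by
    rw [add_assoc, hij _ (by omega), ← add_assoc]
    exact h.mid k hk
  right := by
    rw [add_assoc, hij _ (by omega), ← add_assoc]
    exact h.right

theorem Admissible.letter_recur (hw : Admissible w) (i N : ℕ) : ∃ j, N ≤ j ∧ w j = w i := by
  obtain ⟨j, hj, h⟩ := hw.recur i 1 N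
  exact ⟨j, hj, h 0 one_pos⟩

theorem Admissible.run_end (hw : Admissible w) {c : Bool} {i p : ℕ} (hi : w i = c)
    (hp : w p = !c) : ∃ l, 0 < l ∧ (∀ k < l, w (i + k) = c) ∧ w (i + l) = !c := by
  have hex : ∃ l, w (i + l) = !c := by
    obtain ⟨j, hj, h⟩ := hw.letter_recur p i
    obtain ⟨l, rfl⟩ := Nat.exists_eq_add_of_le hj
    exact ⟨l, h.trans hp⟩
  refine ⟨Nat.find hex, ?_, fun k hk => ?_, Nat.find_spec hex⟩
  · rw [Nat.find_pos]
    simp [hi]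
  · simpa using Nat.find_min hex hk

theorem run_start {c : Bool} {i p : ℕ} (hi : w i = c) (hp : w p = !c) (hpi : p < i) :
    ∃ l j, j + 1 + l = i ∧ w j = !c ∧ ∀ k ≤ l, w (j + 1 + k) = c := by
  have hspec := Nat.findGreatest_spec (P := fun q => w q = !c) hpi.le hp
  have hle := Nat.findGreatest_le (P := fun q => w q = !c) i
  have hmax := fun k => Nat.findGreatest_is_greatest (P := fun q => w q = !c) (n := i) (k := k)
  generalize Nat.findGreatest (fun q => w q = !c) i = q at hspec hle hmax
  have hne : q ≠ i := by
    rintro rfl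
    rw [hi] at hspec
    cases c <;> simp at hspec
  refine ⟨i - q - 1, q, by omega, hspec, fun k hk => ?_⟩
  simpa using hmax (q + 1 + k) (by omega) (by omega)

theorem Admissible.run_of_left (hw : Admissible w) {c : Bool} {i : ℕ} (h : w i = !c)
    (h' : w (i + 1) = c) : ∃ b, Run w c i b := by
  obtain ⟨b, hb, h1, h2⟩ := hw.run_end h' h
  exact ⟨b, hb, h, h1, h2⟩

theorem Admissible.exists_run (hw : Admissible w) {c : Bool} {i n p : ℕ} (hn : 0 < n)
    (h : ∀ k < n, w (i + k) = c) (hp : w p = !c) : ∃ j b, Run w c j b ∧ n ≤ b := by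
  obtain ⟨i', hi', h'⟩ := hw.recur i n (p + 1)
  have hc : ∀ k < n, w (i' + k) = c := fun k hk => (h' k hk).trans (h k hk)
  obtain ⟨l, j, hj, hjl, hjc⟩ := run_start (hc 0 hn) hp hi'
  obtain ⟨b, hb⟩ := hw.run_of_left hjl (hjc 0 (by omega))
  refine ⟨j, b, hb, ?_⟩
  by_contra hlt
  have h1 := hb.right
  rcases le_or_gt b l with hle | hgt
  · rw [hjc b hle] at h1
    cases c <;> simp at h1
  · have := hc (b - l) (by omega)
    rw [show i' + (b - l) = j + 1 + b by omega, h1] at this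
    cases c <;> simp at this

theorem Run.next (hw : Admissible w) {c : Bool} {i b : ℕ} (h : Run w c i b) :
    ∃ a, Run w (!c) (i + b) a := by
  refine hw.run_of_left ?_ ?_
  · have := h.mid (b - 1) (by have := h.pos; omega)
    rw [show i + 1 + (b - 1) = i + b by have := h.pos; omega] at this
    simpa using this
  · rw [add_right_comm]
    exact h.right

theorem Run.prev (hw : Admissible w) {c : Bool} {i b : ℕ} (h : Run w c i b) :
    ∃ j a, Run w (!c) j a ∧ Run w c (j + a) b := by
  obtain ⟨i', hi', h'⟩ := hw.recur i (b + 2) (i + 2)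
  have hr := h.congr h'
  obtain ⟨l, j, hj, hjl, hjc⟩ := run_start (c := !c) (p := i + 1) hr.left
    (by simpa using h.mid 0 h.pos) (by omega)
  refine ⟨j, l + 1, ⟨by omega, hjl, fun k hk => hjc k (by omega), ?_⟩, ?_⟩
  · rw [show j + 1 + (l + 1) = i' + 1 + 0 by omega, hr.mid 0 hr.pos, Bool.not_not]
  · rwa [show j + (l + 1) = i' by omega]

theorem Run.ones_eq {i b : ℕ} (h : Run w true i b) :
    ∀ k ≤ b, ones w (i + 1 + k) = ones w i + k := by
  intro k hk
  rw [ones_add_of_true fun l hl => h.mid l (by omega), ones_succ_of_false h.left]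

/-- The gap between the letters `false` around a run. -/
theorem Run.ret_gap {i b : ℕ} (h : Run w true i b) : Ret w 1 0 1 b := by
  have h1 := h.ones_eq
  have h2 := ones_succ_of_false h.left
  have h3 := ones_succ_of_false h.right
  refine ret_of (i := i) (j := i + 1 + b) h2 h3 (by omega) ?_ rfl (h1 b le_rfl)
  intro k hk hk'
  have e1 := h1 (k - i - 1) (by omega)
  have e2 := h1 (k - i) (by omega)
  rw [show i + 1 + (k - i - 1) = k by omega] at e1
  rw [show i + 1 + (k - i) = k + 1 by omega] at e2
  unfold Occ
  omega

theorem Run.ret_boundary {i b : ℕ} (h : Run w true i b) : Ret w 2 1 1 (b - 1) := by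
  have h0 := h.pos
  have h1 := h.ones_eq
  have h3 := ones_succ_of_false h.right
  refine ret_of (i := i) (j := i + b) (h1 1 (by omega)) ?_ (by omega) ?_ (by omega) ?_
  · have e1 := h1 (b - 1) (by omega)
    have e2 := h1 b le_rfl
    rw [show i + 1 + (b - 1) = i + b by omega] at e1
    rw [show i + 1 + b + 1 = i + b + 2 by omega] at h3
    unfold Occ
    omega
  · intro k hk hk'
    have e1 := h1 (k - i - 1) (by omega)
    have e2 := h1 (k - i + 1) (by omega)
    rw [show i + 1 + (k - i - 1) = k by omega] at e1
    rw [show i + 1 + (k - i + 1) = k + 2 by omega] at e2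
    unfold Occ
    omega
  · have := h1 (b - 1) (by omega)
    rwa [show i + 1 + (b - 1) = i + b by omega] at this

/-- The lengths of the runs of `true` take at most two values if `00` is a factor. -/
theorem Admissible.run_length_eq (hw : Admissible w) {i i₁ b₁ i₂ b₂ i₃ b₃ : ℕ}
    (h0 : w i = false) (h0' : w (i + 1) = false) (h₁ : Run w true i₁ b₁)
    (h₂ : Run w true i₂ b₂) (h₃ : Run w true i₃ b₃) : b₁ = b₂ ∨ b₁ = b₃ ∨ b₂ = b₃ := by
  have hr : Ret w 1 0 1 0 := by
    have e1 := ones_succ_of_false h0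
    exact ret_of (i := i) (j := i + 1) e1 (ones_succ_of_false h0') (by omega)
      (by intros; omega) rfl e1
  have := hw.three _ _ _ _ _ _ _ _ _ _ one_pos hr h₁.ret_gap h₂.ret_gap h₃.ret_gap
  have := h₁.pos
  have := h₂.pos
  have := h₃.pos
  omega

theorem Run.ret_boundary_not {i b : ℕ} (h : Run w false i b) : Ret w 2 1 (b - 1) 1 :=
  h.not.ret_boundary.of_not

theorem Run.ret_wide {i j b a : ℕ} (h : Run w true i b) (hb : 3 ≤ b) (hj : Run w false j a)
    (hji : j + a = i) (ha : 2 ≤ a) (h' : w (i + b + 2) = false) : Ret w 4 2 2 (b - 2) := by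
  have h1 := h.ones_eq
  have h2 : ones w i = ones w (i - 1) := by
    have := ones_succ_of_false (hj.mid (a - 2) (by omega))
    rwa [show j + 1 + (a - 2) + 1 = i by omega, show j + 1 + (a - 2) = i - 1 by omega] at this
  have h3 := ones_succ_of_false h.right
  have h4 := ones_succ_of_false h'
  have hi : i - 1 + 1 = i := by omega
  obtain ⟨p, rfl⟩ : ∃ p, i = p + 1 := ⟨i - 1, hi.symm⟩
  obtain ⟨d, rfl⟩ := Nat.exists_eq_add_of_le' hb
  simp only [Nat.add_sub_cancel] at h2
  refine ret_of (i := p) (j := p + (d + 3)) ?_ ?_ (by omega) ?_ (by omega) ?_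
  · have := h1 2 (by omega)
    unfold Occ
    rw [show p + 4 = p + 1 + 1 + 2 by omega]
    omega
  · have e1 := h1 (d + 1) (by omega)
    have e2 := h1 (d + 3) (by omega)
    rw [show p + 1 + 1 + (d + 1) = p + (d + 3) by omega] at e1
    rw [show p + 1 + (d + 3) + 2 + 1 = p + (d + 3) + 4 by omega] at h4
    rw [show p + 1 + (d + 3) + 2 = p + 1 + 1 + (d + 3) + 1 by omega] at h4
    unfold Occ
    omega
  · intro k hk hk' hocc
    unfold Occ at hocc
    obtain ⟨l, rfl⟩ := Nat.exists_eq_add_of_lt hk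
    rcases Nat.eq_zero_or_pos l with rfl | hl
    · have := h1 3 (by omega)
      rw [show p + 1 + 1 + 3 = p + 0 + 1 + 4 by omega] at this
      simp at this hocc
      omega
    · have e1 := h1 (l - 1) (by omega)
      rw [show p + 1 + 1 + (l - 1) = p + l + 1 by omega] at e1
      have e2 := h1 (min (l + 3) (d + 3)) (by omega)
      have := (ones_bounds (w := w)
        (show p + 1 + 1 + min (l + 3) (d + 3) ≤ p + l + 1 + 4 by omega)).1
      omega
  · have e1 := h1 (d + 1) (by omega)
    rw [show p + 1 + 1 + (d + 1) = p + (d + 3) by omega] at e1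
    omega

end Runs

section TwoRunLengths

variable {w : ℕ → Bool}

/-- If runs of both letters take two lengths, one of the lengths is 2 for both. -/
theorem Admissible.two_mem (hw : Admissible w) {i₁ b₁ i₂ b₂ j₁ a₁ j₂ a₂ : ℕ}
    (h₁ : Run w true i₁ b₁) (h₂ : Run w true i₂ b₂) (hb : b₁ ≠ b₂) (h₃ : Run w false j₁ a₁)
    (h₄ : Run w false j₂ a₂) (ha : a₁ ≠ a₂) : (b₁ = 2 ∨ b₂ = 2) ∧ (a₁ = 2 ∨ a₂ = 2) := by
  have := hw.three _ _ _ _ _ _ _ _ _ _ two_pos h₁.ret_boundary h₂.ret_boundary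
    h₃.ret_boundary_not h₄.ret_boundary_not
  have := h₁.pos
  have := h₂.pos
  have := h₃.pos
  have := h₄.pos
  omega

theorem run_iff_at {c : Bool} {i b : ℕ} (hb : 0 < b) :
    Run w c i b ↔ At w i ((!c) :: List.replicate b c ++ [!c]) := by
  have hget : ∀ k < b, ((!c) :: List.replicate b c ++ [!c]).getD (1 + k) false = c := by
    intro k hk
    simp [add_comm 1, List.getD_eq_getElem?_getD, List.getElem?_append, hk]
  have hget' : ((!c) :: List.replicate b c ++ [!c]).getD (1 + b) false = !c := by
    simp [add_comm 1, List.getD_eq_getElem?_getD]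
  rw [at_iff]
  simp only [List.cons_append, List.length_cons, List.length_append, List.length_replicate,
    List.length_nil] at hget hget' ⊢
  constructor
  · rintro ⟨-, h1, h2, h3⟩ k hk
    rcases Nat.eq_zero_or_pos k with rfl | hk0
    · simpa using h1
    · obtain ⟨k, rfl⟩ := Nat.exists_eq_add_of_le hk0
      rcases Nat.lt_or_ge k b with hkb | hkb
      · rw [hget k hkb, ← add_assoc, Nat.succ_eq_add_one, zero_add, h2 k hkb]
      · obtain rfl : k = b := by omega
        rw [← add_assoc, Nat.succ_eq_add_one, zero_add, h3, hget']
  · intro h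
    exact ⟨hb, by simpa using h 0 (by omega),
      fun k hk => by rw [add_assoc, h (1 + k) (by omega), hget k hk],
      by rw [add_assoc, h (1 + b) (by omega), hget']⟩

theorem Run.ret_four_two_one_zero {i : ℕ} (h : Run w true i 2) (h' : w (i + 4) = false) :
    Ret w 4 2 1 0 := by
  have e1 := h.ones_eq 2 le_rfl
  have e2 := ones_succ_of_false h.left
  have e3 : ones w (i + 4) = ones w (i + 3) := ones_succ_of_false h.right
  have e4 : ones w (i + 5) = ones w (i + 4) := ones_succ_of_false h'
  rw [show i + 1 + 2 = i + 3 by omega] at e1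
  refine ret_of (i := i) (j := i + 1) ?_ ?_ (by omega) (by intros; omega) rfl e2
  · unfold Occ
    omega
  · unfold Occ
    rw [show i + 1 + 4 = i + 5 by omega]
    omega

theorem Run.ret_three_two_one_zero {i : ℕ} (h : Run w true i 2) : Ret w 3 2 1 0 := by
  have e1 := h.ones_eq 2 le_rfl
  have e2 := ones_succ_of_false h.left
  have e3 : ones w (i + 4) = ones w (i + 3) := ones_succ_of_false h.right
  rw [show i + 1 + 2 = i + 3 by omega] at e1
  refine ret_of (i := i) (j := i + 1) e1 ?_ (by omega) (by intros; omega) rfl e2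
  unfold Occ
  rw [show i + 1 + 3 = i + 4 by omega]
  omega

theorem Run.ret_three_two_zero_one {j : ℕ} (h : Run w false j 1) (h' : w (j + 3) = true) :
    Ret w 3 2 0 1 := by
  have e1 : ones w (j + 1) = ones w j + 1 := ones_succ_of_true h.left
  have e2 : ones w (j + 2) = ones w (j + 1) := ones_succ_of_false (h.mid 0 one_pos)
  have e3 : ones w (j + 3) = ones w (j + 2) + 1 := ones_succ_of_true h.right
  have e4 : ones w (j + 4) = ones w (j + 3) + 1 := ones_succ_of_true h'
  refine ret_of (i := j) (j := j + 1) ?_ ?_ (by omega) (by intros; omega) rfl e1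
  · unfold Occ
    omega
  · unfold Occ
    rw [show j + 1 + 3 = j + 4 by omega]
    omega

theorem Run.ret_three_two_one_two {j : ℕ} (h : Run w false (j + 1) 2) (h' : w j = true)
    (h'' : w (j + 5) = true) : Ret w 3 2 1 2 := by
  have e0 : ones w (j + 1) = ones w j + 1 := ones_succ_of_true h'
  have e1 : ones w (j + 2) = ones w (j + 1) + 1 := ones_succ_of_true h.left
  have e2 : ones w (j + 3) = ones w (j + 2) := ones_succ_of_false (h.mid 0 two_pos)
  have e3 : ones w (j + 4) = ones w (j + 3) := ones_succ_of_false (h.mid 1 one_lt_two)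
  have e4 : ones w (j + 5) = ones w (j + 4) + 1 := ones_succ_of_true h.right
  have e5 : ones w (j + 6) = ones w (j + 5) + 1 := ones_succ_of_true h''
  refine ret_of (i := j) (j := j + 3) ?_ ?_ (by omega) ?_ rfl (by omega)
  · unfold Occ
    omega
  · unfold Occ
    rw [show j + 3 + 3 = j + 6 by omega]
    omega
  · intro k hk hk'
    obtain rfl | rfl : k = j + 1 ∨ k = j + 2 := by omega
    · unfold Occ
      rw [show j + 1 + 3 = j + 4 by omega]
      omega
    · unfold Occ
      rw [show j + 2 + 3 = j + 5 by omega]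
      omega

theorem Run.ret_three_two_one {i b : ℕ} (h : Run w true i b) (hb : 3 ≤ b) :
    Ret w 3 2 1 (b - 2) := by
  have h1 := h.ones_eq
  have h2 := ones_succ_of_false h.right
  refine ret_of (i := i) (j := i + b - 1) (h1 2 (by omega)) ?_ (by omega) ?_ (by omega) ?_
  · have e1 := h1 (b - 2) (by omega)
    have e2 := h1 b le_rfl
    rw [show i + 1 + (b - 2) = i + b - 1 by omega] at e1
    rw [show i + 1 + b + 1 = i + b - 1 + 3 by omega] at h2
    unfold Occ
    omega
  · intro k hk hk'
    have e1 := h1 (k - i - 1) (by omega)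
    have e2 := h1 (k - i + 2) (by omega)
    rw [show i + 1 + (k - i - 1) = k by omega] at e1
    rw [show i + 1 + (k - i + 2) = k + 3 by omega] at e2
    unfold Occ
    omega
  · have e1 := h1 (b - 2) (by omega)
    rwa [show i + 1 + (b - 2) = i + b - 1 by omega] at e1

/-- Runs of `true` and of `false` both have exactly two lengths, 2 and `b` respectively `a`. -/
structure TwoLengths (w : ℕ → Bool) (b a : ℕ) : Prop where
  true_two : ∃ i, Run w true i 2
  true_len : ∃ i, Run w true i b
  false_two : ∃ i, Run w false i 2
  false_len : ∃ i, Run w false i a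
  true_ne : b ≠ 2
  false_ne : a ≠ 2
  true_cases : ∀ i n, Run w true i n → n = 2 ∨ n = b
  false_cases : ∀ i n, Run w false i n → n = 2 ∨ n = a

theorem TwoLengths.not {a b : ℕ} (h : TwoLengths w b a) : TwoLengths (fun k => !w k) a b where
  true_two := h.false_two.imp fun _ h => h.not
  true_len := h.false_len.imp fun _ h => h.not
  false_two := h.true_two.imp fun _ h => h.not
  false_len := h.true_len.imp fun _ h => h.not
  true_ne := h.false_ne
  false_ne := h.true_ne
  true_cases i n h' := h.false_cases i n h'.of_not
  false_cases i n h' := h.true_cases i n h'.of_not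

theorem TwoLengths.pos {a b : ℕ} (h : TwoLengths w b a) : 0 < b ∧ 0 < a :=
  ⟨h.true_len.elim fun _ h => h.pos, h.false_len.elim fun _ h => h.pos⟩

/-- No run has more than `n` letters `c`. -/
theorem Admissible.not_at_replicate (hw : Admissible w) {c : Bool} {n p : ℕ}
    (h : ∀ i m, Run w c i m → m ≤ n) (hp : w p = !c) (i : ℕ) :
    ¬ At w i (List.replicate (n + 1) c) := by
  intro hat
  rw [at_iff] at hat
  simp only [List.length_replicate] at hat
  obtain ⟨j, m, hr, hm⟩ := hw.exists_run n.succ_pos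
    (fun k hk => by simpa [List.getD_eq_getElem?_getD, hk] using hat k hk) hp
  have := h j m hr
  omega

theorem TwoLengths.ret_wide (hw : Admissible w) {a b : ℕ} (h : TwoLengths w b a) (hb : 3 ≤ b)
    (ha : 3 ≤ a) : Ret w 4 2 2 (b - 2) ∧ Ret w 4 2 1 0 := by
  have hnext : ∀ i m, Run w true i m → w (i + m + 2) = false := by
    intro i m hr
    obtain ⟨n, hn⟩ := hr.next hw
    have := hn.mid 1 (by have := h.false_cases _ _ hn; omega)
    simpa [add_assoc] using this
  obtain ⟨i, hi⟩ := h.true_len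
  obtain ⟨j, n, hj, hjn⟩ := hi.prev hw
  obtain ⟨i', hi'⟩ := h.true_two
  exact ⟨hjn.ret_wide hb hj rfl (by have := h.false_cases _ _ hj; omega) (hnext _ _ hjn),
    hi'.ret_four_two_one_zero (hnext _ _ hi')⟩

theorem TwoLengths.false_of_three_le (hw : Admissible w) {a b : ℕ} (h : TwoLengths w b a)
    (hb : 3 ≤ b) (ha : 3 ≤ a) : False := by
  obtain ⟨h1, h2⟩ := h.ret_wide hw hb ha
  obtain ⟨h3, h4⟩ := h.not.ret_wide hw.not ha hb
  have := hw.three _ _ _ _ _ _ _ _ _ _ four_pos h1 h2 h3.of_not h4.of_not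
  obtain rfl : b = 4 := by omega
  obtain rfl : a = 4 := by omega
  obtain ⟨i₁, h₁⟩ := h.true_two
  obtain ⟨i₂, h₂⟩ := h.true_len
  obtain ⟨i₃, h₃⟩ := h.false_two
  obtain ⟨i₄, h₄⟩ := h.false_len
  refine Bool.false_ne_true ((Tree.check_sound hw four_pos ?_ ?_).symm.trans treeFourFour_check)
  · simp only [List.mem_cons, List.not_mem_nil, or_false, forall_eq_or_imp, forall_eq]
    exact ⟨⟨_, (run_iff_at two_pos).1 h₃⟩, ⟨_, (run_iff_at four_pos).1 h₄⟩,
      ⟨_, (run_iff_at two_pos).1 h₁⟩, ⟨_, (run_iff_at four_pos).1 h₂⟩⟩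
  · simp only [List.mem_cons, List.not_mem_nil, or_false, forall_eq_or_imp, forall_eq]
    have ht : ∀ n, n ≠ 2 → n ≠ 4 → 0 < n →
        ∀ i, ¬ At w i ((!true) :: List.replicate n true ++ [!true]) := fun n h2 h4 h0 i hat => by
      have := h.true_cases _ _ ((run_iff_at h0).2 hat)
      omega
    have hf : ∀ n, n ≠ 2 → n ≠ 4 → 0 < n →
        ∀ i, ¬ At w i ((!false) :: List.replicate n false ++ [!false]) := fun n h2 h4 h0 i hat => by
      have := h.false_cases _ _ ((run_iff_at h0).2 hat)
      omega
    refine ⟨hf 1 ?_ ?_ ?_, ht 1 ?_ ?_ ?_, hf 3 ?_ ?_ ?_,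
      hw.not_at_replicate (c := false) (n := 4) ?_ h₃.left, ht 3 ?_ ?_ ?_,
      hw.not_at_replicate (c := true) (n := 4) ?_ h₁.left⟩
    case refine_10 => exact fun i m hr => by have := h.false_cases _ _ hr; omega
    case refine_14 => exact fun i m hr => by have := h.true_cases _ _ hr; omega
    all_goals norm_num

theorem TwoLengths.false_of_one_of_three_le (hw : Admissible w) {b : ℕ} (h : TwoLengths w b 1)
    (hb : 3 ≤ b) : False := by
  obtain ⟨i₁, h₁⟩ := h.true_two
  obtain ⟨i₂, h₂⟩ := h.true_len
  obtain ⟨i₃, h₃⟩ := h.false_two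
  obtain ⟨i₄, h₄⟩ := h.false_len
  have hnext : ∀ i m, Run w false i m → w (i + m + 2) = true := by
    intro i m hr
    obtain ⟨n, hn⟩ := hr.next hw
    have := hn.mid 1 (by have := h.true_cases _ _ hn; omega)
    simpa [add_assoc] using this
  obtain ⟨j, n, hj, hjn⟩ := h₃.prev hw
  obtain ⟨m, rfl⟩ : ∃ m, n = m + 2 :=
    Nat.exists_eq_add_of_le' (by have := h.true_cases _ _ hj; omega)
  have h5 := hj.mid m (by omega)
  rw [show j + 1 + m = j + m + 1 by omega] at h5
  have := hw.three _ _ _ _ _ _ _ _ _ _ three_pos h₁.ret_three_two_one_zero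
    (h₄.ret_three_two_zero_one (hnext _ _ h₄)) (h₂.ret_three_two_one hb)
    (Run.ret_three_two_one_two (j := j + m + 1) hjn h5 (hnext (j + (m + 2)) 2 hjn))
  obtain rfl : b = 4 := by omega
  refine Bool.false_ne_true ((Tree.check_sound hw two_pos ?_ ?_).symm.trans treeOneFour_check)
  · simp only [List.mem_cons, List.not_mem_nil, or_false, forall_eq_or_imp, forall_eq]
    exact ⟨⟨_, (run_iff_at two_pos).1 h₃⟩, ⟨_, (run_iff_at one_pos).1 h₄⟩,
      ⟨_, (run_iff_at two_pos).1 h₁⟩, ⟨_, (run_iff_at four_pos).1 h₂⟩⟩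
  · simp only [List.mem_cons, List.not_mem_nil, or_false, forall_eq_or_imp, forall_eq]
    have ht : ∀ n, n ≠ 2 → n ≠ 4 → 0 < n →
        ∀ i, ¬ At w i ((!true) :: List.replicate n true ++ [!true]) := fun n h2 h4 h0 i hat => by
      have := h.true_cases _ _ ((run_iff_at h0).2 hat)
      omega
    refine ⟨hw.not_at_replicate (c := false) (n := 2) ?_ h₃.left, ht 1 ?_ ?_ ?_, ht 3 ?_ ?_ ?_,
      hw.not_at_replicate (c := true) (n := 4) ?_ h₁.left⟩
    case refine_1 => exact fun i m hr => by have := h.false_cases _ _ hr; omega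
    case refine_8 => exact fun i m hr => by have := h.true_cases _ _ hr; omega
    all_goals norm_num

theorem TwoLengths.false_of_one_one (hw : Admissible w) (h : TwoLengths w 1 1) : False := by
  obtain ⟨i₁, h₁⟩ := h.true_two
  obtain ⟨i₂, h₂⟩ := h.true_len
  obtain ⟨i₃, h₃⟩ := h.false_two
  obtain ⟨i₄, h₄⟩ := h.false_len
  refine Bool.false_ne_true ((Tree.check_sound hw two_pos ?_ ?_).symm.trans treeOneOne_check)
  · simp only [List.mem_cons, List.not_mem_nil, or_false, forall_eq_or_imp, forall_eq]
    exact ⟨⟨i₃ + 1, h₃.mid 0 two_pos, h₃.mid 1 one_lt_two, trivial⟩,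
      ⟨i₁ + 1, h₁.mid 0 two_pos, h₁.mid 1 one_lt_two, trivial⟩,
      ⟨_, (run_iff_at one_pos).1 h₄⟩, ⟨_, (run_iff_at one_pos).1 h₂⟩⟩
  · simp only [List.mem_cons, List.not_mem_nil, or_false, forall_eq_or_imp, forall_eq]
    exact ⟨hw.not_at_replicate (c := false) (n := 2)
        (fun i m hr => by have := h.false_cases _ _ hr; omega) h₃.left,
      hw.not_at_replicate (c := true) (n := 2)
        (fun i m hr => by have := h.true_cases _ _ hr; omega) h₁.left⟩

theorem TwoLengths.false (hw : Admissible w) {a b : ℕ} (h : TwoLengths w b a) : False := by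
  have h1 := h.pos
  have h2 := h.true_ne
  have h3 := h.false_ne
  rcases Nat.lt_or_ge b 3 with hb | hb <;> rcases Nat.lt_or_ge a 3 with ha | ha
  · obtain rfl : b = 1 := by omega
    obtain rfl : a = 1 := by omega
    exact h.false_of_one_one hw
  · obtain rfl : b = 1 := by omega
    exact h.not.false_of_one_of_three_le hw.not ha
  · obtain rfl : a = 1 := by omega
    exact h.false_of_one_of_three_le hw hb
  · exact h.false_of_three_le hw hb ha

theorem Admissible.run_length_unique (hw : Admissible w) {i₁ b₁ i₂ b₂ j₁ a₁ j₂ a₂ : ℕ}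
    (h₁ : Run w true i₁ b₁) (h₂ : Run w true i₂ b₂) (hb : b₁ ≠ b₂) (h₃ : Run w false j₁ a₁)
    (h₄ : Run w false j₂ a₂) : a₁ = a₂ := by
  by_contra ha
  have h2 := hw.two_mem h₁ h₂ hb h₃ h₄ ha
  wlog hb2 : b₁ = 2 generalizing i₁ b₁ i₂ b₂
  · exact this h₂ h₁ hb.symm ⟨h2.1.symm, h2.2⟩ (by omega)
  wlog ha2 : a₁ = 2 generalizing j₁ a₁ j₂ a₂
  · exact this h₄ h₃ (Ne.symm ha) ⟨h2.1, h2.2.symm⟩ (by omega)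
  subst hb2 ha2
  refine TwoLengths.false hw (b := b₂) (a := a₂) ⟨⟨_, h₁⟩, ⟨_, h₂⟩, ⟨_, h₃⟩, ⟨_, h₄⟩, hb.symm,
    Ne.symm ha, fun i n h => ?_, fun i n h => ?_⟩
  · have := hw.run_length_eq (h₃.mid 0 two_pos) (h₃.mid 1 one_lt_two) h₁ h₂ h
    omega
  · have := hw.not.run_length_eq (h₁.not.mid 0 two_pos) (h₁.not.mid 1 one_lt_two) h₃.not h₄.not
      h.not
    omega

end TwoRunLengths

section Blocks

variable {w : ℕ → Bool} {a : ℕ} {x r : ℕ → ℕ}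

/-- From position `r 0` on, `w` is the concatenation of the words `1 ^ (x m) 0 ^ a`, which start at
the positions `r m`. -/
structure Blocks (w : ℕ → Bool) (a : ℕ) (x r : ℕ → ℕ) : Prop where
  succ : ∀ m, r (m + 1) = r m + x m + a
  one : ∀ m, ∀ k < x m, w (r m + k) = true
  zero : ∀ m, ∀ k < a, w (r m + x m + k) = false

theorem Blocks.ones_one (h : Blocks w a x r) (m : ℕ) :
    ∀ e ≤ x m, ones w (r m + e) = ones w (r m) + e :=
  fun e he => ones_add_of_true fun k hk => h.one m k (by omega)

theorem Blocks.ones_zero (h : Blocks w a x r) (m : ℕ) :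
    ∀ e ≤ a, ones w (r m + x m + e) = ones w (r m) + x m := fun e he => by
  rw [ones_add_of_false fun k hk => h.zero m k (by omega), h.ones_one m _ le_rfl]

theorem Blocks.mono (h : Blocks w a x r) : Monotone r :=
  monotone_nat_of_le_succ fun m => by rw [h.succ]; omega

/-- Equal runs give equal words. -/
theorem Blocks.agree (h : Blocks w a x r) {m m' l d : ℕ} (hx : ∀ j < l, x (m + j) = x (m' + j))
    (hd : d ≤ x (m + l)) (hd' : d ≤ x (m' + l)) :
    r (m + l) + r m' = r m + r (m' + l) ∧
      ∀ e, r m + e < r (m + l) + d → w (r m + e) = w (r m' + e) := by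
  induction l generalizing d with
  | zero =>
    refine ⟨rfl, fun e he => ?_⟩
    rw [add_zero] at he hd hd'
    rw [h.one m e (by omega), h.one m' e (by omega)]
  | succ l ih =>
    have hl := hx l (by omega)
    obtain ⟨h1, h2⟩ := ih (d := x (m + l)) (fun j hj => hx j (by omega)) le_rfl hl.le
    have e1 := h.succ (m + l)
    have e2 := h.succ (m' + l)
    simp only [← add_assoc] at hd hd' ⊢
    refine ⟨by omega, fun e he => ?_⟩
    have h3 := h.mono (show m ≤ m + l by omega)
    rcases Nat.lt_or_ge (r m + e) (r (m + l) + x (m + l)) with hlt | hge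
    · exact h2 e hlt
    · obtain ⟨f, hf⟩ := Nat.exists_eq_add_of_le hge
      have hf' : r m' + e = r (m' + l) + x (m' + l) + f := by omega
      rcases Nat.lt_or_ge f a with hfa | hfa
      · rw [hf, hf', h.zero _ f hfa, h.zero _ f hfa]
      · obtain ⟨g, rfl⟩ := Nat.exists_eq_add_of_le hfa
        rw [hf, hf', ← add_assoc, ← add_assoc, ← e1, ← e2, h.one _ g (by omega),
          h.one _ g (by omega)]

theorem Blocks.locate (h : Blocks w a x r) (ha : 0 < a) {i : ℕ} (hi : r 0 ≤ i) :
    ∃ m e, i = r m + e ∧ e < x m + a := by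
  have hex : ∃ m, i < r m := by
    have : ∀ m, m ≤ r m := by
      intro m
      induction m with
      | zero => omega
      | succ m ih => rw [h.succ]; omega
    exact ⟨i + 1, this (i + 1)⟩
  obtain ⟨m, hm⟩ : ∃ m, Nat.find hex = m + 1 :=
    Nat.exists_eq_succ_of_ne_zero fun h0 => by
      have := Nat.find_spec hex
      rw [h0] at this
      omega
  have h1 := Nat.find_spec hex
  have h2 := Nat.find_min hex (m := m) (by omega)
  rw [hm, h.succ] at h1
  exact ⟨m, i - r m, by omega, by omega⟩

theorem Blocks.index (h : Blocks w a x r) (ha : 0 < a) {i b : ℕ}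
    (hr : Run w true i b) (hi : r 0 ≤ i) : ∃ m, i + 1 = r m ∧ x m = b := by
  obtain ⟨m, e, rfl, he⟩ := h.locate ha hi
  have h0 := hr.left
  have h1 := hr.mid 0 hr.pos
  have h2 := h.succ m
  have hxe : x m ≤ e := by
    by_contra hlt
    rw [h.one m e (by omega)] at h0
    simp at h0
  have hea : e + 1 = x m + a := by
    by_contra hne
    have := h.zero m (e + 1 - x m) (by omega)
    rw [show r m + x m + (e + 1 - x m) = r m + e + 1 + 0 by omega, h1] at this
    simp at this
  refine ⟨m + 1, by omega, ?_⟩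
  have h3 := hr.right
  rcases lt_trichotomy (x (m + 1)) b with hlt | heq | hgt
  · have := hr.mid _ hlt
    rw [show r m + e + 1 + x (m + 1) = r (m + 1) + x (m + 1) + 0 by omega, h.zero _ 0 ha] at this
    simp at this
  · exact heq
  · rw [show r m + e + 1 + b = r (m + 1) + b by omega, h.one _ b hgt] at h3
    simp at h3

theorem Admissible.exists_blocks (hw : Admissible w) {i b : ℕ} (hi : Run w true i b)
    (ha : ∀ j n, Run w false j n → n = a) :
    ∃ x r, Blocks w a x r ∧ ∀ m, ∃ j, Run w true j (x m) := by
  classical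
  let S := {p : ℕ × ℕ // Run w true p.1 p.2}
  have step : ∀ p : S, ∃ q : S, q.1.1 = p.1.1 + p.1.2 + a ∧
      ∀ k < a, w (p.1.1 + p.1.2 + 1 + k) = false := fun p => by
    obtain ⟨n, hn⟩ := p.2.next hw
    obtain rfl := ha _ _ hn
    obtain ⟨b', hb'⟩ := hn.next hw
    exact ⟨⟨(_, b'), hb'⟩, rfl, hn.mid⟩
  choose f hf using step
  let s : ℕ → S := fun m => f^[m] ⟨(i, b), hi⟩
  have hs : ∀ m, s (m + 1) = f (s m) := fun m => Function.iterate_succ_apply' _ _ _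
  refine ⟨fun m => (s m).1.2, fun m => (s m).1.1 + 1, ⟨fun m => ?_, fun m => (s m).2.mid,
    fun m k hk => ?_⟩, fun m => ⟨_, (s m).2⟩⟩
  · rw [hs, (hf _).1]
    omega
  · rw [add_right_comm _ 1]
    exact (hf (s m)).2 k hk

/-- The letter `t` at index `m` of `x` is followed by `k` different letters and again by `t`. -/
def Gap (x : ℕ → ℕ) (t m k : ℕ) : Prop :=
  x m = t ∧ (∀ j < k, x (m + 1 + j) ≠ t) ∧ x (m + 1 + k) = t

theorem exists_gap {t m : ℕ} (hm : x m = t) (hinf : ∀ M, ∃ m, M ≤ m ∧ x m = t) :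
    ∃ k, Gap x t m k := by
  have hex : ∃ k, x (m + 1 + k) = t := by
    obtain ⟨m', hm', h⟩ := hinf (m + 1)
    obtain ⟨k, rfl⟩ := Nat.exists_eq_add_of_le hm'
    exact ⟨k, h⟩
  exact ⟨Nat.find hex, hm, fun j hj => Nat.find_min hex hj, Nat.find_spec hex⟩

theorem exists_const_gap {t N : ℕ} (hinf : ∀ M, ∃ m, M ≤ m ∧ x m = t)
    (h : ∀ m k l, N ≤ m → Gap x t m k → Gap x t (m + 1 + k) l → l ≤ k) :
    ∃ M k, N ≤ M ∧ ∀ m, M ≤ m → x m = t → Gap x t m k := by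
  have hex : ∃ k m, N ≤ m ∧ Gap x t m k := by
    obtain ⟨m, hm, hm'⟩ := hinf N
    obtain ⟨k, hk⟩ := exists_gap hm' hinf
    exact ⟨k, m, hm, hk⟩
  classical
  obtain ⟨M, hM, hgap⟩ := Nat.find_spec hex
  have hmin := fun k => Nat.find_min' hex (m := k)
  generalize Nat.find hex = k at hgap hmin
  have hall : ∀ i, Gap x t (M + i * (k + 1)) k := by
    intro i
    induction i with
    | zero => simpa using hgap
    | succ i ih =>
      obtain ⟨l, hl⟩ := exists_gap ih.2.2 hinf
      have h1 := h _ _ _ (by omega) ih hl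
      have h2 := hmin l ⟨_, by omega, hl⟩
      obtain rfl : l = k := by omega
      rwa [show M + i * (l + 1) + 1 + l = M + (i + 1) * (l + 1) by ring] at hl
  refine ⟨M, k, hM, fun m hm hx => ?_⟩
  have hdiv := Nat.div_add_mod (m - M) (k + 1)
  have hlt : (m - M) % (k + 1) < k + 1 := Nat.mod_lt _ k.succ_pos
  have hi := hall ((m - M) / (k + 1))
  rw [mul_comm] at hdiv
  rcases Nat.eq_zero_or_pos ((m - M) % (k + 1)) with h0 | h0
  · rwa [show M + (m - M) / (k + 1) * (k + 1) = m by omega] at hi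
  · refine absurd hx ?_
    have := hi.2.1 ((m - M) % (k + 1) - 1) (by omega)
    rwa [show M + (m - M) / (k + 1) * (k + 1) + 1 + ((m - M) % (k + 1) - 1) = m by omega] at this

theorem Blocks.false_of_gap (hw : Admissible w) (h : Blocks w a x r) (ha : 0 < a)
    {n v t t' o k N : ℕ} (hn : 0 < n) (ho : o ≤ a) (hx : ∀ m, x m = t ∨ x m = t')
    (hocc : ∀ i, r 1 ≤ i → (Occ w n v i ↔ ∃ m, i + o = r m ∧ x m = t))
    (hinf : ∀ M, ∃ m, M ≤ m ∧ x m = t) (hgap : ∀ m, N ≤ m → x m = t → Gap x t m k) : False := by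
  have hlt : ∀ m m', r m < r m' → m < m' := fun m m' hr => by
    by_contra hle
    have := h.mono (not_lt.1 hle)
    omega
  have hpred : ∀ m, 1 ≤ m → r m = r (m - 1) + x (m - 1) + a := fun m hm => by
    rw [← h.succ, Nat.sub_add_cancel hm]
  obtain ⟨m₀, hm₀, hxm₀⟩ := hinf (N + 2)
  have hr₀ := hpred m₀ (by omega)
  have hr₁ := h.mono (show 1 ≤ m₀ - 1 by omega)
  refine hw.false_of_single hn (p := r m₀ - o) ((hocc _ (by omega)).2 ⟨m₀, by omega, hxm₀⟩)
    (r (N + 2)) (r (m₀ + (k + 1)) - r m₀) (fun e => w (r m₀ - o + e)) ?_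
  rintro i j hi ⟨hij, hi', hj', hno⟩
  have hr₂ := h.mono (show 1 ≤ N + 2 by omega)
  obtain ⟨m, him, hxm⟩ := (hocc i (by omega)).1 hi'
  have hNm : N < m := hlt _ _ (by
    have h1 := hpred (N + 2) (by omega)
    have h2 := h.mono (show N ≤ N + 2 - 1 by omega)
    omega)
  have hg := hgap m hNm.le hxm
  have hg₀ := hgap m₀ (by omega) hxm₀
  have hag := h.agree (m := m) (m' := m₀) (l := k + 1) (d := 0) (fun j hj => by
    rcases Nat.eq_zero_or_pos j with rfl | hj0
    · rw [add_zero, add_zero, hxm, hxm₀]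
    · have h1 := hg.2.1 (j - 1) (by omega)
      have h2 := hg₀.2.1 (j - 1) (by omega)
      rw [show m + 1 + (j - 1) = m + j by omega] at h1
      rw [show m₀ + 1 + (j - 1) = m₀ + j by omega] at h2
      rw [(hx _).resolve_left h1, (hx _).resolve_left h2]) (by omega) (by omega)
  have hmono := h.mono (show m₀ ≤ m₀ + (k + 1) by omega)
  have hrm := hpred m (by omega)
  constructor
  · have hnext : Occ w n v (i + (r (m₀ + (k + 1)) - r m₀)) := by
      refine (hocc _ (by omega)).2 ⟨m + (k + 1), by omega, ?_⟩
      rw [← add_assoc, add_right_comm]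
      exact hg.2.2
    obtain ⟨m', hjm', hxm'⟩ := (hocc j (by omega)).1 hj'
    by_contra hne
    rcases Nat.lt_or_ge j (i + (r (m₀ + (k + 1)) - r m₀)) with hjlt | hjge
    · have h1 := hlt m m' (by omega)
      have h2 := hlt m' (m + (k + 1)) (by omega)
      refine hg.2.1 (m' - m - 1) (by omega) ?_
      rwa [show m + 1 + (m' - m - 1) = m' by omega]
    · refine hno _ ?_ (by omega) hnext
      have := h.succ m₀
      have := h.mono (show m₀ + 1 ≤ m₀ + (k + 1) by omega)
      omega
  · intro e he
    rcases Nat.lt_or_ge e o with heo | heo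
    · have h1 := h.zero (m - 1) (a - o + e) (by omega)
      have h2 := h.zero (m₀ - 1) (a - o + e) (by omega)
      rw [show i + e = r (m - 1) + x (m - 1) + (a - o + e) by omega, h1,
        show r m₀ - o + e = r (m₀ - 1) + x (m₀ - 1) + (a - o + e) by omega, h2]
    · have := hag.2 (e - o) (by omega)
      rwa [show r m + (e - o) = i + e by omega, show r m₀ + (e - o) = r m₀ - o + e by omega] at this

/-- The windows `1 ^ c` for the largest length `c` of a run. -/
theorem Blocks.occ_one_iff (h : Blocks w a x r) (ha : 0 < a) {c : ℕ} (hc : 0 < c)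
    (hx : ∀ m, x m ≤ c) (i : ℕ) (hi : r 1 ≤ i) :
    Occ w c c i ↔ ∃ m, i + 0 = r m ∧ x m = c := by
  constructor
  · intro ho
    have hall : ∀ k < c, w (i + k) = true := by
      intro k hk
      by_contra hne
      have e1 := ones_bounds (w := w) (show i ≤ i + k by omega)
      have e2 := ones_bounds (w := w) (show i + k + 1 ≤ i + c by omega)
      have e3 := ones_succ_of_false (Bool.eq_false_of_not_eq_true hne)
      unfold Occ at ho
      omega
    obtain ⟨m, e, rfl, he⟩ := h.locate ha ((h.mono zero_le_one).trans hi)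
    have hex : e < x m := by
      by_contra hge
      have := hall 0 hc
      rw [show r m + e + 0 = r m + x m + (e - x m) by omega, h.zero m _ (by omega)] at this
      simp at this
    have hcx : e + c ≤ x m := by
      by_contra hlt
      have := hall (x m - e) (by omega)
      rw [show r m + e + (x m - e) = r m + x m + 0 by omega, h.zero m 0 ha] at this
      simp at this
    have := hx m
    exact ⟨m, by omega, by omega⟩
  · rintro ⟨m, rfl, hm⟩
    exact h.ones_one m c hm.ge

/-- The windows `0 ^ a 1 ^ b 0 ^ a` for the least length `b` of a run. -/
theorem Blocks.occ_zero_iff (h : Blocks w a x r) (ha : 0 < a) {b : ℕ} (hb : 0 < b)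
    (hx : ∀ m, b ≤ x m) (i : ℕ) (hi : r 1 ≤ i) :
    Occ w (a + b + a) b i ↔ ∃ m, i + a = r m ∧ x m = b := by
  constructor
  · intro ho
    have hr01 := h.mono zero_le_one
    obtain ⟨m, e, hm, he⟩ := h.locate ha (show r 0 ≤ i + a by omega)
    obtain ⟨m, rfl⟩ : ∃ m', m = m' + 1 := by
      refine Nat.exists_eq_add_of_le' (Nat.one_le_iff_ne_zero.2 ?_)
      rintro rfl
      have := h.succ 0
      simp at this
      omega
    have s1 := h.succ m
    have s2 := h.succ (m + 1)
    have x1 := hx m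
    have x2 := hx (m + 1)
    have x3 := hx (m + 1 + 1)
    have o1 := h.ones_one (m + 1)
    have o2 := h.ones_one (m + 1 + 1)
    have z1 := h.ones_zero m
    have z2 := h.ones_zero (m + 1)
    have b1 := z1 a le_rfl
    have b2 := z2 a le_rfl
    rw [← s1] at b1
    rw [← s2] at b2
    unfold Occ at ho
    have key : e = 0 ∧ x (m + 1) = b := by
      rcases Nat.eq_zero_or_pos e with rfl | he0
      · refine ⟨rfl, ?_⟩
        by_contra hne
        have e1 := z1 0 (by omega)
        have e2 := o1 (b + 1) (by omega)
        have e3 := (ones_bounds (w := w) (show r (m + 1) + (b + 1) ≤ i + (a + b + a) by omega)).1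
        rw [show r m + x m + 0 = i by omega] at e1
        omega
      · exfalso
        rcases Nat.lt_or_ge (x (m + 1)) e with hxe | hxe
        · have e1 := o1 (x (m + 1) - 1) (by omega)
          have e2 := (ones_bounds (w := w)
            (show i ≤ r (m + 1) + (x (m + 1) - 1) by omega)).1
          have e3 := o2 b x3
          have e4 := (ones_bounds (w := w)
            (show r (m + 1 + 1) + b ≤ i + (a + b + a) by omega)).1
          omega
        · rcases Nat.lt_or_ge a e with hae | hae
          · have e1 := o1 (e - a) (by omega)
            rw [show r (m + 1) + (e - a) = i by omega] at e1
            rcases Nat.lt_or_ge (x (m + 1)) (e + b) with hlt | hge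
            · have e2 := o2 (e + b - x (m + 1)) (by omega)
              rw [show r (m + 1 + 1) + (e + b - x (m + 1)) = i + (a + b + a) by omega] at e2
              omega
            · have e2 := o1 (e + b) hge
              have e3 := (ones_bounds (w := w)
                (show r (m + 1) + (e + b) ≤ i + (a + b + a) by omega)).1
              omega
          · have e1 := z1 e hae
            rw [show r m + x m + e = i by omega] at e1
            rcases Nat.eq_or_lt_of_le x2 with heq | hlt
            · have e2 := o2 1 (by omega)
              have e3 := (ones_bounds (w := w)
                (show r (m + 1 + 1) + 1 ≤ i + (a + b + a) by omega)).1
              omega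
            · have e2 := o1 (b + 1) hlt
              have e3 := (ones_bounds (w := w)
                (show r (m + 1) + (b + 1) ≤ i + (a + b + a) by omega)).1
              omega
    exact ⟨m + 1, by omega, key.2⟩
  · rintro ⟨m, hm, hx⟩
    obtain ⟨m, rfl⟩ : ∃ m', m = m' + 1 := by
      refine Nat.exists_eq_add_of_le' (Nat.one_le_iff_ne_zero.2 ?_)
      rintro rfl
      have := h.mono zero_le_one
      omega
    have s1 := h.succ m
    have z1 := h.ones_zero m 0 (by omega)
    have z1' := h.ones_zero m a le_rfl
    have z2 := h.ones_zero (m + 1) a le_rfl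
    rw [show r m + x m + 0 = i by omega] at z1
    rw [← s1] at z1'
    rw [show r (m + 1) + x (m + 1) + a = i + (a + b + a) by omega] at z2
    unfold Occ
    omega

end Blocks

section Periods

variable {w : ℕ → Bool}

theorem ones_of_period {s p T : ℕ} (hsp : s < p) (h : ∀ e, s + e < T → w (s + e) = w (p + e))
    {i : ℕ} (hi : s ≤ i) (hi' : i ≤ T) :
    ones w (i + (p - s)) = ones w i + (ones w p - ones w s) := by
  have := ones_congr (w := w) (w' := w) (i := s) (j := p) (n := i - s)
    fun k hk => h k (by omega)
  rw [show s + (i - s) = i by omega, show p + (i - s) = i + (p - s) by omega] at this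
  have := ones_bounds (w := w) hsp.le
  omega

theorem occ_pred_iff {s p T : ℕ} (hsp : s < p) (h : ∀ e, s + e < T → w (s + e) = w (p + e))
    {i : ℕ} (hi : s ≤ i) (hi' : i ≤ T) :
    Occ w (p - s - 1) (ones w p - ones w s) i ↔ w (i + (p - s - 1)) = false := by
  have h1 := ones_of_period hsp h hi hi'
  have h2 : ones w (i + (p - s - 1) + 1) = ones w (i + (p - s - 1)) + _ := rfl
  rw [show i + (p - s - 1) + 1 = i + (p - s) by omega] at h2
  unfold Occ
  cases hc : w (i + (p - s - 1)) <;> simp [hc] at h2 ⊢ <;> omega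

theorem occ_succ_iff {s p T : ℕ} (hsp : s < p) (h : ∀ e, s + e < T → w (s + e) = w (p + e))
    {i : ℕ} (hi : s ≤ i) (hi' : i ≤ T) :
    Occ w (p - s + 1) (ones w p - ones w s) i ↔ w (i + (p - s)) = false := by
  have h1 := ones_of_period hsp h hi hi'
  unfold Occ
  rw [← add_assoc, ones, h1]
  cases hc : w (i + (p - s)) <;> simp

end Periods

section Blocks

variable {w : ℕ → Bool} {a : ℕ} {x r : ℕ → ℕ}

theorem Blocks.pred_eq_false (h : Blocks w a x r) (ha : 0 < a) (m : ℕ) :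
    w (r (m + 1) - 1) = false := by
  have h1 := h.zero m (a - 1) (by omega)
  rwa [show r m + x m + (a - 1) = r (m + 1) - 1 by rw [h.succ]; omega] at h1

/-- The gaps between the long runs do not increase. -/
theorem Blocks.false_of_long_gap (hw : Admissible w) (h : Blocks w a x r) (ha : 2 ≤ a)
    {b c m k : ℕ} (hb : 0 < b) (hbc : b < c) (hk : 0 < k) (h0 : x m = c)
    (h1 : ∀ j < k, x (m + 1 + j) = b) (h2 : x (m + (k + 1)) = c)
    (h3 : ∀ j ≤ k, x (m + (k + 1) + 1 + j) = b) : False := by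
  have hag := h.agree (m := m) (m' := m + (k + 1)) (l := k + 1) (d := b) (fun j hj => by
    rcases Nat.eq_zero_or_pos j with rfl | hj0
    · rw [add_zero, add_zero, h0, h2]
    · have e1 := h1 (j - 1) (by omega)
      have e2 := h3 (j - 1) (by omega)
      rw [show m + 1 + (j - 1) = m + j by omega] at e1
      rw [show m + (k + 1) + 1 + (j - 1) = m + (k + 1) + j by omega] at e2
      rw [e1, e2]) (by omega)
    (by rw [← h3 k le_rfl, add_assoc _ 1 k, add_comm 1 k])
  have s0 := h.succ m
  have s1 := h.succ (m + 1)
  have x1 : x (m + 1) = b := h1 0 hk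
  have hmono := h.mono (show m + 1 + 1 ≤ m + (k + 1) by omega)
  have hsp : r m < r (m + (k + 1)) := by omega
  have hx3 : x (m + (k + 1) + (k + 1)) = b := by
    rw [← h3 k le_rfl, add_assoc _ 1 k, add_comm 1 k]
  set p := r (m + (k + 1)) with hp
  set u := r (m + (k + 1) + (k + 1)) with hu
  have hocc := fun i hi hi' => occ_pred_iff (w := w) (i := i) hsp hag.2 hi hi'
  have hocc' : ∀ i, r m < i → i ≤ p + b → (Occ w (p - r m - 1) (ones w p - ones w (r m)) i ↔
      w (i - 1) = false) := by
    intro i hi hi'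
    rw [hocc i hi.le hi', show i + (p - r m - 1) = p + (i - 1 - r m) by omega,
      ← hag.2 (i - 1 - r m) (by omega), show r m + (i - 1 - r m) = i - 1 by omega]
  have hyes : ∀ m' k', m ≤ m' → k' < a → r m' + x m' + k' < p + b →
      Occ w (p - r m - 1) (ones w p - ones w (r m)) (r m' + x m' + k' + 1) := by
    intro m' k' hm' hk' hlt
    have := h.mono hm'
    rw [hocc' _ (by omega) (by omega)]
    exact h.zero m' k' hk'
  have hno : ∀ m' i, m ≤ m' → r m' < i → i ≤ r m' + x m' → i ≤ p + b →
      ¬ Occ w (p - r m - 1) (ones w p - ones w (r m)) i := by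
    intro m' i hm' hi hi' hlt
    have := h.mono hm'
    rw [hocc' _ (by omega) hlt, show i - 1 = r m' + (i - 1 - r m') by omega,
      h.one m' _ (by omega)]
    simp
  have ho0 : Occ w (p - r m - 1) (ones w p - ones w (r m)) (r m) := by
    rw [hocc (r m) le_rfl (by omega), show r m + (p - r m - 1) = p - 1 by omega]
    exact h.pred_eq_false (by omega) (m + k)
  have z0 := h.ones_zero m
  have z1 := h.ones_zero (m + 1)
  have ha0 := z0 a le_rfl
  rw [← s0] at ha0
  have r1 : Ret w (p - r m - 1) (ones w p - ones w (r m)) 1 c :=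
    ret_of (j := r m + x m + 0 + 1) ho0 (hyes m 0 le_rfl (by omega) (by omega)) (by omega)
      (fun i hi hi' => hno m i le_rfl hi (by omega) (by omega)) (by omega)
      ((z0 1 (by omega)).trans (by omega))
  have r2 : Ret w (p - r m - 1) (ones w p - ones w (r m)) 1 0 :=
    ret_of (i := r m + x m + 0 + 1) (j := r m + x m + 1 + 1)
      (hyes m 0 le_rfl (by omega) (by omega)) (hyes m 1 le_rfl (by omega) (by omega)) (by omega)
      (by intros; omega) (by omega) ((z0 2 ha).trans (z0 1 (by omega)).symm)
  have r3 : Ret w (p - r m - 1) (ones w p - ones w (r m)) 1 b := by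
    refine ret_of (i := r m + x m + (a - 1) + 1) (j := r (m + 1) + x (m + 1) + 0 + 1)
      (hyes m (a - 1) le_rfl (by omega) (by omega))
      (hyes (m + 1) 0 (by omega) (by omega) (by omega)) (by omega)
      (fun i hi hi' => hno (m + 1) i (by omega) (by omega) (by omega) (by omega)) (by omega)
      ((z1 1 (by omega)).trans ?_)
    rw [show r m + x m + (a - 1) + 1 = r (m + 1) by omega]
    omega
  have hop : Occ w (p - r m - 1) (ones w p - ones w (r m)) p := by
    rw [hocc' p hsp (by omega)]
    exact h.pred_eq_false (by omega) (m + k)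
  have op := h.ones_one (m + (k + 1))
  have zp := h.ones_zero (m + (k + 1))
  have zu := h.ones_zero (m + (k + 1) + (k + 1))
  have hper := ones_of_period (i := p + b) hsp hag.2 (by omega) le_rfl
  rw [← hp] at op zp
  rw [← hu] at zu
  have hu1 := zu 0 (by omega)
  have hu2 := zu 1 (by omega)
  rw [show u + x (m + (k + 1) + (k + 1)) + 0 = p + b + (p - r m) by omega] at hu1
  obtain ⟨z, o, r4, h4, h5⟩ := hw.ret_of_open (q := p + c + 2) hop (by omega) (by
    intro i hi hi'
    rcases Nat.lt_or_ge (p + b) i with hlt | hge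
    · intro ho
      unfold Occ at ho
      have e1 := op b (by omega)
      have e2 := op (min (i - p) c) (by omega)
      have e3 := (ones_bounds (w := w) (show p + min (i - p) c ≤ i by omega)).1
      have e4 := (ones_bounds (w := w)
        (show u + x (m + (k + 1) + (k + 1)) + 1 ≤ max (u + b + 1) (i + (p - r m - 1)) by omega)).2
      have e5 := (ones_bounds (w := w)
        (show i + (p - r m - 1) ≤ max (u + b + 1) (i + (p - r m - 1)) by omega)).1
      omega
    · exact hno (m + (k + 1)) i (by omega) hi (by omega) hge)
  have e1 := zp 2 ha
  rw [show p + x (m + (k + 1)) + 2 = p + c + 2 by omega] at e1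
  have := hw.three _ _ _ _ _ _ _ _ _ _ (by omega) r1 r2 r3 r4
  omega

/-- The gaps between the short runs do not increase. -/
theorem Blocks.false_of_short_gap (hw : Admissible w) (h : Blocks w a x r) (ha : 2 ≤ a)
    {b c m k : ℕ} (hb : 0 < b) (hbc : b < c) (hk : 0 < k) (hm : 0 < m) (h0 : x m = b)
    (h1 : ∀ j < k, x (m + 1 + j) = c) (h2 : x (m + (k + 1)) = b)
    (h3 : ∀ j ≤ k, x (m + (k + 1) + 1 + j) = c) : False := by
  have hx3 : x (m + (k + 1) + (k + 1)) = c := by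
    rw [← h3 k le_rfl, add_assoc _ 1 k, add_comm 1 k]
  have hag := h.agree (m := m) (m' := m + (k + 1)) (l := k + 1) (d := b) (fun j hj => by
    rcases Nat.eq_zero_or_pos j with rfl | hj0
    · rw [add_zero, add_zero, h0, h2]
    · have e1 := h1 (j - 1) (by omega)
      have e2 := h3 (j - 1) (by omega)
      rw [show m + 1 + (j - 1) = m + j by omega] at e1
      rw [show m + (k + 1) + 1 + (j - 1) = m + (k + 1) + j by omega] at e2
      rw [e1, e2]) h2.ge (by omega)
  have s0 := h.succ m
  have s1 := h.succ (m + 1)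
  have x1 : x (m + 1) = c := h1 0 hk
  have hmono := h.mono (show m + 1 + 1 ≤ m + (k + 1) by omega)
  have hsp : r m < r (m + (k + 1)) := by omega
  have hpred : w (r m - 1) = false ∧ 0 < r m := by
    obtain ⟨m, rfl⟩ := Nat.exists_eq_add_of_le' hm
    exact ⟨h.pred_eq_false (by omega) m, by rw [h.succ]; omega⟩
  have hp1 := ones_succ_of_false hpred.1
  rw [Nat.sub_add_cancel hpred.2] at hp1
  set p := r (m + (k + 1)) with hp
  set u := r (m + (k + 1) + (k + 1)) with hu
  have hocc : ∀ i, r m ≤ i → i < p + b → (Occ w (p - r m + 1) (ones w p - ones w (r m)) i ↔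
      w i = false) := by
    intro i hi hi'
    rw [occ_succ_iff hsp hag.2 hi hi'.le, show i + (p - r m) = p + (i - r m) by omega,
      ← hag.2 (i - r m) (by omega), Nat.add_sub_cancel' hi]
  have hyes : ∀ m' k', m ≤ m' → k' < a → r m' + x m' + k' < p + b →
      Occ w (p - r m + 1) (ones w p - ones w (r m)) (r m' + x m' + k') := by
    intro m' k' hm' hk' hlt
    have := h.mono hm'
    rw [hocc _ (by omega) (by omega)]
    exact h.zero m' k' hk'
  have hno : ∀ m' i, m ≤ m' → r m' ≤ i → i < r m' + x m' → i < p + b →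
      ¬ Occ w (p - r m + 1) (ones w p - ones w (r m)) i := by
    intro m' i hm' hi hi' hlt
    have := h.mono hm'
    rw [hocc i (by omega) hlt, show i = r m' + (i - r m') by omega, h.one m' _ (by omega)]
    simp
  have hle := ones_bounds (w := w) hsp.le
  have ho0 : Occ w (p - r m + 1) (ones w p - ones w (r m)) (r m - 1) := by
    unfold Occ
    rw [show r m - 1 + (p - r m + 1) = p by omega]
    omega
  have z0 := h.ones_zero m
  have z1 := h.ones_zero (m + 1)
  have ha0 := z0 a le_rfl
  rw [← s0] at ha0
  have r1 : Ret w (p - r m + 1) (ones w p - ones w (r m)) 1 b :=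
    ret_of (j := r m + x m + 0) ho0 (hyes m 0 le_rfl (by omega) (by omega)) (by omega)
      (fun i hi hi' => hno m i le_rfl (by omega) (by omega) (by omega)) (by omega)
      ((z0 0 (by omega)).trans (by omega))
  have r2 : Ret w (p - r m + 1) (ones w p - ones w (r m)) 1 0 :=
    ret_of (i := r m + x m + 0) (j := r m + x m + 1)
      (hyes m 0 le_rfl (by omega) (by omega)) (hyes m 1 le_rfl (by omega) (by omega)) (by omega)
      (by intros; omega) (by omega) ((z0 1 (by omega)).trans (z0 0 (by omega)).symm)
  have r3 : Ret w (p - r m + 1) (ones w p - ones w (r m)) 1 c := by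
    refine ret_of (i := r m + x m + (a - 1)) (j := r (m + 1) + x (m + 1) + 0)
      (hyes m (a - 1) le_rfl (by omega) (by omega))
      (hyes (m + 1) 0 (by omega) (by omega) (by omega)) (by omega)
      (fun i hi hi' => hno (m + 1) i (by omega) (by omega) (by omega) (by omega)) (by omega)
      ((z1 0 (by omega)).trans ?_)
    rw [z0 (a - 1) (by omega)]
    omega
  have hp2 := ones_succ_of_false (h.pred_eq_false (by omega) (m + k))
  rw [add_assoc m k 1, ← hp, Nat.sub_add_cancel (by omega)] at hp2
  have hop : Occ w (p - r m + 1) (ones w p - ones w (r m)) (p - 1) := by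
    rw [hocc _ (by omega) (by omega)]
    exact h.pred_eq_false (by omega) (m + k)
  have zp := h.ones_zero (m + (k + 1)) 1 (by omega)
  rw [← hp] at zp
  obtain ⟨z, o, r4, h4, h5⟩ := hw.ret_of_open (q := p + b + 1) hop (by omega) (by
    intro i hi hi'
    rcases Nat.lt_or_ge i (p + b) with hlt | hge
    · exact hno (m + (k + 1)) i (by omega) (by omega) (by omega) hlt
    · obtain rfl : i = p + b := by omega
      rw [occ_succ_iff hsp hag.2 (by omega) le_rfl, show p + b + (p - r m) = u + b by omega, hu,
        h.one _ b (by omega)]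
      simp)
  rw [show p + x (m + (k + 1)) + 1 = p + b + 1 by omega] at zp
  have := hw.three _ _ _ _ _ _ _ _ _ _ (by omega) r1 r2 r3 r4
  omega

set_option maxHeartbeats 400000 in
/-- Two long runs followed by a short run determine the parameters. -/
theorem Blocks.eq_two_of_long_long_short (hw : Admissible w) (h : Blocks w a x r) (ha : 2 ≤ a)
    {b c m : ℕ} (hb : 0 < b) (hbc : b < c) (hm : 0 < m) (h0 : x m = c) (h1 : x (m + 1) = c)
    (h2 : x (m + 2) = b) (h3 : b ≤ x (m + 3)) : a = 2 ∧ c = 2 * b := by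
  have hag := h.agree (m := m) (m' := m + 1) (l := 1) (d := b) (fun j hj => by
    obtain rfl : j = 0 := by omega
    rw [add_zero, add_zero, h0, h1]) (by omega) h2.ge
  have s0 := h.succ m
  have s1 : r (m + 2) = _ := h.succ (m + 1)
  have s2 : r (m + 3) = _ := h.succ (m + 2)
  have hsp : r m < r (m + 1) := by omega
  have hpred : w (r m - 1) = false ∧ 0 < r m := by
    obtain ⟨m, rfl⟩ := Nat.exists_eq_add_of_le' hm
    exact ⟨h.pred_eq_false (by omega) m, by rw [h.succ]; omega⟩
  have hp1 := ones_succ_of_false hpred.1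
  rw [Nat.sub_add_cancel hpred.2] at hp1
  have z0 := h.ones_zero m
  have z1 := h.ones_zero (m + 1)
  have z2 := h.ones_zero (m + 2)
  have ha0 := z0 a le_rfl
  have ha1 := z1 a le_rfl
  have ha2 := z2 a le_rfl
  rw [← s0] at ha0
  rw [← s1] at ha1
  rw [← s2] at ha2
  have o1 := h.ones_one (m + 1)
  set p := r (m + 1) with hp
  obtain ⟨v, hv⟩ : ∃ v, v = ones w p - ones w (r m) := ⟨_, rfl⟩
  have hocc : ∀ i, r m ≤ i → i < p + b → (Occ w (p - r m + 1) v i ↔ w i = false) := by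
    intro i hi hi'
    rw [hv, occ_succ_iff hsp hag.2 hi hi'.le, show i + (p - r m) = p + (i - r m) by omega,
      ← hag.2 (i - r m) (by omega), Nat.add_sub_cancel' hi]
  have hyes : ∀ k < a, Occ w (p - r m + 1) v (r m + x m + k) := fun k hk => by
    rw [hocc _ (by omega) (by omega)]
    exact h.zero m k hk
  have hno : ∀ m' i, m ≤ m' → r m' ≤ i → i < r m' + x m' → i < p + b →
      ¬ Occ w (p - r m + 1) v i := by
    intro m' i hm' hi hi' hlt
    have := h.mono hm'
    rw [hocc i (by omega) hlt, show i = r m' + (i - r m') by omega, h.one m' _ (by omega)]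
    simp
  have ho0 : Occ w (p - r m + 1) v (r m - 1) := by
    unfold Occ
    rw [show r m - 1 + (p - r m + 1) = p by omega]
    omega
  have hot : Occ w (p - r m + 1) v (p + b) := by
    rw [hv, occ_succ_iff hsp hag.2 (by omega) le_rfl,
      show p + b + (p - r m) = r (m + 2) + x (m + 2) + 0 by omega]
    exact h.zero _ 0 (by omega)
  have r1 : Ret w (p - r m + 1) v 1 c :=
    ret_of (j := r m + x m + 0) ho0 (hyes 0 (by omega)) (by omega)
      (fun i hi hi' => hno m i le_rfl (by omega) (by omega) (by omega)) (by omega)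
      ((z0 0 (by omega)).trans (by omega))
  have r2 : Ret w (p - r m + 1) v 1 0 :=
    ret_of (i := r m + x m + 0) (j := r m + x m + 1) (hyes 0 (by omega)) (hyes 1 ha) (by omega)
      (by intros; omega) (by omega) ((z0 1 (by omega)).trans (z0 0 (by omega)).symm)
  have r3 : Ret w (p - r m + 1) v 1 b := by
    refine ret_of (i := r m + x m + (a - 1)) (j := p + b) (hyes (a - 1) (by omega)) hot (by omega)
      (fun i hi hi' => hno (m + 1) i (by omega) (by omega) (by omega) (by omega)) (by omega)
      ((o1 b (by omega)).trans ?_)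
    rw [z0 (a - 1) (by omega)]
    omega
  obtain ⟨j, hj⟩ := hw.next hot
  obtain ⟨z, o, hz, ho, hzo⟩ : ∃ z o, z + ones w j + (p + b) = j + ones w (p + b) ∧
      o + ones w (p + b) = ones w j ∧ z = 1 ∧ (o = c ∨ o = 0 ∨ o = b) := by
    have h4 := hw.three _ _ _ _ _ _ _ _ _ _ (by omega) r1 r2 r3 hj.ret
    have hb1 := ones_bounds (w := w) hj.1.le
    have hpj := hj.1
    refine ⟨j - (p + b) - (ones w j - ones w (p + b)), ones w j - ones w (p + b), by omega,
      by omega, ?_⟩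
    generalize ones w j - ones w (p + b) = o at h4 ⊢
    generalize j - (p + b) - o = z at h4 ⊢
    clear * - h4 hb hbc
    omega
  have e1 := o1 b (by omega)
  have hpj := hj.1
  have hj1 : p + c < j := by
    by_contra hle
    have := o1 (j - p) (by omega)
    rw [show p + (j - p) = j by omega] at this
    omega
  have hj2 : j < p + c + 2 := by
    by_contra hge
    have e2 := z1 2 ha
    have := ones_bounds (w := w) (show p + x (m + 1) + 2 ≤ j by omega)
    omega
  have e2 := z1 1 (by omega)
  rw [show p + x (m + 1) + 1 = j by omega] at e2
  have hc : c = 2 * b := by omega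
  refine ⟨?_, hc⟩
  have hoj := hj.2.2.1
  unfold Occ at hoj
  rw [show j + (p - r m + 1) = r (m + 2) + c + 2 by omega] at hoj
  have hvc : v = c := by omega
  have hj3 : ones w j = ones w (r (m + 2)) := by omega
  rw [hj3, hvc] at hoj
  have o3 := h.ones_one (m + 3)
  clear r1 r2 r3 hz ho hzo e1 e2 hyes hno ho0 hot hocc z0 z1 o1 hag hp1 hpred ha0 ha1 hj3 hvc
  rcases Nat.lt_or_ge a (b + 2) with hlt | hge
  · have e3 := o3 (b + 2 - a) (by omega)
    rw [show r (m + 3) + (b + 2 - a) = r (m + 2) + c + 2 by omega] at e3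
    omega
  · have e3 := z2 (b + 2) hge
    rw [show r (m + 2) + x (m + 2) + (b + 2) = r (m + 2) + c + 2 by omega] at e3
    omega

theorem Blocks.false_of_long_long_short_short (hw : Admissible w) (h : Blocks w 2 x r)
    {b m : ℕ} (hb : 0 < b) (h0 : x (m + 1) = 2 * b) (h1 : x (m + 2) = 2 * b)
    (h2 : x (m + 3) = b) (h3 : x (m + 4) = b) : False := by
  have s0 := h.succ m
  have s1 : r (m + 2) = _ := h.succ (m + 1)
  have s2 : r (m + 3) = _ := h.succ (m + 2)
  have s3 : r (m + 4) = _ := h.succ (m + 3)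
  have zz := h.ones_zero m
  have z0 := h.ones_zero (m + 1)
  have z1 := h.ones_zero (m + 2)
  have z2 := h.ones_zero (m + 3)
  have z3 := h.ones_zero (m + 4)
  have o0 := h.ones_one (m + 1)
  have o1 := h.ones_one (m + 2)
  have o2 := h.ones_one (m + 3)
  have o3 := h.ones_one (m + 4)
  have ez := zz 2 le_rfl
  have e0 := z0 2 le_rfl
  have e1 := z1 2 le_rfl
  have e2 := z2 2 le_rfl
  rw [← s0] at ez
  rw [← s1] at e0
  rw [← s2] at e1
  rw [← s3] at e2
  have c1 : Occ w (2 * b + 4) (2 * b) (r m + x m) := by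
    have f1 := zz 0 (by omega)
    have f2 := z0 2 le_rfl
    rw [show r (m + 1) + x (m + 1) + 2 = r m + x m + (2 * b + 4) by omega] at f2
    simp only [add_zero] at f1
    unfold Occ
    omega
  have c2 : Occ w (2 * b + 4) (2 * b) (r (m + 1) + x (m + 1)) := by
    have f1 := z0 0 (by omega)
    rw [add_zero] at f1
    unfold Occ
    rw [show r (m + 1) + x (m + 1) + (2 * b + 4) = r (m + 3) by omega]
    omega
  have c3 : ∀ e ≤ b, Occ w (2 * b + 4) (2 * b) (r (m + 2) + (b + e)) := fun e he => by
    have f1 := o1 (b + e) (by omega)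
    have f2 := o3 e (by omega)
    unfold Occ
    rw [show r (m + 2) + (b + e) + (2 * b + 4) = r (m + 4) + e by omega]
    omega
  have c4 : Occ w (2 * b + 4) (2 * b) (r (m + 2) + (b + b) + 1) := by
    have f1 := z1 1 (by omega)
    have f2 := z3 1 (by omega)
    rw [show r (m + 2) + x (m + 2) + 1 = r (m + 2) + (b + b) + 1 by omega] at f1
    unfold Occ
    rw [show r (m + 2) + (b + b) + 1 + (2 * b + 4) = r (m + 4) + x (m + 4) + 1 by omega]
    omega
  have r1 : Ret w (2 * b + 4) (2 * b) 2 (2 * b) := by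
    refine ret_of c1 c2 (by omega) (fun i hi hi' => ?_) (by omega) ?_
    · have f1 := o1 (min (i - (r m + x m)) (2 * b)) (by omega)
      have f2 := (ones_bounds (w := w) (show r (m + 2) + min (i - (r m + x m)) (2 * b) ≤
        i + (2 * b + 4) by omega)).1
      have f3 := o0 (i - r (m + 1)) (by omega)
      have f4 := (ones_bounds (w := w) (show i ≤ r (m + 1) + (i - r (m + 1)) by omega)).1
      unfold Occ
      omega
    · have f1 := zz 0 (by omega)
      have f2 := z0 0 (by omega)
      rw [add_zero] at f1 f2
      omega
  have r2 : Ret w (2 * b + 4) (2 * b) 2 b := by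
    refine ret_of c2 (c3 0 (by omega)) (by omega) (fun i hi hi' => ?_) (by omega) ?_
    · have f1 := o2 (min (i - (r (m + 1) + x (m + 1))) b) (by omega)
      have f2 := (ones_bounds (w := w) (show r (m + 3) + min (i - (r (m + 1) + x (m + 1))) b ≤
        i + (2 * b + 4) by omega)).1
      have f3 := o1 (i - r (m + 2)) (by omega)
      have f4 := (ones_bounds (w := w) (show i ≤ r (m + 2) + (i - r (m + 2)) by omega)).1
      unfold Occ
      omega
    · have f1 := z0 0 (by omega)
      have f2 := o1 (b + 0) (by omega)
      rw [add_zero] at f1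
      omega
  have r3 : Ret w (2 * b + 4) (2 * b) 0 1 :=
    ret_of (c3 0 (by omega)) (c3 1 hb) (by omega) (by intros; omega) (by omega)
      (by rw [o1 _ (by omega), o1 _ (by omega)]; omega)
  have r4 : Ret w (2 * b + 4) (2 * b) 1 0 := by
    refine ret_of (c3 b le_rfl) c4 (by omega) (by intros; omega) (by omega) ?_
    have f1 := o1 (b + b) (by omega)
    have f2 := z1 1 (by omega)
    rw [show r (m + 2) + x (m + 2) + 1 = r (m + 2) + (b + b) + 1 by omega] at f2
    omega
  have := hw.three _ _ _ _ _ _ _ _ _ _ (by omega) r1 r2 r3 r4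
  omega

end Blocks

section Conclusion

variable {w : ℕ → Bool} {a : ℕ} {x r : ℕ → ℕ}

/-- Two adjacent long runs are never followed by two adjacent short ones. -/
theorem Blocks.not_short_short (hw : Admissible w) (h : Blocks w a x r) (ha : 2 ≤ a) {b c m : ℕ}
    (hb : 0 < b) (hbc : b < c) (hx : ∀ m, x m = b ∨ x m = c) (hm : 0 < m) (h0 : x m = c)
    (h1 : x (m + 1) = c) (l : ℕ) : ¬ (x (m + 1 + l) = b ∧ x (m + 1 + l + 1) = b) := by
  induction l using Nat.strong_induction_on with
  | _ l ih =>
    rintro ⟨h2, h3⟩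
    obtain ⟨l, rfl⟩ : ∃ l', l = l' + 1 := by
      refine Nat.exists_eq_add_of_le' (Nat.one_le_iff_ne_zero.2 ?_)
      rintro rfl
      exact hbc.ne (h2.symm.trans h1)
    have hl : x (m + l + 1) = c := (hx _).resolve_left fun hl =>
      ih l (by omega) ⟨by rwa [add_right_comm], h2⟩
    rcases hx (m + l) with hl' | hl'
    · obtain ⟨l, rfl⟩ : ∃ l', l = l' + 2 := by
        refine Nat.exists_eq_add_of_le' ?_
        by_contra hlt
        have : l = 0 ∨ l = 1 := by omega
        rcases this with rfl | rfl
        · exact hbc.ne (hl'.symm.trans h0)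
        · exact hbc.ne (hl'.symm.trans h1)
      have hl'' : x (m + 1 + l) = c := (hx _).resolve_left fun hl'' =>
        ih l (by omega) ⟨hl'', by rwa [add_right_comm m 1 l]⟩
      refine h.false_of_long_gap hw ha hb hbc one_pos hl'' (fun j hj => ?_) ?_ fun j hj => ?_
      · obtain rfl : j = 0 := by omega
        rw [← hl']
        congr 1
        omega
      · rw [← hl]
        congr 1
        omega
      · obtain rfl | rfl : j = 0 ∨ j = 1 := by omega
        · rw [← h2]
          congr 1
        · rw [← h3]
          congr 1
    · have e2 : m + l + 2 = m + 1 + (l + 1) := by omega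
      have e3 : m + l + 3 = m + 1 + (l + 1) + 1 := by omega
      rw [← e2] at h2
      rw [← e3] at h3
      obtain ⟨rfl, rfl⟩ := h.eq_two_of_long_long_short hw ha hb hbc (m := m + l) (by omega) hl' hl
        h2 h3.ge
      obtain ⟨m, rfl⟩ := Nat.exists_eq_add_of_le' hm
      refine h.false_of_long_long_short_short hw hb (m := m + l) ?_ ?_ ?_ ?_
      · rwa [add_right_comm]
      · rwa [← show m + 1 + l + 1 = m + l + 2 by omega]
      · rwa [← show m + 1 + l + 2 = m + l + 3 by omega]
      · rwa [← show m + 1 + l + 3 = m + l + 4 by omega]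

theorem Blocks.false_of_two_lengths (hw : Admissible w) (h : Blocks w a x r) (ha : 2 ≤ a)
    {b c : ℕ} (hb : 0 < b) (hbc : b < c) (hx : ∀ m, x m = b ∨ x m = c)
    (hbinf : ∀ M, ∃ m, M ≤ m ∧ x m = b) (hcinf : ∀ M, ∃ m, M ≤ m ∧ x m = c) : False := by
  by_cases hcc : ∃ m, 0 < m ∧ x m = c ∧ x (m + 1) = c
  · obtain ⟨m₀, hm₀, h0, h1⟩ := hcc
    have hno := h.not_short_short hw ha hb hbc hx hm₀ h0 h1
    obtain ⟨M, k, -, hM⟩ := exists_const_gap (N := m₀ + 1) hbinf fun m k l hm hk hl => by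
      by_contra hlt
      have hk0 : 0 < k := by
        refine Nat.pos_of_ne_zero ?_
        rintro rfl
        obtain ⟨i, rfl⟩ := Nat.exists_eq_add_of_le hm
        exact hno i ⟨hk.1, hk.2.2⟩
      exact h.false_of_short_gap hw ha hb hbc hk0 (by omega) hk.1
        (fun j hj => (hx _).resolve_left (hk.2.1 j hj))
        (by rw [← hk.2.2]; congr 1; omega)
        fun j hj => by
          rw [← (hx _).resolve_left (hl.2.1 j (by omega))]
          congr 1
          omega
    exact h.false_of_gap hw (by omega) (by omega) le_rfl hx
      (h.occ_zero_iff (by omega) hb fun m => by rcases hx m with hm | hm <;> omega) hbinf hM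
  · obtain ⟨M, k, -, hM⟩ := exists_const_gap (N := 1) hcinf fun m k l hm hk hl => by
      by_contra hlt
      have hk0 : 0 < k := by
        refine Nat.pos_of_ne_zero ?_
        rintro rfl
        exact hcc ⟨m, hm, hk.1, hk.2.2⟩
      exact h.false_of_long_gap hw ha hb hbc hk0 hk.1
        (fun j hj => (hx _).resolve_right (hk.2.1 j hj))
        (by rw [← hk.2.2]; congr 1; omega)
        fun j hj => by
          rw [← (hx _).resolve_right (hl.2.1 j (by omega))]
          congr 1
          omega
    have hc := hb.trans hbc
    exact h.false_of_gap hw (by omega) hc (Nat.zero_le _) (fun m => (hx m).symm)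
      (h.occ_one_iff (by omega) hc fun m => by rcases hx m with hm | hm <;> omega) hcinf hM

theorem Blocks.exists_run_length_eq (hw : Admissible w) (h : Blocks w a x r) (ha : 0 < a) {i b : ℕ}
    (hi : Run w true i b) (M : ℕ) : ∃ m, M ≤ m ∧ x m = b := by
  obtain ⟨j, hj, hj'⟩ := hw.recur i (b + 2) (r M)
  obtain ⟨m, hm, hxm⟩ := h.index ha (hi.congr hj') ((h.mono M.zero_le).trans hj)
  refine ⟨m, ?_, hxm⟩
  by_contra hlt
  have := h.mono (not_le.1 hlt).le
  omega

theorem Admissible.false_of_run_false_length (hw : Admissible w) (ha : 2 ≤ a) {i b j : ℕ}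
    (hi : Run w true i b) (hj : Run w false j a) (hall : ∀ j n, Run w false j n → n = a) :
    False := by
  obtain ⟨x, r, h, hx⟩ := hw.exists_blocks hi hall
  have hb := hi.pos
  have hinf : ∀ {i b}, Run w true i b → ∀ M, ∃ m, M ≤ m ∧ x m = b :=
    h.exists_run_length_eq hw (by omega)
  by_cases hone : ∀ m, x m = b
  · exact h.false_of_gap hw (t' := b) (k := 0) (N := 0) (by omega) hb (Nat.zero_le _)
      (fun m => Or.inl (hone m)) (h.occ_one_iff (by omega) hb fun m => (hone m).le) (hinf hi)
      fun m _ hm => ⟨hm, fun j hj => absurd hj j.not_lt_zero, hone _⟩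
  · push Not at hone
    obtain ⟨m, hm⟩ := hone
    obtain ⟨i', hi'⟩ := hx m
    have htwo : ∀ k, x k = b ∨ x k = x m := fun k => by
      obtain ⟨i'', hk⟩ := hx k
      have := hw.run_length_eq (hj.mid 0 hj.pos) (hj.mid 1 ha) hk hi hi'
      omega
    rcases lt_or_gt_of_ne hm with hlt | hgt
    · exact h.false_of_two_lengths hw ha hi'.pos hlt (fun k => (htwo k).symm) (hinf hi') (hinf hi)
    · exact h.false_of_two_lengths hw ha hb hgt htwo (hinf hi) (hinf hi')

theorem Admissible.false_of_isFactor (hw : Admissible w) {p q : ℕ} (hp : w p = false)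
    (hp' : w (p + 1) = false) (hq : w q = true) (hq' : w (q + 1) = true) : False := by
  obtain ⟨j, a, hj, ha⟩ := hw.exists_run (c := false) (i := p) two_pos (fun k hk => by
    obtain rfl | rfl : k = 0 ∨ k = 1 := by omega
    exacts [hp, hp']) hq
  obtain ⟨i, b, hi, hb⟩ := hw.exists_run (c := true) (i := q) two_pos (fun k hk => by
    obtain rfl | rfl : k = 0 ∨ k = 1 := by omega
    exacts [hq, hq']) hp
  by_cases hall : ∀ j n, Run w false j n → n = a
  · exact hw.false_of_run_false_length ha hi hj hall
  · push Not at hall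
    obtain ⟨j', a', hj', hne⟩ := hall
    refine hw.not.false_of_run_false_length hb hj.not hi.not fun i' b' hi' => ?_
    by_contra hne'
    exact hne (hw.run_length_unique hi'.of_not hi hne' hj' hj)

end Conclusion

end AbelianReturns

/-- If every factor of a recurrent binary word has at most three abelian returns and at
least two semi-abelian returns, then one of the letters is isolated. -/
theorem stmt11 (w : ℕ → Bool) (hrec : RecurrentW w)
    (h : ∀ u, IsFactorW w u → u ≠ [] →
      AtMostKAbReturns w u 3 ∧ AtLeastTwoSemiAbReturns w u) :
    ¬ IsFactorW w [false, false] ∨ ¬ IsFactorW w [true, true] := by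
  by_contra hcon
  push Not at hcon
  obtain ⟨⟨p, hp⟩, q, hq⟩ := hcon
  simp only [wordAt, List.length_cons, List.length_nil, List.range_succ, List.range_zero,
    List.nil_append, List.cons_append, List.map_cons, List.map_nil, List.cons.injEq] at hp hq
  exact (AbelianReturns.admissible_of_returns hrec h).false_of_isFactor hp.1.symm hp.2.1.symm
    hq.1.symm hq.2.1.symm
end

section
/- Let 0 < l_1 < l_2 and let w be a recurrent infinite binary word that is an infinite concatenation of blocks from {0^{l_1} 1, 0^{l_2} 1}. If every factor of w has at most three abelian returns and at least two semi-abelian returns, then l_2 = l_1 + 1. -/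
/-- The number of `true` entries among `v i, …, v (i + c - 1)`. -/
def windowCount (v : ℕ → Bool) (i c : ℕ) : ℕ :=
  ∑ k ∈ Finset.range c, (v (i + k)).toNat

/-- `i < j` are consecutive elements of `X`. -/
def IsGap (X : ℕ → Prop) (i j : ℕ) : Prop :=
  X i ∧ X j ∧ i < j ∧ ∀ k, i < k → k < j → ¬ X k

/-- The gaps of `X` have at most two different lengths. -/
def FewGaps (X : ℕ → Prop) : Prop :=
  ∀ i₁ j₁ i₂ j₂ i₃ j₃, IsGap X i₁ j₁ → IsGap X i₂ j₂ → IsGap X i₃ j₃ →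
    j₁ - i₁ = j₂ - i₂ ∨ j₁ - i₁ = j₃ - i₃ ∨ j₂ - i₂ = j₃ - i₃

/-- Arbitrarily late, there are two gaps of `X` along which `v` spells different words. -/
def TwoGapWords (v : ℕ → Bool) (X : ℕ → Prop) : Prop :=
  ∀ N, ∃ i j i' j', N ≤ i ∧ N ≤ i' ∧ IsGap X i j ∧ IsGap X i' j' ∧
    ¬ (j - i = j' - i' ∧ ∀ k < j - i, v (i + k) = v (i' + k))

/-- The word `v` is recurrent, and for each length `c` the windows of length `c` that maximize, or
minimize, the number of `true` entries have gaps of at most two lengths and at least two return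
words. -/
def ExtremalGaps (v : ℕ → Bool) : Prop :=
  (∀ i n N, ∃ i', N ≤ i' ∧ ∀ k < n, v (i' + k) = v (i + k)) ∧
  ∀ c m, 0 < c →
    ((0 < m ∧ ∀ i, windowCount v i c ≤ m) ∨ (m < c ∧ ∀ i, m ≤ windowCount v i c)) →
    (∃ i, windowCount v i c = m) →
    FewGaps (fun i => windowCount v i c = m) ∧ TwoGapWords v (fun i => windowCount v i c = m)

lemma windowCount_zero (v : ℕ → Bool) (i : ℕ) : windowCount v i 0 = 0 := rfl

lemma windowCount_succ (v : ℕ → Bool) (i c : ℕ) :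
    windowCount v i (c + 1) = windowCount v i c + (v (i + c)).toNat :=
  Finset.sum_range_succ _ _


lemma windowCount_one (v : ℕ → Bool) (i : ℕ) : windowCount v i 1 = (v i).toNat := by
  simp [windowCount]

lemma windowCount_two (v : ℕ → Bool) (i : ℕ) :
    windowCount v i 2 = (v i).toNat + (v (i + 1)).toNat := by
  simp [windowCount, Finset.sum_range_succ]

lemma windowCount_one_eq_one_iff (v : ℕ → Bool) (i : ℕ) : windowCount v i 1 = 1 ↔ v i = true := by
  rw [windowCount_one]; cases v i <;> simp

lemma windowCount_le (v : ℕ → Bool) (i c : ℕ) : windowCount v i c ≤ c := by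
  induction c with
  | zero => simp [windowCount_zero]
  | succ c ih =>
    have := Bool.toNat_le (v (i + c))
    rw [windowCount_succ]; omega

lemma windowCount_not (v : ℕ → Bool) (i c : ℕ) :
    windowCount (fun k => !v k) i c = c - windowCount v i c := by
  induction c with
  | zero => simp [windowCount_zero]
  | succ c ih =>
    have := windowCount_le v i c
    rw [windowCount_succ, windowCount_succ, ih]
    cases v (i + c)
    · simp; omega
    · simp

lemma windowCount_congr {v : ℕ → Bool} {i j c : ℕ} (h : ∀ k < c, v (i + k) = v (j + k)) :
    windowCount v i c = windowCount v j c :=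
  Finset.sum_congr rfl fun k hk => by rw [h k (Finset.mem_range.1 hk)]

lemma windowCount_eq_zero_iff {v : ℕ → Bool} {i c : ℕ} :
    windowCount v i c = 0 ↔ ∀ k < c, v (i + k) = false := by
  simp [windowCount]

lemma windowCount_eq_one {v : ℕ → Bool} {i c l : ℕ} (hl : l < c) (h : v (i + l) = true)
    (h' : ∀ k < c, k ≠ l → v (i + k) = false) : windowCount v i c = 1 := by
  unfold windowCount
  rw [Finset.sum_eq_single_of_mem l (Finset.mem_range.2 hl), h]
  · rfl
  · intro k hk hkl
    rw [h' k (Finset.mem_range.1 hk) hkl]; rfl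

lemma two_le_windowCount {v : ℕ → Bool} {i c l m : ℕ} (hlm : l < m) (hm : m < c)
    (hl : v (i + l) = true) (hm' : v (i + m) = true) : 2 ≤ windowCount v i c := by
  have : ∑ k ∈ ({l, m} : Finset ℕ), (v (i + k)).toNat ≤ windowCount v i c := by
    refine Finset.sum_le_sum_of_subset fun x hx => ?_
    simp only [Finset.mem_insert, Finset.mem_singleton] at hx
    rw [Finset.mem_range]; omega
  rw [Finset.sum_pair hlm.ne, hl, hm'] at this
  exact this

lemma IsGap.lt {X : ℕ → Prop} {i j : ℕ} (h : IsGap X i j) : i < j := h.2.2.1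

lemma exists_isGap {X : ℕ → Prop} (hX : ∀ N, ∃ i, N ≤ i ∧ X i) {x : ℕ} (hx : X x) :
    ∃ y, IsGap X x y := by
  classical
  obtain ⟨i, hi⟩ := hX (x + 1)
  have hex : ∃ i, x + 1 ≤ i ∧ X i := ⟨i, hi⟩
  obtain ⟨h1, h2⟩ := Nat.find_spec hex
  exact ⟨Nat.find hex, hx, h2, h1, fun k hk hk' hXk => Nat.find_min hex hk' ⟨hk, hXk⟩⟩

lemma exists_isGap_around {X : ℕ → Prop} (hX : ∀ N, ∃ i, N ≤ i ∧ X i) {z i : ℕ} (hz : X z)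
    (hzi : z ≤ i) : ∃ x y, IsGap X x y ∧ x ≤ i ∧ i < y := by
  classical
  have hx := Nat.findGreatest_spec (P := X) hzi hz
  obtain ⟨y, hy⟩ := exists_isGap hX hx
  refine ⟨_, y, hy, Nat.findGreatest_le i, ?_⟩
  by_contra! hyi
  exact Nat.findGreatest_is_greatest hy.lt hyi hy.2.1

lemma not_twoGapWords_of_periodic {v : ℕ → Bool} {X : ℕ → Prop} {P z : ℕ} (hP : 0 < P)
    (hv : ∀ i, z ≤ i → v (i + P) = v i) (hX : ∀ i, z ≤ i → X i → X (i + P))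
    (hXmod : ∀ i j, z ≤ i → z ≤ j → X i → X j → i ≡ j [MOD P]) : ¬ TwoGapWords v X := by
  intro h
  obtain ⟨i, j, i', j', hi, hi', hg, hg', hne⟩ := h z
  have key : ∀ {i j}, z ≤ i → IsGap X i j → j = i + P := by
    intro i j hi hg
    have h1 : j ≤ i + P := by
      by_contra! hlt
      exact hg.2.2.2 (i + P) (by omega) hlt (hX i hi hg.1)
    have h2 := hXmod i j hi (hi.trans hg.lt.le) hg.1 hg.2.1
    have h3 := (Nat.modEq_iff_dvd' hg.lt.le).1 h2
    have := Nat.le_of_dvd (Nat.sub_pos_of_lt hg.lt) h3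
    have := hg.lt
    omega
  have hper : ∀ n i, z ≤ i → v (i + P * n) = v i := by
    intro n
    induction n with
    | zero => simp
    | succ n ih =>
      intro i hi
      rw [Nat.mul_succ, ← add_assoc, hv _ (by omega), ih i hi]
  have hcong : ∀ a b, z ≤ a → a ≤ b → a ≡ b [MOD P] → v a = v b := by
    intro a b ha hab hmod
    obtain ⟨n, hn⟩ := (Nat.modEq_iff_dvd' hab).1 hmod
    rw [show b = a + P * n by omega, hper n a ha]
  have e1 := key hi hg
  have e2 := key hi' hg'
  refine hne ⟨by omega, fun k _ => ?_⟩
  have hm : i + k ≡ i' + k [MOD P] := (hXmod i i' hi hi' hg.1 hg'.1).add_right k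
  rcases le_total (i + k) (i' + k) with hle | hle
  · exact hcong _ _ (by omega) hle hm
  · exact (hcong _ _ (by omega) hle hm.symm).symm

lemma eq_pattern_of_step {v : ℕ → Bool} {Z : ℕ → Prop} {pat : ℕ → Bool} {P z : ℕ} (hP : 0 < P)
    (hz : Z z) (hstep : ∀ z, Z z → Z (z + P) ∧ ∀ y < P, v (z + y) = pat y) (y : ℕ) :
    v (z + y) = pat (y % P) := by
  have hZ : ∀ n, Z (z + P * n) := by
    intro n
    induction n with
    | zero => simpa using hz
    | succ n ih => rw [Nat.mul_succ, ← add_assoc]; exact (hstep _ ih).1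
  have := (hstep _ (hZ (y / P))).2 (y % P) (Nat.mod_lt _ hP)
  rw [← this, add_assoc, Nat.div_add_mod]

namespace ExtremalGaps

variable {v : ℕ → Bool}

lemma compl (h : ExtremalGaps v) : ExtremalGaps (fun i => !v i) := by
  refine ⟨fun i n N => ?_, fun c m hc hm hex => ?_⟩
  · obtain ⟨i', h1, h2⟩ := h.1 i n N
    exact ⟨i', h1, fun k hk => by simp only [h2 k hk]⟩
  · simp only [windowCount_not] at hm hex ⊢
    have hle := fun i => windowCount_le v i c
    obtain ⟨i₀, hi₀⟩ := hex
    have hmc : m ≤ c := by omega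
    have hX : (fun i => c - windowCount v i c = m) = fun i => windowCount v i c = c - m := by
      funext i
      have := hle i
      apply propext; omega
    rw [hX]
    have hext : (0 < c - m ∧ ∀ i, windowCount v i c ≤ c - m) ∨
        (c - m < c ∧ ∀ i, c - m ≤ windowCount v i c) := by
      rcases hm with ⟨hm0, hm⟩ | ⟨hm0, hm⟩
      · exact Or.inr ⟨by omega, fun i => by have := hm i; have := hle i; omega⟩
      · exact Or.inl ⟨by omega, fun i => by have := hm i; have := hle i; omega⟩
    obtain ⟨h1, h2⟩ := h.2 c (c - m) hc hext ⟨i₀, by have := hle i₀; omega⟩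
    refine ⟨h1, fun N => ?_⟩
    obtain ⟨i, j, i', j', hi, hi', hg, hg', hne⟩ := h2 N
    refine ⟨i, j, i', j', hi, hi', hg, hg', fun hh => hne ⟨hh.1, fun k hk => ?_⟩⟩
    simpa using hh.2 k hk

lemma exists_true (h : ExtremalGaps v) : ∃ i, v i = true := by
  by_contra! hv
  simp only [ne_eq, Bool.not_eq_true] at hv
  have hcnt : ∀ i, windowCount v i 1 = 0 := fun i => by simp [windowCount_one, hv]
  have := (h.2 1 0 one_pos (Or.inr ⟨one_pos, fun i => Nat.zero_le _⟩) ⟨0, hcnt 0⟩).2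
  exact not_twoGapWords_of_periodic (P := 1) (z := 0) one_pos (by simp [hv])
    (fun i _ _ => hcnt _) (fun i j _ _ _ _ => Nat.modEq_one) this

lemma exists_late (h : ExtremalGaps v) (N : ℕ) : ∃ i, N ≤ i ∧ v i = true := by
  obtain ⟨i, hi⟩ := h.exists_true
  obtain ⟨j, hj, hj'⟩ := h.1 i 1 N
  exact ⟨j, hj, by simpa [hi] using hj' 0 one_pos⟩

/-- The gaps between consecutive `true` entries have exactly two lengths. -/
lemma exists_gap_lengths (h : ExtremalGaps v) : ∃ α β, 0 < α ∧ α < β ∧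
    (∃ x, IsGap (fun i => v i = true) x (x + α)) ∧ (∃ x, IsGap (fun i => v i = true) x (x + β)) ∧
    ∀ x y, IsGap (fun i => v i = true) x y → y = x + α ∨ y = x + β := by
  obtain ⟨i, hi⟩ := h.exists_true
  have hX : (fun i => windowCount v i 1 = 1) = fun i => v i = true := by
    funext i; exact propext (windowCount_one_eq_one_iff v i)
  obtain ⟨h1, h2⟩ := h.2 1 1 one_pos (Or.inl ⟨one_pos, fun i => windowCount_le v i 1⟩)
    ⟨i, (windowCount_one_eq_one_iff v i).2 hi⟩
  rw [hX] at h1 h2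
  obtain ⟨i, j, i', j', -, -, hg, hg', hne⟩ := h2 0
  have hlen : j - i ≠ j' - i' := by
    intro heq
    refine hne ⟨heq, fun k hk => ?_⟩
    rcases Nat.eq_zero_or_pos k with rfl | hk0
    · exact hg.1.trans hg'.1.symm
    · have e1 := hg.2.2.2 (i + k) (by omega) (by omega)
      have e2 := hg'.2.2.2 (i' + k) (by omega) (by omega)
      simp only [Bool.not_eq_true] at e1 e2
      rw [e1, e2]
  have hlt := hg.lt
  have hlt' := hg'.lt
  have e : i + (j - i) = j := by omega
  have e' : i' + (j' - i') = j' := by omega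
  rcases lt_or_gt_of_ne hlen with hc | hc
  · refine ⟨j - i, j' - i', by omega, hc, ⟨i, by rwa [e]⟩, ⟨i', by rwa [e']⟩, fun x y hxy => ?_⟩
    have := h1 i j i' j' x y hg hg' hxy
    have := hxy.lt
    omega
  · refine ⟨j' - i', j - i, by omega, hc, ⟨i', by rwa [e']⟩, ⟨i, by rwa [e]⟩, fun x y hxy => ?_⟩
    have := h1 i j i' j' x y hg hg' hxy
    have := hxy.lt
    omega

end ExtremalGaps

namespace ExtremalGaps

variable {v : ℕ → Bool}

lemma exists_run_length (h : ExtremalGaps v) (hh : ∃ i, v i = true ∧ v (i + 1) = true) :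
    ∃ k, 0 < k ∧ (∃ x, v x = true ∧ v (x + 1) = false) ∧
      ∀ x, v x = true → v (x + 1) = false →
        (∀ y, 0 < y → y ≤ k → v (x + y) = false) ∧ v (x + k + 1) = true := by
  obtain ⟨α, β, hα, hαβ, -, ⟨x, hx⟩, hall⟩ := h.exists_gap_lengths
  obtain ⟨i, hi, hi'⟩ := hh
  have h1 := hall i (i + 1) ⟨hi, hi', by omega, by intros; omega⟩
  have hα1 : α = 1 := by omega
  subst hα1
  refine ⟨β - 1, by omega, ⟨x, hx.1, ?_⟩, fun z hz hz' => ?_⟩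
  · simpa using hx.2.2.2 (x + 1) (by omega) (by omega)
  · obtain ⟨y, hy⟩ := exists_isGap h.exists_late hz
    rcases hall z y hy with rfl | rfl
    · have := hy.2.1
      simp [hz'] at this
    · refine ⟨fun y hy0 hyk => ?_, ?_⟩
      · simpa using hy.2.2.2 (z + y) (by omega) (by omega)
      · rw [show z + (β - 1) + 1 = z + β by omega]
        exact hy.2.1

/-- Long runs of both letters cannot both occur. -/
lemma false_of_runs (h : ExtremalGaps v) (ht : ∃ i, v i = true ∧ v (i + 1) = true)
    (hf : ∃ i, v i = false ∧ v (i + 1) = false) : False := by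
  obtain ⟨k, hk, ⟨z, hz⟩, hrun⟩ := h.exists_run_length ht
  obtain ⟨l, hl, -, hrun'⟩ := h.compl.exists_run_length (by simpa using hf)
  have hstep : ∀ z, (v z = true ∧ v (z + 1) = false) →
      (v (z + (k + l)) = true ∧ v (z + (k + l) + 1) = false) ∧
        ∀ y < k + l, v (z + y) = decide (y = 0 ∨ k < y) := by
    rintro z ⟨hz, hz'⟩
    obtain ⟨h1, h2⟩ := hrun z hz hz'
    obtain ⟨h3, h4⟩ := hrun' (z + k) (by simp [h1 k hk le_rfl]) (by simp [h2])
    simp only [Bool.not_eq_false', Bool.not_eq_true'] at h3 h4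
    refine ⟨⟨?_, by rw [← h4, ← add_assoc]⟩, fun y hy => ?_⟩
    · rw [← add_assoc]; exact h3 l hl le_rfl
    · rcases Nat.eq_zero_or_pos y with rfl | hy0
      · simpa using hz
      · by_cases hyk : y ≤ k
        · rw [h1 y hy0 hyk]; symm; rw [decide_eq_false_iff_not]; omega
        · have := h3 (y - k) (by omega) (by omega)
          rw [show z + k + (y - k) = z + y by omega] at this
          rw [this]; symm; rw [decide_eq_true_eq]; omega
  have hpat := eq_pattern_of_step (P := k + l) (Z := fun z => v z = true ∧ v (z + 1) = false)
    (pat := fun y => decide (y = 0 ∨ k < y)) (by omega) hz hstep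
  have hper : ∀ i, z ≤ i → v (i + (k + l)) = v i := by
    intro i hi
    obtain ⟨y, rfl⟩ := Nat.exists_eq_add_of_le hi
    rw [add_assoc, hpat, hpat, Nat.add_mod_right]
  have hzero : windowCount v (z + 1) k = 0 := by
    refine windowCount_eq_zero_iff.2 fun y hy => ?_
    rw [add_assoc]
    exact (hrun z hz.1 hz.2).1 _ (by omega) (by omega)
  refine not_twoGapWords_of_periodic (P := k + l) (z := z) (by omega) hper (fun i hi hX => ?_)
    (fun i j hi hj hXi hXj => ?_)
    (h.2 k 0 hk (Or.inr ⟨hk, fun i => Nat.zero_le _⟩) ⟨_, hzero⟩).2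
  · rw [← hX]
    refine windowCount_congr fun y _ => ?_
    rw [← hper (i + y) (by omega)]
    congr 1; omega
  · have key : ∀ i, z ≤ i → windowCount v i k = 0 → i ≡ z + 1 [MOD (k + l)] := by
      intro i hi hX
      rw [windowCount_eq_zero_iff] at hX
      obtain ⟨y, rfl⟩ := Nat.exists_eq_add_of_le hi
      refine Nat.ModEq.add_left z ?_
      have hlt := Nat.mod_lt y (show 0 < k + l by omega)
      have h0 := hX 0 hk
      rw [add_zero, hpat] at h0
      simp only [decide_eq_false_iff_not, not_or, not_lt] at h0
      by_contra hne
      have hr : y % (k + l) ≠ 1 := by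
        intro hr
        refine hne ?_
        rw [Nat.ModEq, hr, Nat.mod_eq_of_lt (show 1 < k + l by omega)]
      have h1 := hX (k + 1 - y % (k + l)) (by omega)
      rw [add_assoc, hpat, Nat.add_mod, Nat.mod_eq_of_lt (a := k + 1 - y % (k + l)) (by omega),
        show y % (k + l) + (k + 1 - y % (k + l)) = k + 1 by omega,
        decide_eq_false_iff_not] at h1
      rcases (show l = 1 ∨ k + 1 < k + l by omega) with rfl | hlt'
      · simp at h1
      · rw [Nat.mod_eq_of_lt hlt'] at h1
        omega
    exact (key i hi hXi).trans (key j hj hXj).symm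

end ExtremalGaps

lemma windowCount_two_mul_add_one {v : ℕ → Bool} (hv : ∀ i, v i = true → v (i + 1) = false)
    (i t : ℕ) : windowCount v i (2 * t + 1) ≤ t + 1 ∧
      (windowCount v i (2 * t + 1) = t + 1 ↔ ∀ s ≤ t, v (i + 2 * s) = true) := by
  induction t with
  | zero => simp [windowCount_one, Bool.toNat_le]
  | succ t ih =>
    obtain ⟨h1, h2⟩ := ih
    rw [show 2 * (t + 1) + 1 = 2 * t + 1 + 1 + 1 by ring, windowCount_succ, windowCount_succ]
    have hsplit : (∀ s ≤ t + 1, v (i + 2 * s) = true) ↔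
        (∀ s ≤ t, v (i + 2 * s) = true) ∧ v (i + (2 * t + 1 + 1)) = true := by
      constructor
      · exact fun h => ⟨fun s hs => h s (by omega), h (t + 1) le_rfl⟩
      · rintro ⟨h, h'⟩ s hs
        rcases Nat.le_succ_iff.1 hs with hs | rfl
        · exact h s hs
        · exact h'
    rw [hsplit, ← h2]
    have e1 := hv (i + (2 * t + 1))
    have e2 : windowCount v i (2 * t + 1) = t + 1 → v (i + (2 * t + 1)) = false :=
      fun h => hv _ (h2.1 h t le_rfl)
    rw [show i + (2 * t + 1) + 1 = i + (2 * t + 1 + 1) by ring] at e1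
    generalize v (i + (2 * t + 1)) = p at *
    generalize v (i + (2 * t + 1 + 1)) = q at *
    cases p <;> cases q <;> simp at * <;> omega

/-- `z` is a `true` entry of `v`, and the next one is `z + K`. -/
def IsLongGap (v : ℕ → Bool) (K z : ℕ) : Prop :=
  IsGap (fun i => v i = true) z (z + K)

/-- A gap of length `K` at `z` is followed by exactly `t` gaps of length two and then by another
gap of length `K`. -/
def IsLongGapRun (v : ℕ → Bool) (K t z : ℕ) : Prop :=
  IsLongGap v K z ∧ IsLongGap v K (z + (K + 2 * t)) ∧
    ∀ y < K + 2 * t, v (z + y) = decide (y = 0 ∨ K ≤ y ∧ 2 ∣ y - K)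

lemma IsLongGap.left {v : ℕ → Bool} {K z : ℕ} (h : IsLongGap v K z) : v z = true := h.1

lemma IsLongGap.right {v : ℕ → Bool} {K z : ℕ} (h : IsLongGap v K z) : v (z + K) = true := h.2.1

lemma IsLongGap.between {v : ℕ → Bool} {K z y : ℕ} (h : IsLongGap v K z) (hy : 0 < y)
    (hyK : y < K) : v (z + y) = false := by
  simpa using h.2.2.2 (z + y) (by omega) (by omega)

lemma IsLongGap.windowCount_sub_one {v : ℕ → Bool} {K z : ℕ}
    (hv : ∀ i, v i = true → v (i + 1) = false) (hK : 0 < K) (h : IsLongGap v K (z + 1)) :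
    windowCount v z (K + 1) = 1 := by
  refine windowCount_eq_one (l := 1) (by omega) h.left fun k hk hk1 => ?_
  rcases Nat.eq_zero_or_pos k with rfl | hk0
  · by_contra hne
    have := hv z (by simpa using hne)
    simp [h.left] at this
  · have := h.between (y := k - 1) (by omega) (by omega)
    rwa [show z + 1 + (k - 1) = z + k by omega] at this

lemma IsLongGap.windowCount_add_one {v : ℕ → Bool} {K z : ℕ}
    (hv : ∀ i, v i = true → v (i + 1) = false) (hK : 0 < K) (h : IsLongGap v K z) :
    windowCount v (z + 1) (K + 1) = 1 := by
  refine windowCount_eq_one (l := K - 1) (by omega) ?_ fun k hk hk1 => ?_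
  · rw [show z + 1 + (K - 1) = z + K by omega]; exact h.right
  · rw [add_assoc]
    by_cases hkK : 1 + k < K
    · exact h.between (by omega) hkK
    · rw [show 1 + k = K + 1 by omega]
      exact hv _ h.right

lemma IsLongGap.isGap_windowCount {v : ℕ → Bool} {K z : ℕ}
    (hv : ∀ i, v i = true → v (i + 1) = false) (hK : 0 < K) (h : IsLongGap v K (z + 1)) :
    IsGap (fun i => windowCount v i (K + 1) = 1) z (z + 2) := by
  refine ⟨h.windowCount_sub_one hv hK, h.windowCount_add_one hv hK, by omega, fun k hk hk' => ?_⟩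
  obtain rfl : k = z + 1 := by omega
  have := two_le_windowCount (c := K + 1) (l := 0) (m := K) hK (by omega) h.left h.right
  omega

lemma IsLongGapRun.isGap_windowCount {v : ℕ → Bool} {K t z : ℕ}
    (hv : ∀ i, v i = true → v (i + 1) = false) (hK : 3 ≤ K) (h : IsLongGapRun v K t z) :
    IsGap (fun i => windowCount v i (K + 1) = 1) (z + 1)
      (z + 1 + if t = 0 then 1 else K + 2 * t - 2) := by
  obtain ⟨h1, h2, h3⟩ := h
  split_ifs with ht
  · subst ht
    refine ⟨h1.windowCount_add_one hv (by omega), ?_, by omega, by intros; omega⟩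
    refine windowCount_eq_one (l := K - 2) (by omega) ?_ fun k hk hk1 => ?_
    · rw [show z + 1 + 1 + (K - 2) = z + K by omega]; exact h1.right
    · by_cases hkK : k < K - 2
      · rw [show z + 1 + 1 + k = z + (k + 2) by omega]
        exact h1.between (by omega) (by omega)
      · have := h2.between (y := k - (K - 2)) (by omega) (by omega)
        rwa [show z + (K + 2 * 0) + (k - (K - 2)) = z + 1 + 1 + k by omega] at this
  · refine ⟨h1.windowCount_add_one hv (by omega), ?_, by omega, fun k hk hk' => ?_⟩
    · rw [show z + 1 + (K + 2 * t - 2) = z + (K + 2 * t) - 1 by omega]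
      refine IsLongGap.windowCount_sub_one hv (by omega) ?_
      rwa [show z + (K + 2 * t) - 1 + 1 = z + (K + 2 * t) by omega]
    · have htrue : ∀ s ≤ t, v (z + (K + 2 * s)) = true := by
        intro s hs
        rcases hs.eq_or_lt with rfl | hs
        · exact h2.left
        · rw [h3 _ (by omega), decide_eq_true_eq]; omega
      obtain ⟨l, m, hlm, hm, hl, hm'⟩ : ∃ l m, l < m ∧ m < K + 1 ∧ v (k + l) = true ∧
          v (k + m) = true := by
        by_cases hkK : k ≤ z + K
        · refine ⟨z + K - k, z + K + 2 - k, by omega, by omega, ?_, ?_⟩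
          · rw [show k + (z + K - k) = z + (K + 2 * 0) by omega]; exact htrue 0 (by omega)
          · rw [show k + (z + K + 2 - k) = z + (K + 2 * 1) by omega]; exact htrue 1 (by omega)
        · obtain ⟨s, hs⟩ : ∃ s, k = z + K + 2 * s ∨ k + 1 = z + K + 2 * s := by
            exact ⟨(k + 1 - z - K) / 2, by omega⟩
          rcases hs with hs | hs
          · refine ⟨0, 2, by omega, by omega, ?_, ?_⟩
            · rw [show k + 0 = z + (K + 2 * s) by omega]; exact htrue s (by omega)
            · rw [show k + 2 = z + (K + 2 * (s + 1)) by omega]; exact htrue _ (by omega)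
          · refine ⟨1, 3, by omega, by omega, ?_, ?_⟩
            · rw [show k + 1 = z + (K + 2 * s) by omega]; exact htrue s (by omega)
            · rw [show k + 3 = z + (K + 2 * (s + 1)) by omega]; exact htrue _ (by omega)
      have := two_le_windowCount hlm hm hl hm'
      omega

namespace ExtremalGaps

variable {v : ℕ → Bool}

lemma exists_late_isLongGap (h : ExtremalGaps v) {K z : ℕ} (hz : IsLongGap v K z) (N : ℕ) :
    ∃ i, N ≤ i ∧ IsLongGap v K i := by
  obtain ⟨i, hi, hi'⟩ := h.1 z (K + 1) N
  refine ⟨i, hi, ?_, ?_, ?_, fun k hk hk' => ?_⟩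
  · have := hi' 0 (by omega)
    rw [add_zero, add_zero, hz.left] at this
    exact this
  · exact (hi' K (by omega)).trans hz.right
  · have := hz.lt; omega
  · have := hi' (k - i) (by omega)
    rw [show i + (k - i) = k by omega, hz.between (by omega) (by omega)] at this
    simp [this]

lemma exists_isLongGapRun (h : ExtremalGaps v) {K : ℕ} (hK : 3 ≤ K)
    (hgaps : ∀ x y, IsGap (fun i => v i = true) x y → y = x + 2 ∨ y = x + K) {z : ℕ}
    (hz : IsLongGap v K z) : ∃ t, IsLongGapRun v K t z := by
  by_contra! hno
  have hpat : ∀ t, v (z + (K + 2 * t)) = true ∧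
      ∀ y < K + 2 * t, v (z + y) = decide (y = 0 ∨ K ≤ y ∧ 2 ∣ y - K) := by
    intro t
    induction t with
    | zero =>
      refine ⟨hz.right, fun y hy => ?_⟩
      rcases Nat.eq_zero_or_pos y with rfl | hy0
      · simpa using hz.left
      · rw [hz.between hy0 (by omega)]; symm; rw [decide_eq_false_iff_not]; omega
    | succ t ih =>
      obtain ⟨y, hy⟩ := exists_isGap h.exists_late ih.1
      rcases hgaps _ y hy with rfl | rfl
      · refine ⟨by simpa [mul_add, add_assoc] using hy.2.1, fun y hyt => ?_⟩
        rcases (show y < K + 2 * t ∨ y = K + 2 * t ∨ y = K + 2 * t + 1 by omega)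
          with hlt | rfl | rfl
        · exact ih.2 y hlt
        · rw [ih.1]; symm; rw [decide_eq_true_eq]; omega
        · have := hy.2.2.2 (z + (K + 2 * t) + 1) (by omega) (by omega)
          rw [Bool.not_eq_true, add_assoc] at this
          rw [this]; symm; rw [decide_eq_false_iff_not]; omega
      · exact absurd ⟨hz, hy, ih.2⟩ (hno t)
  obtain ⟨i, hi, hiK⟩ := h.exists_late_isLongGap hz (z + K)
  obtain ⟨y, rfl⟩ := Nat.exists_eq_add_of_le (show z ≤ i by omega)
  have h1 := hiK.left
  have h2 := hiK.between (y := 2) (by omega) (by omega)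
  rw [(hpat y).2 y (by omega), decide_eq_true_eq] at h1
  rw [add_assoc, (hpat y).2 (y + 2) (by omega), decide_eq_false_iff_not] at h2
  omega

lemma one_le_windowCount (h : ExtremalGaps v) {K : ℕ}
    (hgaps : ∀ x y, IsGap (fun i => v i = true) x y → y ≤ x + K) (i : ℕ) :
    1 ≤ windowCount v i (K + 1) := by
  by_contra! hlt
  have h0 := windowCount_eq_zero_iff.1 (Nat.lt_one_iff.1 hlt)
  obtain ⟨z, hz⟩ := h.exists_true
  obtain ⟨j, hzj, hj⟩ := h.1 i (K + 1) z
  obtain ⟨x, y, hxy, hxj, hjy⟩ := exists_isGap_around h.exists_late hz hzj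
  have hle := hgaps x y hxy
  have h1 := hj (y - j) (by omega)
  rw [h0 _ (by omega), show j + (y - j) = y by omega] at h1
  simpa [h1] using hxy.2.1

/-- The `true` entries cannot all be isolated with gaps of length `2` and `K`. -/
lemma false_of_gap_two (h : ExtremalGaps v) (hv : ∀ i, v i = true → v (i + 1) = false) {K : ℕ}
    (hK : 3 ≤ K) (htwo : ∃ x, v x = true ∧ v (x + 2) = true) (hlong : ∃ z, IsLongGap v K z)
    (hgaps : ∀ x y, IsGap (fun i => v i = true) x y → y = x + 2 ∨ y = x + K) : False := by
  obtain ⟨z₀, hz₀⟩ := hlong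
  obtain ⟨T, hT⟩ := h.exists_isLongGapRun hK hgaps hz₀
  have huniq : ∀ z, IsLongGap v K z → IsLongGapRun v K T z := by
    intro z hz
    obtain ⟨t, ht⟩ := h.exists_isLongGapRun hK hgaps hz
    obtain ⟨s, hs, hsK⟩ := h.exists_late_isLongGap hz₀ 1
    obtain ⟨s, rfl⟩ := Nat.exists_eq_add_of_le' hs
    have hgap := hsK.isGap_windowCount hv (by omega)
    have hfew := (h.2 (K + 1) 1 (by omega) (Or.inr ⟨by omega, fun i => h.one_le_windowCount
      (fun x y hxy => by rcases hgaps x y hxy with rfl | rfl <;> omega) i⟩) ⟨_, hgap.1⟩).1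
      _ _ _ _ _ _ hgap (hT.isGap_windowCount hv hK) (ht.isGap_windowCount hv hK)
    obtain rfl : T = t := by split_ifs at hfew <;> omega
    exact ht
  have hT1 : 0 < T := by
    by_contra hT0
    obtain rfl : T = 0 := by omega
    obtain ⟨x, hx, hx2⟩ := htwo
    obtain ⟨i, hi, hi'⟩ := h.1 x 3 z₀
    have e0 := hi' 0 (by omega)
    have e2 := hi' 2 (by omega)
    rw [hx2] at e2
    rw [add_zero, add_zero, hx] at e0
    obtain ⟨z, z', hzz', hzi, hiz'⟩ :=
      exists_isGap_around (h.exists_late_isLongGap hz₀) hz₀ hi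
    have hrun := huniq z hzz'.1
    have hle : z' ≤ z + K := by
      by_contra! hlt
      exact hzz'.2.2.2 (z + K) (by omega) hlt hrun.2.1
    rcases hzi.eq_or_lt with rfl | hlt
    · simp [hzz'.1.between (y := 2) (by omega) (by omega)] at e2
    · have := hzz'.1.between (y := i - z) (by omega) (by omega)
      rw [show z + (i - z) = i by omega] at this
      simp [this] at e0
  have hpat := eq_pattern_of_step (P := K + 2 * T) (by omega) hz₀ fun z hz => (huniq z hz).2
  have hper : ∀ i, z₀ ≤ i → v (i + (K + 2 * T)) = v i := by
    intro i hi
    obtain ⟨y, rfl⟩ := Nat.exists_eq_add_of_le hi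
    rw [add_assoc, hpat, hpat, Nat.add_mod_right]
  have hmax : windowCount v (z₀ + K) (2 * T + 1) = T + 1 := by
    refine (windowCount_two_mul_add_one hv _ T).2.2 fun s hs => ?_
    rw [add_assoc]
    rcases hs.eq_or_lt with rfl | hs
    · exact hT.2.1.left
    · rw [hT.2.2 _ (by omega), decide_eq_true_eq]; omega
  refine not_twoGapWords_of_periodic (P := K + 2 * T) (z := z₀) (by omega) hper
    (fun i hi hX => ?_) (fun i j hi hj hXi hXj => ?_)
    (h.2 (2 * T + 1) (T + 1) (by omega)
      (Or.inl ⟨by omega, fun i => (windowCount_two_mul_add_one hv i T).1⟩) ⟨_, hmax⟩).2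
  · rw [← hX]
    refine windowCount_congr fun y _ => ?_
    rw [← hper (i + y) (by omega)]
    congr 1; omega
  · have key : ∀ i, z₀ ≤ i → windowCount v i (2 * T + 1) = T + 1 →
        i ≡ z₀ + K [MOD (K + 2 * T)] := by
      intro i hi hX
      rw [(windowCount_two_mul_add_one hv i T).2] at hX
      obtain ⟨y, rfl⟩ := Nat.exists_eq_add_of_le hi
      refine Nat.ModEq.add_left z₀ ?_
      have hlt := Nat.mod_lt y (show 0 < K + 2 * T by omega)
      have hpat' : ∀ s, v (z₀ + y + 2 * s) = decide ((y % (K + 2 * T) + 2 * s) % (K + 2 * T) = 0 ∨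
          K ≤ (y % (K + 2 * T) + 2 * s) % (K + 2 * T) ∧
            2 ∣ (y % (K + 2 * T) + 2 * s) % (K + 2 * T) - K) := by
        intro s
        rw [add_assoc, hpat, Nat.mod_add_mod]
      rw [Nat.ModEq, Nat.mod_eq_of_lt (show K < K + 2 * T by omega)]
      generalize y % (K + 2 * T) = r at *
      have h0 := hX 0 (by omega)
      rw [hpat', mul_zero, add_zero, Nat.mod_eq_of_lt hlt, decide_eq_true_eq] at h0
      rcases h0 with rfl | ⟨hKr, s, hs⟩
      · have h1 := hX 1 hT1
        rw [hpat', Nat.mod_eq_of_lt (by omega), decide_eq_true_eq] at h1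
        omega
      · by_contra hne
        have h1 := hX (T - s + 1) (by omega)
        rw [hpat', show r + 2 * (T - s + 1) = 2 + (K + 2 * T) by omega, Nat.add_mod_right,
          Nat.mod_eq_of_lt (by omega), decide_eq_true_eq] at h1
        omega
    exact (key i hi hXi).trans (key j hj hXj).symm

lemma false_of_isolated (h : ExtremalGaps v) (hv : ∀ i, v i = true → v (i + 1) = false) :
    False := by
  obtain ⟨α, β, hα, hαβ, ⟨x, hx⟩, ⟨z, hz⟩, hgaps⟩ := h.exists_gap_lengths
  have hα1 : α ≠ 1 := by
    rintro rfl
    have := hv x hx.1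
    have := hx.2.1
    simp_all
  by_cases hα2 : α = 2
  · subst hα2
    exact h.false_of_gap_two hv (by omega) ⟨x, hx.1, hx.2.1⟩ ⟨z, hz⟩ hgaps
  have hleft : ∀ {x y}, IsGap (fun i => v i = true) x y → x + 2 < y →
      IsGap (fun i => windowCount v i 2 = 1) x (y - 1) ∧
        IsGap (fun i => windowCount v i 2 = 1) (y - 1) y := by
    intro x y hxy hlt
    have hfalse : ∀ k, x < k → k < y → v k = false := by simpa using hxy.2.2.2
    have h1 : v x = true := hxy.1
    have h2 : v y = true := hxy.2.1
    have e1 := hfalse (x + 1) (by omega) (by omega)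
    have e2 := hfalse (y - 1) (by omega) (by omega)
    have e3 := hv y h2
    have hy : y - 1 + 1 = y := by omega
    refine ⟨⟨?_, ?_, by omega, fun k hk hk' => ?_⟩, ?_, ?_, by omega, by intros; omega⟩
    · simp [windowCount_two, h1, e1]
    · simp [windowCount_two, h2, e2, hy]
    · simp [windowCount_two, hfalse k hk (by omega), hfalse (k + 1) (by omega) (by omega)]
    · simp [windowCount_two, h2, e2, hy]
    · simp [windowCount_two, h2, e3]
  have hbound : ∀ i, windowCount v i 2 ≤ 1 := by
    intro i
    have := hv i
    rw [windowCount_two]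
    cases hi : v i
    · simpa using Bool.toNat_le _
    · simp [this hi]
  have hx' := hleft hx (by omega)
  have hz' := hleft hz (by omega)
  have := (h.2 2 1 two_pos (Or.inl ⟨one_pos, hbound⟩) ⟨_, hx'.1.1⟩).1 _ _ _ _ _ _ hx'.1 hz'.1 hx'.2
  omega

end ExtremalGaps

theorem not_extremalGaps (v : ℕ → Bool) : ¬ ExtremalGaps v := by
  intro h
  by_cases ht : ∃ i, v i = true ∧ v (i + 1) = true
  · by_cases hf : ∃ i, v i = false ∧ v (i + 1) = false
    · exact h.false_of_runs ht hf
    · exact h.compl.false_of_isolated (by simpa using hf)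
  · exact h.false_of_isolated (by simpa using ht)

section wordAt

variable {α : Type*}

lemma length_wordAt (w : ℕ → α) (i n : ℕ) : (wordAt w i n).length = n := by
  simp [wordAt]

lemma wordAt_succ (w : ℕ → α) (i n : ℕ) : wordAt w i (n + 1) = wordAt w i n ++ [w (i + n)] := by
  simp [wordAt, List.range_succ]

lemma wordAt_eq_wordAt_iff {w : ℕ → α} {i j n : ℕ} :
    wordAt w i n = wordAt w j n ↔ ∀ k < n, w (i + k) = w (j + k) := by
  simp [wordAt]

lemma isFactorW_wordAt (w : ℕ → α) (i n : ℕ) : IsFactorW w (wordAt w i n) :=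
  ⟨i, by rw [length_wordAt]⟩

lemma wordAt_ne_nil (w : ℕ → α) (i : ℕ) {n : ℕ} (hn : 0 < n) : wordAt w i n ≠ [] := by
  rw [← List.length_pos_iff_ne_nil, length_wordAt]; exact hn

lemma RecurrentW.exists_late {w : ℕ → α} (h : RecurrentW w) (i n N : ℕ) :
    ∃ i', N ≤ i' ∧ ∀ k < n, w (i' + k) = w (i + k) := by
  obtain ⟨i', hi', he⟩ := h _ (isFactorW_wordAt w i n) N
  rw [length_wordAt, eq_comm, wordAt_eq_wordAt_iff] at he
  exact ⟨i', hi', he⟩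

lemma wordAt_eq_replicate_append {w : ℕ → Bool} {i n l : ℕ}
    (h : wordAt w i n = List.replicate l false ++ [true]) :
    n = l + 1 ∧ (∀ k < l, w (i + k) = false) ∧ w (i + l) = true := by
  have hn : n = l + 1 := by simpa [length_wordAt] using congrArg List.length h
  subst hn
  rw [wordAt_succ] at h
  obtain ⟨h1, h2⟩ := List.append_inj h (by simp [length_wordAt])
  refine ⟨rfl, fun k hk => ?_, by simpa using h2⟩
  have hmem : w (i + k) ∈ wordAt w i l := List.mem_map.2 ⟨k, List.mem_range.2 hk, rfl⟩
  rw [h1] at hmem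
  exact List.eq_of_mem_replicate hmem

lemma count_true_wordAt (w : ℕ → Bool) (i n : ℕ) :
    (wordAt w i n).count true + Nat.count (fun x => w x = true) i =
      Nat.count (fun x => w x = true) (i + n) := by
  induction n with
  | zero => simp [wordAt]
  | succ n ih =>
    rw [wordAt_succ, List.count_append, ← add_assoc i, Nat.count_succ, ← ih]
    cases w (i + n)
    · simp
    · simp; omega

lemma abEquiv_iff_of_length_eq {u v : List Bool} (h : u.length = v.length) :
    AbEquiv u v ↔ u.count true = v.count true := by
  have hu := List.count_false_add_count_true u
  have hv := List.count_false_add_count_true v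
  simp only [AbEquiv, Bool.forall_bool]
  omega

lemma mem_abOcc_iff {w : ℕ → Bool} {u : List Bool} {i : ℕ} :
    i ∈ abOcc w u ↔ (wordAt w i u.length).count true = u.count true :=
  abEquiv_iff_of_length_eq (length_wordAt _ _ _)

lemma AtMostKAbReturns.count_eq_count {w : ℕ → Bool} {u r₀ r₁ r₂ r₃ : List Bool}
    (h : AtMostKAbReturns w u 3) (h₀ : r₀ ∈ semiAbReturns w u) (h₁ : r₁ ∈ semiAbReturns w u)
    (h₂ : r₂ ∈ semiAbReturns w u) (h₃ : r₃ ∈ semiAbReturns w u)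
    (h₀₁ : r₀.count true ≠ r₁.count true) (h₀₂ : r₀.count true ≠ r₂.count true)
    (h₀₃ : r₀.count true ≠ r₃.count true) :
    r₁.count true = r₂.count true ∨ r₁.count true = r₃.count true ∨
      r₂.count true = r₃.count true := by
  obtain ⟨f, hf⟩ := h
  obtain ⟨g₀, hg₀⟩ := hf _ h₀
  obtain ⟨g₁, hg₁⟩ := hf _ h₁
  obtain ⟨g₂, hg₂⟩ := hf _ h₂
  obtain ⟨g₃, hg₃⟩ := hf _ h₃
  rw [hg₀, hg₁] at h₀₁
  rw [hg₀, hg₂] at h₀₂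
  rw [hg₀, hg₃] at h₀₃
  rw [hg₁, hg₂, hg₃]
  have e₁ : g₀ ≠ g₁ := fun e => h₀₁ (by rw [e])
  have e₂ : g₀ ≠ g₂ := fun e => h₀₂ (by rw [e])
  have e₃ : g₀ ≠ g₃ := fun e => h₀₃ (by rw [e])
  by_cases e₄ : g₁ = g₂
  · exact Or.inl (by rw [e₄])
  by_cases e₅ : g₁ = g₃
  · exact Or.inr (Or.inl (by rw [e₅]))
  have e₆ : g₂ = g₃ := by omega
  exact Or.inr (Or.inr (by rw [e₆]))

end wordAt

/-- The entries `true` of `w` are exactly at the positions `p 0 < p 1 < …`, and the gaps between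
them have lengths `a` and `a + d`. -/
structure SpacedOnes (w : ℕ → Bool) (p : ℕ → ℕ) (a d : ℕ) : Prop where
  zero_pos : 0 < p 0
  apply_eq_true_iff : ∀ x, w x = true ↔ ∃ j, x = p j
  gap : ∀ j, p (j + 1) = p j + a ∨ p (j + 1) = p j + (a + d)
  two_le : 2 ≤ a
  two_le' : 2 ≤ d

/-- The sequence recording which gaps of `p` are long. -/
def longGaps (p : ℕ → ℕ) (a d : ℕ) (j : ℕ) : Bool :=
  decide (p (j + 1) = p j + (a + d))

namespace SpacedOnes

variable {w : ℕ → Bool} {p : ℕ → ℕ} {a d : ℕ}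

lemma add_two_le (h : SpacedOnes w p a d) (j : ℕ) : p j + 2 ≤ p (j + 1) := by
  have := h.gap j
  have := h.two_le
  omega

lemma strictMono (h : SpacedOnes w p a d) : StrictMono p :=
  strictMono_nat_of_lt_succ fun j => by have := h.add_two_le j; omega

lemma apply_add (h : SpacedOnes w p a d) (j c : ℕ) :
    p (j + c) = p j + c * a + d * windowCount (longGaps p a d) j c := by
  induction c with
  | zero => simp [windowCount_zero]
  | succ c ih =>
    rw [windowCount_succ]
    have hg : p (j + (c + 1)) = p (j + c) + a + d * (longGaps p a d (j + c)).toNat := by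
      have := h.gap (j + c)
      have := h.two_le'
      unfold longGaps
      rw [← add_assoc]
      by_cases hb : p (j + c + 1) = p (j + c) + (a + d)
      · rw [decide_eq_true hb, hb, Bool.toNat_true, mul_one, add_assoc]
      · rw [decide_eq_false hb, Bool.toNat_false, mul_zero]; omega
    rw [hg, ih]
    ring

lemma count_apply (h : SpacedOnes w p a d) (j : ℕ) : Nat.count (fun x => w x = true) (p j) = j := by
  rw [Nat.count_eq_card_filter_range]
  have : (Finset.range (p j)).filter (fun x => w x = true) = (Finset.range j).image p := by
    ext x
    simp only [Finset.mem_filter, Finset.mem_range, Finset.mem_image, h.apply_eq_true_iff]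
    constructor
    · rintro ⟨hx, k, rfl⟩
      exact ⟨k, h.strictMono.lt_iff_lt.1 hx, rfl⟩
    · rintro ⟨k, hk, rfl⟩
      exact ⟨h.strictMono hk, k, rfl⟩
  rw [this, Finset.card_image_of_injective _ h.strictMono.injective, Finset.card_range]

lemma count_le_iff (h : SpacedOnes w p a d) (x j : ℕ) :
    Nat.count (fun x => w x = true) x ≤ j ↔ x ≤ p j := by
  constructor
  · intro hx
    by_contra! hlt
    have h1 := Nat.count_monotone (fun x => w x = true) (Nat.succ_le_of_lt hlt)
    rw [Nat.succ_eq_add_one, Nat.count_succ, h.count_apply,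
      if_pos ((h.apply_eq_true_iff _).2 ⟨j, rfl⟩)] at h1
    omega
  · intro hx
    have := Nat.count_monotone (fun x => w x = true) hx
    rwa [h.count_apply] at this

lemma count_eq_iff (h : SpacedOnes w p a d) (x j : ℕ) :
    Nat.count (fun x => w x = true) x = j + 1 ↔ p j < x ∧ x ≤ p (j + 1) := by
  rw [← h.count_le_iff, ← not_le, ← h.count_le_iff]
  omega

/-- If the distances of `c`-th next ones are at most `c * a + d * μ`, the windows of length slightly
below this bound that contain only `c - 1` ones are those inside a maximal distance. -/
lemma count_true_eq_iff_of_le (h : SpacedOnes w p a d) {c μ e : ℕ} (hc : 0 < c) (hμ : 0 < μ)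
    (hle : ∀ i, windowCount (longGaps p a d) i c ≤ μ) (he : e ≤ 2) (he0 : 0 < e) (x : ℕ)
    (hx : p 0 + 1 ≤ x) :
    (wordAt w x (c * a + d * μ - e)).count true = c - 1 ↔
      ∃ j f, windowCount (longGaps p a d) j c = μ ∧ f < e ∧ x = p j + 1 + f := by
  have hd := h.two_le'
  have hdμ : d ≤ d * μ := Nat.le_mul_of_pos_right d hμ
  have hcount := count_true_wordAt w x (c * a + d * μ - e)
  have hsucc : c - 1 + 1 = c := by omega
  constructor
  · intro hcnt
    have h1 := (h.count_le_iff x 0).not.2 (by omega)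
    obtain ⟨j, hj⟩ := Nat.exists_eq_succ_of_ne_zero
      (show Nat.count (fun x => w x = true) x ≠ 0 by omega)
    rw [Nat.succ_eq_add_one] at hj
    rw [hcnt, hj] at hcount
    have h2 := (h.count_eq_iff x j).1 hj
    have h3 := (h.count_eq_iff (x + (c * a + d * μ - e)) (j + (c - 1))).1
      (show _ = j + (c - 1) + 1 by omega)
    rw [add_assoc, hsucc, h.apply_add j c] at h3
    have h4 : windowCount (longGaps p a d) j c = μ := by
      refine le_antisymm (hle j) ?_
      by_contra! hlt
      have := Nat.mul_le_mul_left d (Nat.succ_le_of_lt hlt)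
      rw [Nat.mul_succ] at this
      omega
    rw [h4] at h3
    exact ⟨j, x - p j - 1, h4, by omega, by omega⟩
  · rintro ⟨j, f, hj, hf, rfl⟩
    have h1 := h.add_two_le j
    have h2 := h.add_two_le (j + (c - 1))
    have h3 := h.apply_add j c
    rw [hj] at h3
    rw [add_assoc j, hsucc] at h2
    have h4 := (h.count_eq_iff (p j + 1 + f) j).2 (by omega)
    have h5 := (h.count_eq_iff (p j + 1 + f + (c * a + d * μ - e)) (j + (c - 1))).2
      (by rw [add_assoc j, hsucc]; omega)
    omega

/-- If the distances of `c`-th next ones are at least `c * a + d * μ`, the windows of length slightly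
above this bound that contain `c + 1` ones are those covering a minimal distance. -/
lemma count_true_eq_iff_of_ge (h : SpacedOnes w p a d) {c μ e : ℕ}
    (hle : ∀ i, μ ≤ windowCount (longGaps p a d) i c) (he : e ≤ 2) (he0 : 0 < e) (x : ℕ) :
    (wordAt w x (c * a + d * μ + e)).count true = c + 1 ↔
      ∃ j f, windowCount (longGaps p a d) j c = μ ∧ f < e ∧ x + e = p j + 1 + f := by
  have hd := h.two_le'
  have hcount := count_true_wordAt w x (c * a + d * μ + e)
  constructor
  · intro hcnt
    obtain ⟨j, hj⟩ : ∃ j, Nat.count (fun x => w x = true) x = j := ⟨_, rfl⟩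
    rw [hcnt, hj] at hcount
    have h2 := (h.count_le_iff x j).1 hj.le
    have h3 := (h.count_eq_iff (x + (c * a + d * μ + e)) (j + c)).1 (show _ = j + c + 1 by omega)
    rw [h.apply_add j c] at h3
    have h4 : windowCount (longGaps p a d) j c = μ := by
      refine le_antisymm ?_ (hle j)
      by_contra! hlt
      have := Nat.mul_le_mul_left d (Nat.succ_le_of_lt hlt)
      rw [Nat.mul_succ] at this
      omega
    rw [h4] at h3
    exact ⟨j, x + e - p j - 1, h4, by omega, by omega⟩
  · rintro ⟨j, f, hj, hf, hx⟩
    have h2 := h.add_two_le (j + c)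
    have h3 := h.apply_add j c
    rw [hj] at h3
    have h4 : Nat.count (fun x => w x = true) x = j := by
      rcases Nat.eq_zero_or_pos j with rfl | hj0
      · exact Nat.le_zero.1 ((h.count_le_iff x 0).2 (by omega))
      · obtain ⟨i, rfl⟩ := Nat.exists_eq_succ_of_ne_zero hj0.ne'
        have := h.add_two_le i
        exact (h.count_eq_iff x i).2 ⟨by simp only [Nat.succ_eq_add_one] at hx; omega,
          by simp only [Nat.succ_eq_add_one] at hx; omega⟩
    have h5 := (h.count_eq_iff (x + (c * a + d * μ + e)) (j + c)).2 (by omega)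
    omega

lemma fewGaps_of_count (h : SpacedOnes w p a d) {n m o : ℕ} {X : ℕ → Prop} (hn : 0 < n)
    (ho : o = 0 ∨ o = 2)
    (hX : ∀ x, p 0 + 1 ≤ x + o →
      ((wordAt w x n).count true = m ↔ ∃ j f, X j ∧ f < 2 ∧ x + o = p j + 1 + f))
    (hret : ∀ u, IsFactorW w u → u ≠ [] → AtMostKAbReturns w u 3) : FewGaps X := by
  intro i₁ j₁ i₂ j₂ i₃ j₃ hg₁ hg₂ hg₃
  have hp0 := h.zero_pos
  have hpj : ∀ j, p 0 ≤ p j := fun j => h.strictMono.monotone (Nat.zero_le j)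
  have hmem : ∀ x, p 0 + 1 ≤ x + o →
      (x ∈ abOcc w (wordAt w (p i₁ + 1 - o) n) ↔ ∃ j f, X j ∧ f < 2 ∧ x + o = p j + 1 + f) := by
    intro x hx
    have := hpj i₁
    rw [mem_abOcc_iff, length_wordAt,
      (hX (p i₁ + 1 - o) (by omega)).2 ⟨i₁, 0, hg₁.1, two_pos, by omega⟩, hX x hx]
  have hreturn : ∀ {i j}, IsGap X i j → ∃ r ∈ semiAbReturns w (wordAt w (p i₁ + 1 - o) n),
      r.count true = j - i := by
    intro i j hg
    have h1 := hpj i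
    have h2 : p i + 2 ≤ p j := (h.add_two_le i).trans (h.strictMono.monotone hg.lt)
    refine ⟨_, ⟨p i + 2 - o, p j + 1 - o, (hmem _ (by omega)).2 ⟨i, 1, hg.1, by omega, by omega⟩,
      (hmem _ (by omega)).2 ⟨j, 0, hg.2.1, by omega, by omega⟩, by omega, fun k hk hk' => ?_, rfl⟩,
      ?_⟩
    · rw [hmem k (by omega)]
      rintro ⟨l, f, hl, hf, hkl⟩
      refine hg.2.2.2 l ?_ ?_ hl
      · rw [← h.strictMono.lt_iff_lt]; omega
      · rw [← h.strictMono.lt_iff_lt]; omega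
    · have hcount := count_true_wordAt w (p i + 2 - o) (p j + 1 - o - (p i + 2 - o))
      rw [show p i + 2 - o + (p j + 1 - o - (p i + 2 - o)) = p j + 1 - o by omega] at hcount
      have h3 := h.add_two_le i
      have h4 := h.add_two_le j
      rcases ho with rfl | rfl
      · rw [(h.count_eq_iff (p i + 2 - 0) i).2 (by omega),
          (h.count_eq_iff (p j + 1 - 0) j).2 (by omega)] at hcount
        omega
      · obtain ⟨k, rfl⟩ := Nat.exists_eq_add_of_lt hg.lt
        have h5 := h.add_two_le (i + k)
        rw [show p i + 2 - 2 = p i by omega, h.count_apply,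
          (h.count_eq_iff (p (i + k + 1) + 1 - 2) (i + k)).2 (by omega)] at hcount
        rw [show p i + 2 - 2 = p i by omega]
        omega
  have hzero : ∃ r ∈ semiAbReturns w (wordAt w (p i₁ + 1 - o) n), r.count true = 0 := by
    have h1 := hpj i₁
    refine ⟨_, ⟨p i₁ + 1 - o, p i₁ + 2 - o,
      (hmem _ (by omega)).2 ⟨i₁, 0, hg₁.1, by omega, by omega⟩,
      (hmem _ (by omega)).2 ⟨i₁, 1, hg₁.1, by omega, by omega⟩, by omega, by intros; omega, rfl⟩,
      ?_⟩
    rw [show p i₁ + 2 - o - (p i₁ + 1 - o) = 1 by omega]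
    suffices w (p i₁ + 1 - o) = false by simp [wordAt, this]
    rw [← Bool.not_eq_true, h.apply_eq_true_iff]
    rintro ⟨j, hj⟩
    rcases lt_trichotomy j i₁ with hlt | rfl | hlt
    · have := (h.add_two_le j).trans (h.strictMono.monotone hlt)
      omega
    · omega
    · have := (h.add_two_le i₁).trans (h.strictMono.monotone hlt)
      omega
  obtain ⟨r₀, hr₀, hc₀⟩ := hzero
  obtain ⟨r₁, hr₁, hc₁⟩ := hreturn hg₁
  obtain ⟨r₂, hr₂, hc₂⟩ := hreturn hg₂
  obtain ⟨r₃, hr₃, hc₃⟩ := hreturn hg₃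
  have l₁ := hg₁.lt
  have l₂ := hg₂.lt
  have l₃ := hg₃.lt
  have := (hret _ (isFactorW_wordAt _ _ _) (wordAt_ne_nil _ _ hn)).count_eq_count hr₀ hr₁ hr₂ hr₃
    (by omega) (by omega) (by omega)
  rwa [hc₁, hc₂, hc₃] at this

lemma apply_add_congr (h : SpacedOnes w p a d) {i i' c : ℕ}
    (hv : ∀ k < c, longGaps p a d (i + k) = longGaps p a d (i' + k)) {l : ℕ} (hl : l ≤ c) :
    p (i + l) + p i' = p (i' + l) + p i := by
  rw [h.apply_add, h.apply_add, windowCount_congr fun k hk => hv k (by omega)]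
  ring

lemma eq_of_longGaps_eq (h : SpacedOnes w p a d) {i i' c y : ℕ}
    (hv : ∀ k < c, longGaps p a d (i + k) = longGaps p a d (i' + k)) (hy : p i + y ≤ p (i + c)) :
    w (p i + y) = w (p i' + y) := by
  have himp : ∀ {i i'}, (∀ k < c, longGaps p a d (i + k) = longGaps p a d (i' + k)) →
      p i + y ≤ p (i + c) → w (p i + y) = true → w (p i' + y) = true := by
    intro i i' hv hy hw
    rw [h.apply_eq_true_iff] at hw ⊢
    obtain ⟨j, hj⟩ := hw
    have h1 : i ≤ j := by rw [← h.strictMono.le_iff_le]; omega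
    have h2 : j ≤ i + c := by rw [← h.strictMono.le_iff_le]; omega
    obtain ⟨l, rfl⟩ := Nat.exists_eq_add_of_le h1
    have := h.apply_add_congr hv (l := l) (by omega)
    exact ⟨i' + l, by omega⟩
  have := h.apply_add_congr hv le_rfl
  exact Bool.eq_iff_iff.2 ⟨himp hv hy, himp (fun k hk => (hv k hk).symm) (by omega)⟩

lemma twoGapWords_of_count (h : SpacedOnes w p a d) (hrec : RecurrentW w) {n m o : ℕ}
    {X : ℕ → Prop} (hn : 0 < n) (ho : o ≤ 1) (hne : ∃ j, X j)
    (hX : ∀ x, p 0 + 1 ≤ x + o →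
      ((wordAt w x n).count true = m ↔ ∃ j f, X j ∧ f < 1 ∧ x + o = p j + 1 + f))
    (hret : ∀ u, IsFactorW w u → u ≠ [] → AtLeastTwoSemiAbReturns w u) :
    TwoGapWords (longGaps p a d) X := by
  intro N
  obtain ⟨j₀, hj₀⟩ := hne
  have hp0 := h.zero_pos
  have hpj : ∀ j, p 0 ≤ p j := fun j => h.strictMono.monotone (Nat.zero_le j)
  set u := wordAt w (p j₀ + 1 - o) n with hu
  have hmem : ∀ x, x ∈ abOcc w u ↔ (wordAt w x n).count true = m := by
    intro x
    have := hpj j₀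
    rw [mem_abOcc_iff, length_wordAt,
      (hX (p j₀ + 1 - o) (by omega)).2 ⟨j₀, 0, hj₀, one_pos, by omega⟩]
  have hlate : ∀ r ∈ semiAbReturns w u, ∃ i j, N ≤ i ∧ IsGap X i j ∧
      r = wordAt w (p i + 1 - o) (p j - p i) := by
    rintro r ⟨x, y, hx, hy, hxy, hno, rfl⟩
    obtain ⟨x', hx'N, hx'⟩ := hrec.exists_late x (y - x + n) (p N + 1)
    have hword : ∀ k ≤ y - x, wordAt w (x' + k) n = wordAt w (x + k) n := by
      intro k hk
      rw [wordAt_eq_wordAt_iff]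
      intro l hl
      rw [add_assoc, add_assoc]
      exact hx' _ (by omega)
    have hpN := hpj N
    have hocc : ∀ k ≤ y - x, (x + k ∈ abOcc w u ↔ ∃ j, X j ∧ x' + k + o = p j + 1) := by
      intro k hk
      rw [hmem, ← hword k hk, hX _ (by omega)]
      constructor
      · rintro ⟨j, f, hj, hf, he⟩
        exact ⟨j, hj, by omega⟩
      · rintro ⟨j, hj, he⟩
        exact ⟨j, 0, hj, one_pos, he⟩
    obtain ⟨i, hi, hei⟩ := (hocc 0 (Nat.zero_le _)).1 hx
    obtain ⟨j, hj, hej⟩ := (hocc (y - x) le_rfl).1 (by rwa [show x + (y - x) = y by omega])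
    refine ⟨i, j, ?_, ⟨hi, hj, ?_, fun k hk hk' hXk => ?_⟩, ?_⟩
    · rw [← h.strictMono.le_iff_le]; omega
    · rw [← h.strictMono.lt_iff_lt]; omega
    · have h1 := h.strictMono hk
      have h2 := h.strictMono hk'
      refine hno (x + (p k + 1 - o - x')) (by omega) (by omega) ?_
      exact (hocc _ (by omega)).2 ⟨k, hXk, by omega⟩
    · rw [show p j - p i = y - x by omega, show p i + 1 - o = x' by omega, eq_comm,
        wordAt_eq_wordAt_iff]
      exact fun k hk => hx' k (by omega)
  obtain ⟨r₁, r₂, hr₁, hr₂, hne⟩ := hret u (isFactorW_wordAt _ _ _) (wordAt_ne_nil _ _ hn)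
  obtain ⟨i, j, hi, hg, rfl⟩ := hlate r₁ hr₁
  obtain ⟨i', j', hi', hg', rfl⟩ := hlate r₂ hr₂
  refine ⟨i, j, i', j', hi, hi', hg, hg', fun ⟨hlen, hv⟩ => hne ?_⟩
  have l₁ := hg.lt
  have l₂ := hg'.lt
  have hpp := h.apply_add_congr hv le_rfl
  rw [show i + (j - i) = j by omega, show i' + (j - i) = j' by omega] at hpp
  have m₁ := h.strictMono l₁
  have m₂ := h.strictMono l₂
  rw [show p j' - p i' = p j - p i by omega, wordAt_eq_wordAt_iff]
  intro k hk
  rcases Nat.eq_zero_or_pos (1 - o + k) with h0 | h0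
  · have ho1 : o = 1 := by omega
    have hk0 : k = 0 := by omega
    subst ho1 hk0
    simp [(h.apply_eq_true_iff _).2 ⟨i, rfl⟩, (h.apply_eq_true_iff _).2 ⟨i', rfl⟩]
  · rw [show p i + 1 - o + k = p i + (1 - o + k) by omega,
      show p i' + 1 - o + k = p i' + (1 - o + k) by omega]
    refine h.eq_of_longGaps_eq hv ?_
    rw [show i + (j - i) = j by omega]
    omega

lemma recurrent_longGaps (h : SpacedOnes w p a d) (hrec : RecurrentW w) (i n N : ℕ) :
    ∃ i', N ≤ i' ∧ ∀ k < n, longGaps p a d (i' + k) = longGaps p a d (i + k) := by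
  obtain ⟨x, hx, hx'⟩ := hrec.exists_late (p i) (p (i + n) - p i + 1) (p N)
  have h0 := hx' 0 (by omega)
  rw [add_zero, add_zero, (h.apply_eq_true_iff (p i)).2 ⟨i, rfl⟩, h.apply_eq_true_iff] at h0
  obtain ⟨j, rfl⟩ := h0
  have hmono : ∀ k, p k < p (k + 1) := fun k => h.strictMono k.lt_succ_self
  have key : ∀ k ≤ n, p (j + k) + p i = p (i + k) + p j := by
    intro k hk
    induction k with
    | zero => simp [add_comm]
    | succ k ih =>
      have ih := ih (by omega)
      have h1 : p (i + (k + 1)) ≤ p (i + n) := h.strictMono.monotone (by omega)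
      have h2 : p i ≤ p (i + k) := h.strictMono.monotone (by omega)
      have h3 : p j ≤ p (j + k) := h.strictMono.monotone (by omega)
      have h4 := hmono (i + k)
      have h5 := hmono (j + k)
      rw [add_assoc] at h4 h5
      rcases lt_trichotomy (p (j + (k + 1)) + p i) (p (i + (k + 1)) + p j) with hlt | heq | hlt
      · have hw := hx' (p (j + (k + 1)) - p j) (by omega)
        rw [show p j + (p (j + (k + 1)) - p j) = p (j + (k + 1)) by omega,
          (h.apply_eq_true_iff _).2 ⟨_, rfl⟩, eq_comm, h.apply_eq_true_iff] at hw
        obtain ⟨l, hl⟩ := hw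
        have h6 : i + k < l := by rw [← h.strictMono.lt_iff_lt]; omega
        have h7 : l < i + (k + 1) := by rw [← h.strictMono.lt_iff_lt]; omega
        omega
      · exact heq
      · have hw := hx' (p (i + (k + 1)) - p i) (by omega)
        rw [show p i + (p (i + (k + 1)) - p i) = p (i + (k + 1)) by omega,
          (h.apply_eq_true_iff (p (i + (k + 1)))).2 ⟨_, rfl⟩, h.apply_eq_true_iff] at hw
        obtain ⟨l, hl⟩ := hw
        have h6 : j + k < l := by rw [← h.strictMono.lt_iff_lt]; omega
        have h7 : l < j + (k + 1) := by rw [← h.strictMono.lt_iff_lt]; omega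
        omega
  refine ⟨j, h.strictMono.le_iff_le.1 hx, fun k hk => ?_⟩
  have e1 := key k hk.le
  have e2 := key (k + 1) hk
  rw [← add_assoc, ← add_assoc] at e2
  unfold longGaps
  rw [decide_eq_decide]
  omega

lemma extremalGaps (h : SpacedOnes w p a d) (hrec : RecurrentW w)
    (hret : ∀ u, IsFactorW w u → u ≠ [] → AtMostKAbReturns w u 3 ∧ AtLeastTwoSemiAbReturns w u) :
    ExtremalGaps (longGaps p a d) := by
  refine ⟨h.recurrent_longGaps hrec, fun c μ hc hext hne => ?_⟩
  have ha := h.two_le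
  have hd := h.two_le'
  have hca : a ≤ c * a := Nat.le_mul_of_pos_left a hc
  rcases hext with ⟨hμ, hle⟩ | ⟨-, hle⟩
  · have hdμ : d ≤ d * μ := Nat.le_mul_of_pos_right d hμ
    exact ⟨h.fewGaps_of_count (n := c * a + d * μ - 2) (o := 0) (by omega) (Or.inl rfl)
        (h.count_true_eq_iff_of_le hc hμ hle le_rfl two_pos) fun u hu hu' => (hret u hu hu').1,
      h.twoGapWords_of_count hrec (n := c * a + d * μ - 1) (o := 0) (by omega) (Nat.zero_le _) hne
        (h.count_true_eq_iff_of_le hc hμ hle one_le_two one_pos) fun u hu hu' => (hret u hu hu').2⟩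
  · exact ⟨h.fewGaps_of_count (n := c * a + d * μ + 2) (o := 2) (by omega) (Or.inr rfl)
        (fun x _ => h.count_true_eq_iff_of_ge hle le_rfl two_pos x)
        fun u hu hu' => (hret u hu hu').1,
      h.twoGapWords_of_count hrec (n := c * a + d * μ + 1) (o := 1) (by omega) le_rfl hne
        (fun x _ => h.count_true_eq_iff_of_ge hle one_le_two one_pos x)
        fun u hu hu' => (hret u hu hu').2⟩

end SpacedOnes

lemma spacedOnes_of_blocks {w : ℕ → Bool} {l₁ l₂ : ℕ} (hl₁ : 0 < l₁) (hl : l₁ + 2 ≤ l₂)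
    {s : ℕ → ℕ} (hs : s 0 = 0)
    (hblocks : ∀ n,
      wordAt w (s n) (s (n + 1) - s n) = List.replicate l₁ false ++ [true] ∨
      wordAt w (s n) (s (n + 1) - s n) = List.replicate l₂ false ++ [true]) :
    SpacedOnes w (fun n => s (n + 1) - 1) (l₁ + 1) (l₂ - l₁) := by
  have hb : ∀ n, ∃ l, (l = l₁ ∨ l = l₂) ∧ s (n + 1) = s n + (l + 1) ∧
      (∀ k < l, w (s n + k) = false) ∧ w (s n + l) = true := by
    intro n
    rcases hblocks n with h | h <;> obtain ⟨h1, h2, h3⟩ := wordAt_eq_replicate_append h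
    · exact ⟨l₁, Or.inl rfl, by omega, h2, h3⟩
    · exact ⟨l₂, Or.inr rfl, by omega, h2, h3⟩
  refine ⟨?_, fun x => ⟨fun hx => ?_, ?_⟩, fun j => ?_, by omega, by omega⟩
  · obtain ⟨l, hl, hs1, -⟩ := hb 0
    simp only [zero_add] at hs1 ⊢
    omega
  · have hmono : StrictMono s := strictMono_nat_of_lt_succ fun n => by
      obtain ⟨l, -, h, -⟩ := hb n; omega
    have hex : ∃ n, x < s n := ⟨x + 1, hmono.le_apply⟩
    classical
    obtain ⟨n, hn⟩ := Nat.exists_eq_succ_of_ne_zero (n := Nat.find hex) fun h0 => by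
      have := Nat.find_spec hex
      rw [h0, hs] at this
      omega
    have h1 := Nat.find_spec hex
    have h2 := Nat.find_min hex (m := n) (by omega)
    rw [hn, Nat.succ_eq_add_one] at h1
    obtain ⟨l, -, h3, h4, -⟩ := hb n
    refine ⟨n, ?_⟩
    by_contra hne
    have := h4 (x - s n) (by omega)
    rw [show s n + (x - s n) = x by omega, hx] at this
    exact absurd this (by simp)
  · rintro ⟨j, rfl⟩
    obtain ⟨l, -, h3, -, h5⟩ := hb j
    rwa [show s (j + 1) - 1 = s j + l by omega]
  · obtain ⟨l, h1, h2, -⟩ := hb (j + 1)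
    obtain ⟨l', -, h3, -⟩ := hb j
    omega

/-- If a recurrent binary word is an infinite concatenation of blocks `0^{l₁} 1` and
`0^{l₂} 1` with `0 < l₁ < l₂`, and every factor has at most three abelian returns and at
least two semi-abelian returns, then `l₂ = l₁ + 1`. -/
theorem stmt12 (w : ℕ → Bool) (hrec : RecurrentW w) (l₁ l₂ : ℕ)
    (hl₁ : 0 < l₁) (hl : l₁ < l₂)
    (hblocks : ∃ s : ℕ → ℕ, s 0 = 0 ∧ ∀ n,
      wordAt w (s n) (s (n + 1) - s n) = List.replicate l₁ false ++ [true] ∨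
      wordAt w (s n) (s (n + 1) - s n) = List.replicate l₂ false ++ [true])
    (h : ∀ u, IsFactorW w u → u ≠ [] →
      AtMostKAbReturns w u 3 ∧ AtLeastTwoSemiAbReturns w u) :
    l₂ = l₁ + 1 := by
  by_contra hne
  obtain ⟨s, hs, hb⟩ := hblocks
  exact not_extremalGaps _
    ((spacedOnes_of_blocks hl₁ (by omega) hs hb).extremalGaps hrec h)
end
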